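/- Let K₂ = { x ∈ (0,1) : the continued fraction expansion x = [0; a₁, a₂, a₃, …] satisfies a_n ∈ {1,2} for all n, and there is no index n with (a_n, a_{n+1}, a_{n+2}) = (1,2,1) }, and let D₂ = dim_H K₂ be its Hausdorff dimension. Then the level set of the dimension function at the value 2D₂ is exactly the closed interval d⁻¹({2D₂}) = [4√30/7, (16351+720√30)/6409]. -/

import Mathlib

open Filter Set MeasureTheory
open scoped ENNReal

/-- Finite continued fraction `[a 0; a 1, ..., a n]`. -/
noncomputable def cfConv : (ℕ → ℝ) → ℕ → ℝ
  | a, 0 => a 0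
  | a, n + 1 => a 0 + 1 / cfConv (fun i => a (i + 1)) n

/-- Value of the infinite continued fraction `[a 0; a 1, a 2, ...]`,
as the limit of its convergents. -/
noncomputable def cfVal (a : ℕ → ℝ) : ℝ := limUnder atTop (cfConv a)

/-- `λ_k(α) = [α_k; α_{k+1}, ...] + [0; α_{k-1}, α_{k-2}, ...]`. -/
noncomputable def lambdaVal (α : ℤ → ℕ) (k : ℤ) : ℝ :=
  cfVal (fun n => (α (k + n) : ℝ)) +
  cfVal (fun n => if n = 0 then 0 else (α (k - n) : ℝ))

/-- The Markov value `m(α) = sup_{k ∈ ℤ} λ_k(α)`. -/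
noncomputable def markovValue (α : ℤ → ℕ) : ℝ := ⨆ k : ℤ, lambdaVal α k

/-- The Markov spectrum. -/
def markovSpectrum : Set ℝ :=
  { x | ∃ α : ℤ → ℕ, (∀ n, 0 < α n) ∧ BddAbove (range (lambdaVal α)) ∧
      markovValue α = x }

/-- The dimension function `d(t) = dim_H (M ∩ (-∞, t))`. -/
noncomputable def dimFun (t : ℝ) : ℝ≥0∞ := dimH (markovSpectrum ∩ Iio t)

/-- The Gauss–Cantor set `K₂` of numbers in `(0,1)` whose continued fraction
expansion has all partial quotients in `{1,2}` and never contains the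
pattern `(1,2,1)`. -/
def K2 : Set ℝ :=
  { x | x ∈ Ioo (0 : ℝ) 1 ∧ ∃ a : ℕ → ℕ,
      a 0 = 0 ∧
      (∀ n, 1 ≤ n → a n = 1 ∨ a n = 2) ∧
      (∀ n, 1 ≤ n → ¬(a n = 1 ∧ a (n + 1) = 2 ∧ a (n + 2) = 1)) ∧
      x = cfVal (fun n => (a n : ℝ)) }

/-- The Möbius map `x ↦ [0; w₁, …, wₙ + x]`. -/
noncomputable def cfMap : List ℕ → ℝ → ℝ
  | [], x => x
  | a :: w, x => 1 / (a + cfMap w x)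

/-- The denominator of the Möbius map `cfMap w`, as a function of the point. -/
noncomputable def cfDen : List ℕ → ℝ → ℝ
  | [], _ => 1
  | a :: w, x => (a + cfMap w x) * cfDen w x

/-- A finite word with letters in `{1, 2}`. -/
def IsBin (w : List ℕ) : Prop := ∀ d ∈ w, d = 1 ∨ d = 2

/-- The denominator of the finite continued fraction `[0; w]`. -/
noncomputable def cfq (w : List ℕ) : ℝ := cfDen w 0

/-- The value of the continued fraction of the reversed word. -/
noncomputable def cfTheta (w : List ℕ) : ℝ := cfMap w.reverse 0

section basics

@[simp] theorem cfMap_nil (x : ℝ) : cfMap [] x = x := rfl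
@[simp] theorem cfMap_cons (a : ℕ) (w : List ℕ) (x : ℝ) :
    cfMap (a :: w) x = 1 / (a + cfMap w x) := rfl
@[simp] theorem cfDen_nil (x : ℝ) : cfDen [] x = 1 := rfl
@[simp] theorem cfDen_cons (a : ℕ) (w : List ℕ) (x : ℝ) :
    cfDen (a :: w) x = (a + cfMap w x) * cfDen w x := rfl

theorem cfMap_append (u v : List ℕ) (x : ℝ) : cfMap (u ++ v) x = cfMap u (cfMap v x) := by
  induction u with
  | nil => rfl
  | cons a u ih => simp [ih]

theorem cfDen_append (u v : List ℕ) (x : ℝ) :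
    cfDen (u ++ v) x = cfDen u (cfMap v x) * cfDen v x := by
  induction u with
  | nil => simp
  | cons a u ih => simp [ih, cfMap_append, mul_assoc]

@[simp] theorem isBin_nil : IsBin [] := by simp [IsBin]

theorem isBin_cons {a : ℕ} {w : List ℕ} : IsBin (a :: w) ↔ (a = 1 ∨ a = 2) ∧ IsBin w := by
  simp [IsBin]

theorem isBin_append {u v : List ℕ} : IsBin (u ++ v) ↔ IsBin u ∧ IsBin v := by
  simp only [IsBin, List.mem_append]
  constructor
  · exact fun h => ⟨fun d hd => h d (Or.inl hd), fun d hd => h d (Or.inr hd)⟩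
  · rintro ⟨h1, h2⟩ d (hd | hd)
    exacts [h1 d hd, h2 d hd]

theorem isBin_reverse {w : List ℕ} : IsBin w.reverse ↔ IsBin w := by simp [IsBin]

theorem IsBin.of_isInfix {u w : List ℕ} (hw : IsBin w) (h : u <:+: w) : IsBin u :=
  fun d hd => hw d (h.subset hd)

theorem one_le_cast_of_bin {a : ℕ} (h : a = 1 ∨ a = 2) : (1 : ℝ) ≤ a := by
  rcases h with rfl | rfl <;> norm_num

theorem cast_le_two_of_bin {a : ℕ} (h : a = 1 ∨ a = 2) : (a : ℝ) ≤ 2 := by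
  rcases h with rfl | rfl <;> norm_num

theorem cfMap_mem_Icc {w : List ℕ} (hw : IsBin w) {x : ℝ} (hx : x ∈ Icc (0 : ℝ) 1) :
    cfMap w x ∈ Icc (0 : ℝ) 1 := by
  induction w with
  | nil => simpa using hx
  | cons a w ih =>
    obtain ⟨ha, hw⟩ := isBin_cons.1 hw
    have h1 := one_le_cast_of_bin ha
    have h2 := ih hw
    have h3 : (1 : ℝ) ≤ a + cfMap w x := by linarith [h2.1]
    rw [cfMap_cons]
    exact ⟨by positivity, by rw [div_le_one (by linarith)]; exact h3⟩

theorem cfDen_pos {w : List ℕ} (hw : IsBin w) {x : ℝ} (hx : x ∈ Icc (0 : ℝ) 1) :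
    0 < cfDen w x := by
  induction w with
  | nil => simp
  | cons a w ih =>
    obtain ⟨ha, hw⟩ := isBin_cons.1 hw
    have h1 := one_le_cast_of_bin ha
    have h2 := cfMap_mem_Icc hw hx
    have := ih hw
    rw [cfDen_cons]
    exact mul_pos (by linarith [h2.1]) this

theorem cfMap_sub {w : List ℕ} (hw : IsBin w) {x y : ℝ} (hx : x ∈ Icc (0 : ℝ) 1)
    (hy : y ∈ Icc (0 : ℝ) 1) :
    cfMap w x - cfMap w y = (-1) ^ w.length * (x - y) / (cfDen w x * cfDen w y) := by
  induction w with
  | nil => simp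
  | cons a w ih =>
    obtain ⟨ha, hw⟩ := isBin_cons.1 hw
    have h1 := one_le_cast_of_bin ha
    have hx2 := cfMap_mem_Icc hw hx
    have hy2 := cfMap_mem_Icc hw hy
    have px : (a : ℝ) + cfMap w x ≠ 0 := by linarith [hx2.1]
    have py : (a : ℝ) + cfMap w y ≠ 0 := by linarith [hy2.1]
    have dx := (cfDen_pos hw hx).ne'
    have dy := (cfDen_pos hw hy).ne'
    have := ih hw
    rw [cfMap_cons, cfMap_cons, cfDen_cons, cfDen_cons, List.length_cons, pow_succ]
    have e : 1 / ((a : ℝ) + cfMap w x) - 1 / (a + cfMap w y) =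
      -(cfMap w x - cfMap w y) / ((a + cfMap w x) * (a + cfMap w y)) := by
      field_simp; ring
    rw [e, this]
    field_simp

theorem abs_cfMap_sub {w : List ℕ} (hw : IsBin w) {x y : ℝ} (hx : x ∈ Icc (0 : ℝ) 1)
    (hy : y ∈ Icc (0 : ℝ) 1) :
    |cfMap w x - cfMap w y| = |x - y| / (cfDen w x * cfDen w y) := by
  rw [cfMap_sub hw hx hy, abs_div, abs_mul, abs_pow, abs_neg, abs_one, one_pow, one_mul,
    abs_of_pos (mul_pos (cfDen_pos hw hx) (cfDen_pos hw hy))]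

theorem zero_mem_Icc01 : (0 : ℝ) ∈ Icc (0 : ℝ) 1 := ⟨le_rfl, zero_le_one⟩

theorem cfTheta_mem {w : List ℕ} (hw : IsBin w) : cfTheta w ∈ Icc (0 : ℝ) 1 :=
  cfMap_mem_Icc (isBin_reverse.2 hw) zero_mem_Icc01

theorem cfTheta_append (p w : List ℕ) : cfTheta (p ++ w) = cfMap w.reverse (cfTheta p) := by
  rw [cfTheta, List.reverse_append, cfMap_append]; rfl

theorem cfq_pos {w : List ℕ} (hw : IsBin w) : 0 < cfq w := cfDen_pos hw zero_mem_Icc01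

/-- The denominator is an affine function of the point. -/
theorem cfDen_eq {w : List ℕ} (hw : IsBin w) {x : ℝ} (hx : x ∈ Icc (0 : ℝ) 1) :
    cfDen w x = cfq w * (1 + cfTheta w * x) := by
  induction w using List.reverseRecOn generalizing x with
  | nil => simp [cfq, cfTheta]
  | append_singleton w a ih =>
    obtain ⟨hw, ha⟩ := isBin_append.1 hw
    have ha := (isBin_cons.1 ha).1
    have h1 := one_le_cast_of_bin ha
    have hθ := cfTheta_mem hw
    have key : ∀ y ∈ Icc (0 : ℝ) 1, cfDen (w ++ [a]) y = cfq w * (a + cfTheta w + y) := by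
      intro y hy
      have hy' : (a : ℝ) + y ≠ 0 := by linarith [hy.1]
      have hm : cfMap [a] y ∈ Icc (0 : ℝ) 1 :=
        cfMap_mem_Icc (isBin_cons.2 ⟨ha, isBin_nil⟩) hy
      rw [cfDen_append, ih hw hm]
      simp only [cfMap_cons, cfMap_nil, cfDen_cons, cfDen_nil]
      field_simp
      ring
    have hq : cfq (w ++ [a]) = cfq w * (a + cfTheta w) := by
      rw [cfq, key 0 zero_mem_Icc01, add_zero]
    have ht : cfTheta (w ++ [a]) = 1 / (a + cfTheta w) := by
      rw [cfTheta_append]; simp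
    have : (a : ℝ) + cfTheta w ≠ 0 := by linarith [hθ.1]
    rw [key x hx, hq, ht]
    field_simp

theorem cfq_append {u v : List ℕ} (hu : IsBin u) (hv : IsBin v) :
    cfq (u ++ v) = cfq u * (1 + cfTheta u * cfMap v 0) * cfq v := by
  rw [cfq, cfDen_append, cfDen_eq hu (cfMap_mem_Icc hv zero_mem_Icc01)]; rfl

theorem cfDen_ge {w : List ℕ} (hw : IsBin w) {x : ℝ} (hx : x ∈ Icc (0 : ℝ) 1) :
    cfq w ≤ cfDen w x := by
  rw [cfDen_eq hw hx]
  have h := mul_nonneg (cfTheta_mem hw).1 hx.1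
  nlinarith [cfq_pos hw]

theorem cfDen_le {w : List ℕ} (hw : IsBin w) {x : ℝ} (hx : x ∈ Icc (0 : ℝ) 1) :
    cfDen w x ≤ 2 * cfq w := by
  rw [cfDen_eq hw hx]
  have h := mul_le_one₀ (cfTheta_mem hw).2 hx.1 hx.2
  nlinarith [cfq_pos hw]

theorem cfq_append_ge {u v : List ℕ} (hu : IsBin u) (hv : IsBin v) :
    cfq u * cfq v ≤ cfq (u ++ v) := by
  rw [cfq.eq_1 (u ++ v), cfDen_append]
  exact mul_le_mul_of_nonneg_right (cfDen_ge hu (cfMap_mem_Icc hv zero_mem_Icc01)) (cfq_pos hv).le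

theorem cfq_append_le {u v : List ℕ} (hu : IsBin u) (hv : IsBin v) :
    cfq (u ++ v) ≤ 2 * cfq u * cfq v := by
  rw [cfq, cfDen_append]
  exact mul_le_mul_of_nonneg_right (cfDen_le hu (cfMap_mem_Icc hv zero_mem_Icc01)) (cfq_pos hv).le

theorem one_le_cfq {w : List ℕ} (hw : IsBin w) : 1 ≤ cfq w := by
  induction w with
  | nil => simp [cfq]
  | cons a w ih =>
    obtain ⟨ha, hw⟩ := isBin_cons.1 hw
    have h1 := one_le_cast_of_bin ha
    have h2 := (cfMap_mem_Icc hw zero_mem_Icc01).1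
    have h3 := ih hw
    rw [cfq, cfDen_cons]
    change 1 ≤ (a + cfMap w 0) * cfq w
    nlinarith

theorem cfq_singleton (a : ℕ) : cfq [a] = a := by simp [cfq]

theorem cfq_snoc_le {w : List ℕ} (hw : IsBin w) {a : ℕ} (ha : a = 1 ∨ a = 2) :
    cfq (w ++ [a]) ≤ 3 * cfq w := by
  have hb : IsBin [a] := isBin_cons.2 ⟨ha, isBin_nil⟩
  have hm : cfMap [a] 0 = 1 / (a : ℝ) := by simp
  rw [cfq_append hw hb, cfq_singleton, hm]
  have h1 := one_le_cast_of_bin ha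
  have h2 := cast_le_two_of_bin ha
  have hθ := cfTheta_mem hw
  have hq := cfq_pos hw
  have e : cfq w * (1 + cfTheta w * (1 / (a : ℝ))) * a = cfq w * (a + cfTheta w) := by
    field_simp
  rw [e]
  nlinarith [hθ.2]

theorem cfq_mono_isPrefix {u w : List ℕ} (hw : IsBin w) (h : u <+: w) : cfq u ≤ cfq w := by
  obtain ⟨v, rfl⟩ := h
  obtain ⟨hu, hv⟩ := isBin_append.1 hw
  have := cfq_append_ge hu hv
  nlinarith [one_le_cfq hv, cfq_pos hu]

theorem two_le_cfq_pair {a b : ℕ} (ha : a = 1 ∨ a = 2) (hb : b = 1 ∨ b = 2) :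
    2 ≤ cfq [a, b] := by
  rcases ha with rfl | rfl <;> rcases hb with rfl | rfl <;> norm_num [cfq]

theorem two_pow_le_cfq {n : ℕ} {w : List ℕ} (hw : IsBin w) (h : 2 * n ≤ w.length) :
    2 ^ n ≤ cfq w := by
  induction n generalizing w with
  | zero => simpa using one_le_cfq hw
  | succ n ih =>
    match w, h with
    | a :: b :: w, h =>
      obtain ⟨ha, hw⟩ := isBin_cons.1 hw
      obtain ⟨hb, hw⟩ := isBin_cons.1 hw
      have h3 := ih hw (by simp at h; omega)
      have h4 := cfq_append_ge (isBin_cons.2 ⟨ha, isBin_cons.2 ⟨hb, isBin_nil⟩⟩) hw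
      have h5 := two_le_cfq_pair ha hb
      change _ ≤ cfq ([a, b] ++ w)
      have : (0 : ℝ) < 2 ^ n := by positivity
      rw [pow_succ]
      nlinarith

/-- The cylinder of a word has size at most the inverse square of its denominator. -/
theorem abs_cfMap_sub_le {w : List ℕ} (hw : IsBin w) {x y : ℝ} (hx : x ∈ Icc (0 : ℝ) 1)
    (hy : y ∈ Icc (0 : ℝ) 1) : |cfMap w x - cfMap w y| ≤ |x - y| / cfq w ^ 2 := by
  rw [abs_cfMap_sub hw hx hy, sq]
  have hq := cfq_pos hw
  have h1 := cfDen_ge hw hx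
  have h2 := cfDen_ge hw hy
  gcongr
  exact hq.le.trans h1

theorem abs_cfMap_sub_ge {w : List ℕ} (hw : IsBin w) {x y : ℝ} (hx : x ∈ Icc (0 : ℝ) 1)
    (hy : y ∈ Icc (0 : ℝ) 1) : |x - y| / (4 * cfq w ^ 2) ≤ |cfMap w x - cfMap w y| := by
  rw [abs_cfMap_sub hw hx hy]
  have hq := cfq_pos hw
  have h1 := cfDen_pos hw hx
  have h2 := cfDen_pos hw hy
  have h3 := cfDen_le hw hx
  have h4 := cfDen_le hw hy
  exact div_le_div_of_nonneg_left (abs_nonneg _) (by positivity) (by nlinarith)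

theorem abs_sub_le_one_of_mem {x y : ℝ} (hx : x ∈ Icc (0 : ℝ) 1) (hy : y ∈ Icc (0 : ℝ) 1) :
    |x - y| ≤ 1 := by
  rw [abs_le]; constructor <;> linarith [hx.1, hx.2, hy.1, hy.2]

theorem abs_cfMap_sub_le_inv {w : List ℕ} (hw : IsBin w) {x y : ℝ} (hx : x ∈ Icc (0 : ℝ) 1)
    (hy : y ∈ Icc (0 : ℝ) 1) : |cfMap w x - cfMap w y| ≤ 1 / cfq w ^ 2 :=
  (abs_cfMap_sub_le hw hx hy).trans (by
    have := cfq_pos hw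
    gcongr
    exact abs_sub_le_one_of_mem hx hy)

/-- The interval containing every continued fraction with letters in `{1, 2}`. -/
abbrev binHull : Set ℝ := Icc (1 / 3 : ℝ) (3 / 4)

theorem binHull_subset : binHull ⊆ Icc (0 : ℝ) 1 := Icc_subset_Icc (by norm_num) (by norm_num)

theorem cfMap_mem_binHull {w : List ℕ} (hw : IsBin w) {x : ℝ} (hx : x ∈ binHull) :
    cfMap w x ∈ binHull := by
  induction w with
  | nil => simpa using hx
  | cons a w ih =>
    obtain ⟨ha, hw⟩ := isBin_cons.1 hw
    obtain ⟨h1, h2⟩ := ih hw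
    rw [cfMap_cons]
    have : (0 : ℝ) < a + cfMap w x := by linarith [one_le_cast_of_bin ha]
    constructor
    · rw [le_div_iff₀ this]; linarith [cast_le_two_of_bin ha]
    · rw [div_le_iff₀ this]; linarith [one_le_cast_of_bin ha]

/-- Points whose expansions differ right after a common prefix are separated. -/
theorem cfMap_separated {w u v : List ℕ} {a b : ℕ} (hw : IsBin w) (ha : a = 1 ∨ a = 2)
    (hb : b = 1 ∨ b = 2) (hab : a ≠ b) (hu : IsBin u) (hv : IsBin v) {x y : ℝ}
    (hx : x ∈ binHull) (hy : y ∈ binHull) :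
    1 / (32 * cfq w ^ 2) ≤ |cfMap (w ++ a :: u) x - cfMap (w ++ b :: v) y| := by
  have hX := cfMap_mem_binHull (isBin_cons.2 ⟨ha, hu⟩) hx
  have hY := cfMap_mem_binHull (isBin_cons.2 ⟨hb, hv⟩) hy
  rw [cfMap_append, cfMap_append]
  refine le_trans ?_ (abs_cfMap_sub_ge hw (binHull_subset hX) (binHull_subset hY))
  have h8 : (1 / 8 : ℝ) ≤ |cfMap (a :: u) x - cfMap (b :: v) y| := by
    have h1 := cfMap_mem_binHull hu hx
    have h2 := cfMap_mem_binHull hv hy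
    have key : ∀ s ∈ binHull, ∀ t ∈ binHull, (1 / 8 : ℝ) ≤ 1 / (1 + s) - 1 / (2 + t) := by
      intro s hs t ht
      have e1 : (4 / 7 : ℝ) ≤ 1 / (1 + s) := by
        rw [le_div_iff₀ (by linarith [hs.1])]; linarith [hs.2]
      have e2 : 1 / (2 + t) ≤ (3 / 7 : ℝ) := by
        rw [div_le_iff₀ (by linarith [ht.1])]; linarith [ht.1]
      linarith
    rw [cfMap_cons, cfMap_cons]
    rcases ha with rfl | rfl <;> rcases hb with rfl | rfl
    · exact absurd rfl hab
    · push_cast; exact (key _ h1 _ h2).trans (le_abs_self _)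
    · push_cast; rw [abs_sub_comm]; exact (key _ h2 _ h1).trans (le_abs_self _)
    · exact absurd rfl hab
  have hq := cfq_pos hw
  calc 1 / (32 * cfq w ^ 2) = (1 / 8) / (4 * cfq w ^ 2) := by field_simp; norm_num
    _ ≤ _ := by gcongr

end basics

section infinite

theorem cfConv_mem {a : ℕ → ℝ} (h : ∀ n, 1 ≤ a (n + 1)) (n : ℕ) :
    cfConv a n ∈ Icc (a 0) (a 0 + 1) := by
  induction n generalizing a with
  | zero => simp [cfConv]
  | succ n ih =>
    have h1 := ih (a := fun i => a (i + 1)) (fun n => h (n + 1))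
    have h2 : 1 ≤ cfConv (fun i => a (i + 1)) n := (h 0).trans h1.1
    rw [cfConv]
    refine ⟨by linarith [one_div_pos.2 (zero_lt_one.trans_le h2)], ?_⟩
    have : 1 / cfConv (fun i => a (i + 1)) n ≤ 1 := by
      rw [div_le_one (by linarith)]; exact h2
    linarith

theorem abs_cfConv_sub_le {k : ℕ} {a : ℕ → ℝ} (h : ∀ n, 1 ≤ a (n + 1)) {n m : ℕ}
    (hn : 2 * k ≤ n) (hm : 2 * k ≤ m) : |cfConv a n - cfConv a m| ≤ (1 / 4) ^ k := by
  induction k generalizing a n m with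
  | zero =>
    have h1 := cfConv_mem h n
    have h2 := cfConv_mem h m
    rw [pow_zero, abs_le]; constructor <;> linarith [h1.1, h1.2, h2.1, h2.2]
  | succ k ih =>
    obtain ⟨n, rfl⟩ : ∃ n', n = n' + 2 := ⟨n - 2, by omega⟩
    obtain ⟨m, rfl⟩ : ∃ n', m = n' + 2 := ⟨m - 2, by omega⟩
    have h0 := ih (a := fun i => a (i + 1 + 1)) (n := n) (m := m) (fun n => h (n + 2))
      (by omega) (by omega)
    have h1 := (cfConv_mem (a := fun i => a (i + 1 + 1)) (fun n => h (n + 2)) n).1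
    have h2 := (cfConv_mem (a := fun i => a (i + 1 + 1)) (fun n => h (n + 2)) m).1
    simp only [cfConv]
    set X := cfConv (fun i => a (i + 1 + 1)) n
    set Y := cfConv (fun i => a (i + 1 + 1)) m
    have hb := h 0
    have hc := h 1
    simp only [zero_add] at hb h1 h2 hc ⊢
    norm_num at h1 h2 hc
    set b := a 1
    have hX : 1 ≤ X := hc.trans h1
    have hY : 1 ≤ Y := hc.trans h2
    have e : a 0 + 1 / (b + 1 / X) - (a 0 + 1 / (b + 1 / Y)) =
        (X - Y) / ((b * X + 1) * (b * Y + 1)) := by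
      have : b * X + 1 ≠ 0 := by positivity
      have : b * Y + 1 ≠ 0 := by positivity
      field_simp
      ring
    have p1 : 2 ≤ b * X + 1 := by nlinarith
    have p2 : 2 ≤ b * Y + 1 := by nlinarith
    rw [e, abs_div, pow_succ, abs_of_pos (by positivity : 0 < (b * X + 1) * (b * Y + 1)),
      div_le_iff₀ (by positivity)]
    have : (0 : ℝ) < (1 / 4) ^ k := by positivity
    have p3 : 4 ≤ (b * X + 1) * (b * Y + 1) := by nlinarith
    nlinarith

theorem tendsto_cfConv {a : ℕ → ℝ} (h : ∀ n, 1 ≤ a (n + 1)) :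
    Tendsto (cfConv a) atTop (nhds (cfVal a)) := by
  have : CauchySeq (cfConv a) := by
    rw [Metric.cauchySeq_iff]
    intro ε hε
    obtain ⟨k, hk⟩ := exists_pow_lt_of_lt_one hε (by norm_num : (1 / 4 : ℝ) < 1)
    exact ⟨2 * k, fun m hm n hn => by
      rw [Real.dist_eq]; exact (abs_cfConv_sub_le h hm hn).trans_lt hk⟩
  exact this.tendsto_limUnder

theorem cfVal_ge {a : ℕ → ℝ} (h : ∀ n, 1 ≤ a (n + 1)) : a 0 ≤ cfVal a :=
  ge_of_tendsto' (tendsto_cfConv h) fun n => (cfConv_mem h n).1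

theorem cfVal_eq {a : ℕ → ℝ} (h : ∀ n, 1 ≤ a (n + 1)) :
    cfVal a = a 0 + 1 / cfVal (fun i => a (i + 1)) := by
  have h1 := tendsto_cfConv (a := fun i => a (i + 1)) (fun n => h (n + 1))
  have h2 : (cfVal fun i => a (i + 1)) ≠ 0 := by
    have := cfVal_ge (a := fun i => a (i + 1)) (fun n => h (n + 1))
    have := h 0
    simp only [zero_add] at *
    linarith
  have h3 := (tendsto_cfConv h).comp (tendsto_add_atTop_nat 1)
  refine tendsto_nhds_unique h3 ?_
  have := (tendsto_const_nhds (x := a 0)).add ((tendsto_const_nhds (x := (1 : ℝ))).div h1 h2)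
  exact this

/-- The first `n` terms of a sequence. -/
def seqTake (a : ℕ → ℕ) (n : ℕ) : List ℕ := (List.range n).map a

/-- The sequence without its first `n` terms. -/
def shift (a : ℕ → ℕ) (n : ℕ) : ℕ → ℕ := fun i => a (n + i)

/-- A finite word followed by a sequence. -/
def seqApp (w : List ℕ) (a : ℕ → ℕ) : ℕ → ℕ :=
  fun i => if i < w.length then w.getD i 0 else a (i - w.length)

@[simp] theorem shift_apply (a : ℕ → ℕ) (n i : ℕ) : shift a n i = a (n + i) := rfl
@[simp] theorem length_seqTake (a : ℕ → ℕ) (n : ℕ) : (seqTake a n).length = n := by simp [seqTake]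
@[simp] theorem shift_zero (a : ℕ → ℕ) : shift a 0 = a := by funext i; simp
theorem shift_shift (a : ℕ → ℕ) (n m : ℕ) : shift (shift a n) m = shift a (n + m) := by
  funext i; simp [add_assoc]

@[simp] theorem seqTake_zero (a : ℕ → ℕ) : seqTake a 0 = [] := rfl

theorem seqTake_succ (a : ℕ → ℕ) (n : ℕ) :
    seqTake a (n + 1) = a 0 :: seqTake (shift a 1) n := by
  simp [seqTake, List.range_succ_eq_map, Function.comp_def, shift, add_comm]

theorem seqTake_add (a : ℕ → ℕ) (n m : ℕ) :
    seqTake a (n + m) = seqTake a n ++ seqTake (shift a n) m := by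
  simp [seqTake, List.range_add, Function.comp_def, shift]

theorem seqApp_of_lt {w : List ℕ} {i : ℕ} (a : ℕ → ℕ) (h : i < w.length) :
    seqApp w a i = w[i] := by
  simp [seqApp, h]

theorem seqApp_add (w : List ℕ) (a : ℕ → ℕ) (i : ℕ) : seqApp w a (w.length + i) = a i := by
  simp [seqApp]

theorem shift_seqApp (w : List ℕ) (a : ℕ → ℕ) : shift (seqApp w a) w.length = a :=
  funext fun i => seqApp_add w a i

theorem seqTake_seqApp (w : List ℕ) (a : ℕ → ℕ) : seqTake (seqApp w a) w.length = w := by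
  apply List.ext_getElem (by simp)
  intro i h1 h2
  simp [seqTake, seqApp_of_lt a h2]

theorem seqApp_seqTake_shift (a : ℕ → ℕ) (n : ℕ) : seqApp (seqTake a n) (shift a n) = a := by
  funext i
  by_cases h : i < n
  · rw [seqApp_of_lt _ (by simpa using h)]; simp [seqTake]
  · simp only [seqApp, length_seqTake, h, if_false, shift_apply]
    congr 1; omega

theorem seqApp_append (u v : List ℕ) (a : ℕ → ℕ) :
    seqApp (u ++ v) a = seqApp u (seqApp v a) := by
  funext i
  by_cases h : i < u.length
  · rw [seqApp_of_lt _ h, seqApp_of_lt _ (by simp; omega), List.getElem_append_left h]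
  · obtain ⟨j, rfl⟩ : ∃ j, i = u.length + j := ⟨i - u.length, by omega⟩
    rw [seqApp_add]
    by_cases h2 : j < v.length
    · rw [seqApp_of_lt _ h2, seqApp_of_lt _ (by simp; omega),
        List.getElem_append_right (by omega)]
      simp
    · obtain ⟨k, rfl⟩ : ∃ k, j = v.length + k := ⟨j - v.length, by omega⟩
      rw [seqApp_add, ← add_assoc, ← List.length_append, seqApp_add]

/-- The value `[0; a₀, a₁, …]` of a sequence of positive integers. -/
noncomputable def cfv (a : ℕ → ℕ) : ℝ := 1 / cfVal (fun n => (a n : ℝ))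

/-- A sequence of positive integers. -/
def PosSeq (a : ℕ → ℕ) : Prop := ∀ n, 0 < a n

/-- A sequence with values in `{1, 2}`. -/
def BinSeq (a : ℕ → ℕ) : Prop := ∀ n, a n = 1 ∨ a n = 2

theorem BinSeq.posSeq {a : ℕ → ℕ} (h : BinSeq a) : PosSeq a := fun n => by
  rcases h n with h | h <;> rw [h] <;> norm_num

theorem PosSeq.drop {a : ℕ → ℕ} (h : PosSeq a) (n : ℕ) : PosSeq (shift a n) := fun m => h (n + m)
theorem BinSeq.drop {a : ℕ → ℕ} (h : BinSeq a) (n : ℕ) : BinSeq (shift a n) := fun m => h (n + m)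

theorem PosSeq.one_le {a : ℕ → ℕ} (h : PosSeq a) (n : ℕ) : (1 : ℝ) ≤ a n := by
  exact_mod_cast h n

theorem cfv_pos {a : ℕ → ℕ} (h : PosSeq a) : 0 < cfv a := by
  have h1 := cfVal_ge (a := fun n => (a n : ℝ)) (fun n => h.one_le (n + 1))
  have h2 := h.one_le 0
  exact one_div_pos.2 (by linarith)

theorem cfVal_seq {a : ℕ → ℕ} (h : PosSeq a) :
    cfVal (fun n => (a n : ℝ)) = a 0 + cfv (shift a 1) := by
  rw [cfVal_eq (fun n => h.one_le (n + 1)), cfv]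
  simp only [shift_apply, add_comm 1]

theorem cfv_eq {a : ℕ → ℕ} (h : PosSeq a) : cfv a = 1 / (a 0 + cfv (shift a 1)) := by
  rw [cfv, cfVal_seq h]

theorem cfv_lt_one {a : ℕ → ℕ} (h : PosSeq a) : cfv a < 1 := by
  rw [cfv_eq h, div_lt_one]
  · linarith [h.one_le 0, cfv_pos (h.drop 1)]
  · linarith [h.one_le 0, cfv_pos (h.drop 1)]

theorem cfv_mem_Icc {a : ℕ → ℕ} (h : PosSeq a) : cfv a ∈ Icc (0 : ℝ) 1 :=
  ⟨(cfv_pos h).le, (cfv_lt_one h).le⟩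

theorem cfv_take_drop {a : ℕ → ℕ} (h : PosSeq a) (n : ℕ) :
    cfv a = cfMap (seqTake a n) (cfv (shift a n)) := by
  induction n generalizing a with
  | zero => simp
  | succ n ih => rw [cfv_eq h, ih (h.drop 1), seqTake_succ, cfMap_cons, shift_shift, add_comm 1]

theorem posSeq_append {w : List ℕ} (hw : IsBin w) {a : ℕ → ℕ} (h : PosSeq a) :
    PosSeq (seqApp w a) := by
  intro i
  by_cases hi : i < w.length
  · rw [seqApp_of_lt _ hi]
    rcases hw _ (List.getElem_mem hi) with e | e <;> rw [e] <;> norm_num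
  · simp only [seqApp, hi, if_false]; exact h _

theorem binSeq_append {w : List ℕ} (hw : IsBin w) {a : ℕ → ℕ} (h : BinSeq a) :
    BinSeq (seqApp w a) := by
  intro i
  by_cases hi : i < w.length
  · rw [seqApp_of_lt _ hi]; exact hw _ (List.getElem_mem hi)
  · simp only [seqApp, hi, if_false]; exact h _

theorem cfv_append {w : List ℕ} (hw : IsBin w) {a : ℕ → ℕ} (h : PosSeq a) :
    cfv (seqApp w a) = cfMap w (cfv a) := by
  rw [cfv_take_drop (posSeq_append hw h) w.length, shift_seqApp, seqTake_seqApp]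

theorem BinSeq.isBin_take {a : ℕ → ℕ} (h : BinSeq a) (n : ℕ) : IsBin (seqTake a n) := by
  intro d hd
  obtain ⟨i, -, rfl⟩ := List.mem_map.1 hd
  exact h i

theorem cfv_mem_binHull {a : ℕ → ℕ} (h : BinSeq a) : cfv a ∈ binHull := by
  have low : ∀ {b : ℕ → ℕ}, BinSeq b → 1 / 3 ≤ cfv b := by
    intro b hb
    have h1 := cfv_pos (hb.drop 1).posSeq
    have h2 := cfv_lt_one (hb.drop 1).posSeq
    have h3 := one_le_cast_of_bin (hb 0)
    rw [cfv_eq hb.posSeq, le_div_iff₀ (by linarith)]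
    linarith [cast_le_two_of_bin (hb 0)]
  refine ⟨low h, ?_⟩
  have h1 := low (h.drop 1)
  have h3 := one_le_cast_of_bin (h 0)
  rw [cfv_eq h.posSeq, div_le_iff₀ (by linarith)]
  linarith

theorem lambdaVal_eq {α : ℤ → ℕ} (h : ∀ n, 0 < α n) (k : ℤ) :
    lambdaVal α k = α k + cfv (fun n => α (k + 1 + n)) + cfv (fun n => α (k - 1 - n)) := by
  have h1 : cfVal (fun n : ℕ => (α (k + n) : ℝ)) = α k + cfv (fun n => α (k + 1 + n)) := by
    rw [cfVal_eq (fun n => by exact_mod_cast h _), cfv]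
    have e1 : (fun i : ℕ => ((α (k + ((i + 1 : ℕ) : ℤ)) : ℕ) : ℝ)) =
        fun i : ℕ => (α (k + 1 + i) : ℝ) := by
      funext i; congr 2; push_cast; ring
    rw [e1]; simp
  have h2 : cfVal (fun n : ℕ => if n = 0 then 0 else (α (k - n) : ℝ)) =
      cfv (fun n => α (k - 1 - n)) := by
    rw [cfVal_eq, cfv]
    · have e2 : (fun i : ℕ => if i + 1 = 0 then (0 : ℝ) else ((α (k - ((i + 1 : ℕ) : ℤ)) : ℕ) : ℝ))
          = fun i : ℕ => (α (k - 1 - i) : ℝ) := by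
        funext i; rw [if_neg (by omega)]; congr 2; push_cast; ring
      rw [e2]; simp
    · intro n
      rw [if_neg (by omega)]
      exact_mod_cast h _
  rw [lambdaVal, h1, h2]

/-- Sequences with a common prefix have close values. -/
theorem abs_cfv_sub_le {a b : ℕ → ℕ} (ha : BinSeq a) (hb : BinSeq b) {n : ℕ}
    (h : seqTake a n = seqTake b n) : |cfv a - cfv b| ≤ 1 / cfq (seqTake a n) ^ 2 := by
  rw [cfv_take_drop ha.posSeq n, cfv_take_drop hb.posSeq n, ← h]
  exact abs_cfMap_sub_le_inv (ha.isBin_take n) (cfv_mem_Icc (ha.drop n).posSeq)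
    (cfv_mem_Icc (hb.drop n).posSeq)

end infinite

/-- A map defined on the boundary of the `H`-ary tree that separates points branching at level `i`
by at least `c * Λ ^ (-i)` has range of Hausdorff dimension at least `log H / log Λ`. -/
theorem le_dimH_range_of_separated {H : ℕ} {c Λ s : ℝ} (hc : 0 < c) (hΛ : 1 < Λ)
    (hs : Λ ^ s ≤ H) (z : (ℕ → Fin H) → ℝ)
    (hz : ∀ ω ω' : ℕ → Fin H, ∀ i, (∀ j < i, ω j = ω' j) → ω i ≠ ω' i →
      c ≤ |z ω - z ω'| * Λ ^ i) :
    ENNReal.ofReal s ≤ dimH (range z) := by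
  rcases le_or_gt s 0 with h0 | h0
  · simp [ENNReal.ofReal_of_nonpos h0]
  have hH : 1 < H := by
    have : (1 : ℝ) < Λ ^ s := Real.one_lt_rpow hΛ h0
    exact_mod_cast this.trans_le hs
  have hΛ0 : 0 < Λ := zero_lt_one.trans hΛ
  have hdiff : ∀ ω ω' : ℕ → Fin H, ω ≠ ω' → ∃ i, (∀ j < i, ω j = ω' j) ∧ ω i ≠ ω' i := by
    intro ω ω' hne
    have hex : ∃ i, ω i ≠ ω' i := by
      by_contra! h
      exact hne (funext h)
    classical
    exact ⟨Nat.find hex, fun j hj => not_not.1 (Nat.find_min hex hj), Nat.find_spec hex⟩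
  have hinj : Function.Injective z := by
    intro ω ω' h
    by_contra hne
    obtain ⟨i, h1, h2⟩ := hdiff ω ω' hne
    have := hz ω ω' i h1 h2
    rw [h, sub_self, abs_zero, zero_mul] at this
    linarith
  let w0 : ℕ → Fin H := fun _ => ⟨0, by omega⟩
  have : Nonempty (ℕ → Fin H) := ⟨w0⟩
  let g : ℝ → ℝ := fun x => Real.ofDigits (Function.invFun z x)
  have hg : ∀ ω, g (z ω) = Real.ofDigits ω := fun ω => by
    simp only [g, Function.leftInverse_invFun hinj ω]
  let r : NNReal := ⟨s, h0.le⟩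
  let C : NNReal := ⟨(c⁻¹) ^ s, by positivity⟩
  have hold : HolderOnWith C r g (range z) := by
    rintro _ ⟨ω, rfl⟩ _ ⟨ω', rfl⟩
    rw [hg, hg]
    by_cases hne : ω = ω'
    · simp [hne]
    obtain ⟨i, h1, h2⟩ := hdiff ω ω' hne
    have h3 := hz ω ω' i h1 h2
    have h4 := Real.abs_ofDigits_sub_ofDigits_le h1
    have hreal : |Real.ofDigits ω - Real.ofDigits ω'| ≤ (c⁻¹) ^ s * |z ω - z ω'| ^ s := by
      refine h4.trans ?_
      rw [← Real.mul_rpow (by positivity) (abs_nonneg _)]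
      have h5 : (Λ ^ i)⁻¹ ≤ c⁻¹ * |z ω - z ω'| := by
        rw [inv_le_iff_one_le_mul₀ (by positivity)]
        have : 1 = c⁻¹ * c := by field_simp
        calc 1 = c⁻¹ * c := this
          _ ≤ c⁻¹ * (|z ω - z ω'| * Λ ^ i) := by gcongr
          _ = _ := by ring
      have h6 := Real.rpow_le_rpow (by positivity) h5 h0.le
      refine le_trans ?_ h6
      rw [Real.inv_rpow (by positivity)]
      gcongr
      rw [← Real.rpow_natCast Λ i, ← Real.rpow_mul hΛ0.le, mul_comm, Real.rpow_mul hΛ0.le,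
        Real.rpow_natCast]
      gcongr
    have hr : ((r : NNReal) : ℝ) = s := rfl
    rw [edist_dist, edist_dist, Real.dist_eq, Real.dist_eq, hr,
      ENNReal.ofReal_rpow_of_nonneg (abs_nonneg _) h0.le]
    have hC : ((C : NNReal) : ℝ≥0∞) = ENNReal.ofReal ((c⁻¹) ^ s) := by
      rw [← ENNReal.ofReal_coe_nnreal]; rfl
    rw [hC, ← ENNReal.ofReal_mul (by positivity)]
    exact ENNReal.ofReal_le_ofReal hreal
  have hrpos : 0 < r := h0
  have hdim := hold.dimH_image_le hrpos
  have himg : Icc (0 : ℝ) 1 ⊆ g '' range z := by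
    intro y hy
    obtain ⟨ω, -, hω⟩ := Real.ofDigits_SurjOn hH hy
    exact ⟨z ω, ⟨ω, rfl⟩, (hg ω).trans hω⟩
  have h1 : dimH (Icc (0 : ℝ) 1) = 1 := by
    rw [Real.dimH_of_nonempty_interior]
    · simp
    · simp
  have h2 : (1 : ℝ≥0∞) ≤ dimH (range z) / r := by
    rw [← h1]; exact (dimH_mono himg).trans hdim
  rw [ENNReal.le_div_iff_mul_le (by simp [hrpos.ne']) (by simp), one_mul] at h2
  convert h2 using 1
  rw [← ENNReal.ofReal_coe_nnreal]; rfl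

section overlap

variable {E ι : Type*} [Fintype E]

open Classical in
/-- The number of letters overlapping a given one. -/
noncomputable def overlapCount (O : E → E → Prop) (e : E) : ℕ :=
  (Finset.univ.filter fun e' => O e e').card

/-- The total logarithmic overlap along a path. -/
noncomputable def overlapCost (O : List E → E → E → Prop) : List E → List E → ℝ
  | _, [] => 0
  | p, e :: l => Real.log (overlapCount (O p) e) + overlapCost O (p ++ [e]) l

theorem overlapCount_pos {O : E → E → Prop} (hO : ∀ e, O e e) (e : E) : 1 ≤ overlapCount O e := by
  classical
  rw [overlapCount, Nat.one_le_iff_ne_zero, Finset.card_ne_zero]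
  exact ⟨e, by simp [hO]⟩

theorem overlapCost_nonneg {O : List E → E → E → Prop} (l p : List E) :
    0 ≤ overlapCost O p l := by
  induction l generalizing p with
  | nil => simp [overlapCost]
  | cons e l ih =>
    rw [overlapCost]
    exact add_nonneg (Real.log_natCast_nonneg _) (ih _)

variable [DecidableEq E]

/-- All words of length `n` over a finite alphabet. -/
def pathsOfLength (E : Type*) [Fintype E] [DecidableEq E] : ℕ → Finset (List E)
  | 0 => {[]}
  | n + 1 => (Finset.univ ×ˢ pathsOfLength E n).image fun x => x.1 :: x.2

theorem mem_pathsOfLength {n : ℕ} {l : List E} : l ∈ pathsOfLength E n ↔ l.length = n := by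
  induction n generalizing l with
  | zero => simp [pathsOfLength]
  | succ n ih =>
    rcases l with _ | ⟨e, l⟩
    · simp [pathsOfLength]
    · simp [pathsOfLength, ih]

theorem sum_pathsOfLength_succ {n : ℕ} (f : List E → ℝ) :
    ∑ l ∈ pathsOfLength E (n + 1), f l = ∑ e : E, ∑ l ∈ pathsOfLength E n, f (e :: l) := by
  rw [pathsOfLength, Finset.sum_image, Finset.sum_product]
  rintro ⟨a, b⟩ - ⟨c, d⟩ - h
  simpa using h

theorem card_pathsOfLength (n : ℕ) : (pathsOfLength E n).card = Fintype.card E ^ n := by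
  induction n with
  | zero => simp [pathsOfLength]
  | succ n ih =>
    rw [pathsOfLength, Finset.card_image_of_injective, Finset.card_product, ih, pow_succ, mul_comm]
    · rfl
    · rintro ⟨a, b⟩ ⟨c, d⟩ h
      simpa using h

theorem sum_overlapCost_le {F : Finset ι} {O : ι → List E → E → E → Prop}
    (hO : ∀ c p e, O c p e e) {g : ℝ} (hg : 0 < g)
    (h : ∀ p e, ∑ c ∈ F, (overlapCount (O c p) e : ℝ) ≤ g * F.card) (n : ℕ) (p : List E) :
    ∑ c ∈ F, ∑ l ∈ pathsOfLength E n, overlapCost (O c) p l ≤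
      F.card * (n * (Fintype.card E : ℝ) ^ n * Real.log g) := by
  induction n generalizing p with
  | zero => simp [pathsOfLength, overlapCost]
  | succ n ih =>
    have hlog : ∀ e, ∑ c ∈ F, Real.log (overlapCount (O c p) e) ≤ F.card * Real.log g := by
      intro e
      have h1 : ∀ c ∈ F, Real.log (overlapCount (O c p) e) ≤
          Real.log g + ((overlapCount (O c p) e : ℝ) / g - 1) := by
        intro c _
        have h2 : (0 : ℝ) < overlapCount (O c p) e := by
          exact_mod_cast overlapCount_pos (hO c p) e
        have h3 := Real.log_le_sub_one_of_pos (div_pos h2 hg)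
        rw [Real.log_div h2.ne' hg.ne'] at h3
        linarith
      refine (Finset.sum_le_sum h1).trans ?_
      rw [Finset.sum_add_distrib, Finset.sum_sub_distrib, ← Finset.sum_div]
      have := (div_le_iff₀ hg).2 ((h p e).trans_eq (mul_comm _ _))
      simp only [Finset.sum_const, nsmul_eq_mul, mul_one]
      linarith
    simp_rw [sum_pathsOfLength_succ, overlapCost, Finset.sum_add_distrib, Finset.sum_const,
      nsmul_eq_mul, card_pathsOfLength]
    rw [← Finset.sum_comm (s := Finset.univ), ← Finset.sum_comm (s := Finset.univ)]
    have h1 : ∑ e : E, ∑ c ∈ F, ((Fintype.card E ^ n : ℕ) : ℝ) * Real.log (overlapCount (O c p) e)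
        ≤ ∑ e : E, ((Fintype.card E : ℝ) ^ n) * (F.card * Real.log g) := by
      refine Finset.sum_le_sum fun e _ => ?_
      rw [← Finset.mul_sum, Nat.cast_pow]
      exact mul_le_mul_of_nonneg_left (hlog e) (by positivity)
    have h2 : ∑ e : E, ∑ c ∈ F, ∑ l ∈ pathsOfLength E n, overlapCost (O c) (p ++ [e]) l ≤
        ∑ e : E, (F.card : ℝ) * (n * (Fintype.card E : ℝ) ^ n * Real.log g) :=
      Finset.sum_le_sum fun e _ => ih (p ++ [e])
    refine (add_le_add h1 h2).trans_eq ?_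
    simp only [Finset.sum_const, nsmul_eq_mul, Finset.card_univ]
    push_cast
    ring

/-- Weighted count of a family of pairwise overlapping paths. -/
theorem sum_exp_neg_overlapCost_le {O : List E → E → E → Prop} (n : ℕ)
    (p : List E) (Q : Finset (List E)) (hQ : ∀ l ∈ Q, l.length = n)
    (hov : ∀ r e s e' s', r ++ e :: s ∈ Q → r ++ e' :: s' ∈ Q → O (p ++ r) e e') :
    ∑ l ∈ Q, Real.exp (-overlapCost O p l) ≤ 1 := by
  classical
  induction n generalizing p Q with
  | zero =>
    have : Q ⊆ {[]} := fun l hl => by simpa using hQ l hl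
    refine (Finset.sum_le_sum_of_subset_of_nonneg this fun _ _ _ => (Real.exp_pos _).le).trans ?_
    simp [overlapCost]
  | succ n ih =>
    have hsub : Q = (pathsOfLength E (n + 1)).filter (· ∈ Q) := by
      ext l
      simp only [Finset.mem_filter, mem_pathsOfLength]
      exact ⟨fun h => ⟨hQ l h, h⟩, fun h => h.2⟩
    rw [hsub, Finset.sum_filter, sum_pathsOfLength_succ]
    let T : Finset E := Finset.univ.filter fun e => ∃ l, e :: l ∈ Q
    have hle : ∀ e : E, ∑ l ∈ pathsOfLength E n,
        (if e :: l ∈ Q then Real.exp (-overlapCost O p (e :: l)) else 0) ≤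
          if e ∈ T then 1 / (T.card : ℝ) else 0 := by
      intro e
      by_cases he : e ∈ T
      · rw [if_pos he]
        have h1 : T.card ≤ overlapCount (O p) e := by
          refine Finset.card_le_card fun e' he' => ?_
          obtain ⟨l, hl⟩ := (Finset.mem_filter.1 he).2
          obtain ⟨l', hl'⟩ := (Finset.mem_filter.1 he').2
          simpa using hov [] e l e' l' hl hl'
        have hT : (0 : ℝ) < T.card := by exact_mod_cast Finset.card_pos.2 ⟨e, he⟩
        have hm : (0 : ℝ) < overlapCount (O p) e := hT.trans_le (by exact_mod_cast h1)
        have h2 := ih (p ++ [e]) ((pathsOfLength E n).filter fun l => e :: l ∈ Q)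
          (fun l hl => mem_pathsOfLength.1 (Finset.mem_filter.1 hl).1)
          (fun r e1 s e2 s' h1 h2 => by
            have := hov (e :: r) e1 s e2 s' (Finset.mem_filter.1 h1).2 (Finset.mem_filter.1 h2).2
            simpa using this)
        rw [Finset.sum_filter] at h2
        have h3 : ∀ l ∈ pathsOfLength E n,
            (if e :: l ∈ Q then Real.exp (-overlapCost O p (e :: l)) else 0) =
            1 / (overlapCount (O p) e : ℝ) *
              (if e :: l ∈ Q then Real.exp (-overlapCost O (p ++ [e]) l) else 0) := by
          intro l _
          split_ifs
          · rw [overlapCost, neg_add, Real.exp_add, Real.exp_neg, Real.exp_log hm, one_div]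
          · simp
        rw [Finset.sum_congr rfl h3, ← Finset.mul_sum]
        calc _ ≤ 1 / (overlapCount (O p) e : ℝ) * 1 := by gcongr
          _ ≤ _ := by
            rw [mul_one]
            exact one_div_le_one_div_of_le hT (by exact_mod_cast h1)
      · rw [if_neg he]
        refine (Finset.sum_eq_zero fun l _ => if_neg fun hl => he ?_).le
        exact Finset.mem_filter.2 ⟨Finset.mem_univ _, l, hl⟩
    refine (Finset.sum_le_sum fun e _ => hle e).trans ?_
    rw [Finset.sum_ite_mem, Finset.univ_inter, Finset.sum_const, nsmul_eq_mul]
    rcases T.card.eq_zero_or_pos with h | h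
    · simp [h]
    · rw [mul_one_div_cancel (Nat.cast_pos.2 h).ne']

/-- If overlaps are rare on average over a parameter `c`, then for some value of the parameter many
paths are mapped to well separated points. -/
theorem exists_separated_paths {F : Finset ι} (hF : F.Nonempty) {O : ι → List E → E → E → Prop}
    (hO : ∀ c p e, O c p e e) {g : ℝ} (hg : 1 < g)
    (h : ∀ p e, ∑ c ∈ F, (overlapCount (O c p) e : ℝ) ≤ g * F.card) {N : ℕ} (hN : 0 < N)
    (z : ι → List E → ℝ) {Δ : ℝ} (hΔ : 0 ≤ Δ)
    (hz : ∀ c r e s e' s', (r ++ e :: s).length = N → (r ++ e' :: s').length = N →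
      |z c (r ++ e :: s) - z c (r ++ e' :: s')| ≤ 2 * Δ → O c r e e') :
    ∃ c ∈ F, ∃ S ⊆ pathsOfLength E N,
      (∀ l ∈ S, ∀ l' ∈ S, l ≠ l' → Δ < |z c l - z c l'|) ∧
      (Fintype.card E : ℝ) ^ N ≤ 2 * g ^ (2 * N) * S.card := by
  classical
  have hlg : 0 < Real.log g := Real.log_pos hg
  have hNpos : (0 : ℝ) < N := by exact_mod_cast hN
  obtain ⟨c, hcF, hc⟩ : ∃ c ∈ F, ∑ l ∈ pathsOfLength E N, overlapCost (O c) [] l ≤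
      N * (Fintype.card E : ℝ) ^ N * Real.log g := by
    apply Finset.exists_le_of_sum_le hF
    rw [Finset.sum_const, nsmul_eq_mul]
    exact sum_overlapCost_le hO (zero_lt_one.trans hg) h N []
  let G := (pathsOfLength E N).filter fun l => overlapCost (O c) [] l ≤ 2 * N * Real.log g
  have hG : (Fintype.card E : ℝ) ^ N ≤ 2 * G.card := by
    let G' := (pathsOfLength E N).filter fun l => ¬ overlapCost (O c) [] l ≤ 2 * N * Real.log g
    have h1 : (G.card : ℝ) + G'.card = (Fintype.card E : ℝ) ^ N := by
      rw [← Nat.cast_pow, ← card_pathsOfLength, ← Nat.cast_add,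
        Finset.card_filter_add_card_filter_not]
    have h2 : G'.card * (2 * N * Real.log g) ≤ N * (Fintype.card E : ℝ) ^ N * Real.log g := by
      calc G'.card * (2 * N * Real.log g) = ∑ l ∈ G', 2 * N * Real.log g := by
            rw [Finset.sum_const, nsmul_eq_mul]
        _ ≤ ∑ l ∈ G', overlapCost (O c) [] l :=
            Finset.sum_le_sum fun l hl => (not_le.1 (Finset.mem_filter.1 hl).2).le
        _ ≤ ∑ l ∈ pathsOfLength E N, overlapCost (O c) [] l :=
            Finset.sum_le_sum_of_subset_of_nonneg (Finset.filter_subset _ _)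
              fun l _ _ => overlapCost_nonneg l []
        _ ≤ _ := hc
    have h3 : 2 * (G'.card : ℝ) ≤ (Fintype.card E : ℝ) ^ N := by
      have : 0 < N * Real.log g := by positivity
      nlinarith
    linarith
  let P : Finset (List E) → Prop := fun S => ∀ l ∈ S, ∀ l' ∈ S, l ≠ l' → Δ < |z c l - z c l'|
  obtain ⟨S, hS, hmax⟩ := Finset.exists_max_image (G.powerset.filter P) Finset.card
    ⟨∅, by simp [P]⟩
  rw [Finset.mem_filter, Finset.mem_powerset] at hS
  refine ⟨c, hcF, S, hS.1.trans (Finset.filter_subset _ _), hS.2, ?_⟩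
  let Q : List E → Finset (List E) := fun s => G.filter fun l => |z c l - z c s| ≤ Δ
  have hcov : G ⊆ S.biUnion Q := by
    intro l hl
    rw [Finset.mem_biUnion]
    by_contra! hno
    have hlS : l ∉ S := fun hlS => hno l hlS (by simp [Q, hl, hΔ])
    have hfar : ∀ s ∈ S, Δ < |z c l - z c s| := by
      intro s hs
      by_contra! hcon
      exact hno s hs (Finset.mem_filter.2 ⟨hl, hcon⟩)
    have := hmax (insert l S) (by
      rw [Finset.mem_filter, Finset.mem_powerset]
      refine ⟨Finset.insert_subset hl hS.1, ?_⟩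
      intro a ha b hb hab
      rw [Finset.mem_insert] at ha hb
      rcases ha with rfl | ha <;> rcases hb with rfl | hb
      · exact absurd rfl hab
      · exact hfar b hb
      · rw [abs_sub_comm]; exact hfar a ha
      · exact hS.2 a ha b hb hab)
    rw [Finset.card_insert_of_notMem hlS] at this
    omega
  have hcard : ∀ s ∈ S, ((Q s).card : ℝ) ≤ g ^ (2 * N) := by
    intro s hs
    have h1 := sum_exp_neg_overlapCost_le (O := O c) N [] (Q s)
      (fun l hl => mem_pathsOfLength.1
        (Finset.mem_filter.1 (Finset.mem_filter.1 hl).1).1)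
      (by
        intro r e t e' t' h1 h2
        have len : ∀ l ∈ Q s, l.length = N := fun l hl => mem_pathsOfLength.1
          (Finset.mem_filter.1 (Finset.mem_filter.1 hl).1).1
        refine hz c r e t e' t' (len _ h1) (len _ h2) ?_
        have a1 := (Finset.mem_filter.1 h1).2
        have a2 := (Finset.mem_filter.1 h2).2
        rw [abs_le] at a1 a2 ⊢
        constructor <;> linarith [a1.1, a1.2, a2.1, a2.2])
    have hgp : 0 < g ^ (2 * N) := by positivity
    have h2 : ((Q s).card : ℝ) * (g ^ (2 * N))⁻¹ ≤ 1 := by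
      refine le_trans ?_ h1
      rw [← nsmul_eq_mul, ← Finset.sum_const]
      refine Finset.sum_le_sum fun l hl => ?_
      have h3 := (Finset.mem_filter.1 (Finset.mem_filter.1 hl).1).2
      have h4 : (g ^ (2 * N))⁻¹ = Real.exp (-(2 * N * Real.log g)) := by
        rw [Real.exp_neg, mul_comm _ (Real.log g), Real.exp_mul, Real.exp_log (by linarith)]
        norm_cast
      rw [h4]
      exact Real.exp_le_exp.2 (neg_le_neg h3)
    rwa [mul_inv_le_iff₀ hgp, one_mul] at h2
  have hfin : (G.card : ℝ) ≤ g ^ (2 * N) * S.card := by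
    calc (G.card : ℝ) ≤ (S.biUnion Q).card := by exact_mod_cast Finset.card_le_card hcov
      _ ≤ ∑ s ∈ S, ((Q s).card : ℝ) := by exact_mod_cast Finset.card_biUnion_le
      _ ≤ ∑ s ∈ S, g ^ (2 * N) := Finset.sum_le_sum hcard
      _ = _ := by rw [Finset.sum_const, nsmul_eq_mul, mul_comm]
  linarith

end overlap

section rotation

/-- The `n`-fold repetition of a word. -/
def wrep (e : List ℕ) (n : ℕ) : List ℕ := (List.replicate n e).flatten

@[simp] theorem wrep_zero (e : List ℕ) : wrep e 0 = [] := rfl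

theorem wrep_succ (e : List ℕ) (n : ℕ) : wrep e (n + 1) = e ++ wrep e n := by
  simp [wrep, List.replicate_succ]

theorem wrep_add (e : List ℕ) (n m : ℕ) : wrep e (n + m) = wrep e n ++ wrep e m := by
  rw [wrep, ← List.replicate_append_replicate, List.flatten_append]; rfl

theorem wrep_one (e : List ℕ) : wrep e 1 = e := by simp [wrep]

theorem wrep_succ_right (e : List ℕ) (n : ℕ) : wrep e (n + 1) = wrep e n ++ e := by
  rw [wrep_add, wrep_one]

theorem length_wrep (e : List ℕ) (n : ℕ) : (wrep e n).length = n * e.length := by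
  simp [wrep]

theorem isBin_wrep {e : List ℕ} (he : IsBin e) (n : ℕ) : IsBin (wrep e n) := by
  induction n with
  | zero => simp
  | succ n ih => rw [wrep_succ]; exact isBin_append.2 ⟨he, ih⟩

theorem reverse_wrep (e : List ℕ) (n : ℕ) : (wrep e n).reverse = wrep e.reverse n := by
  induction n with
  | zero => rfl
  | succ n ih => rw [wrep_succ, List.reverse_append, ih, wrep_succ_right]

theorem cfMap_wrep_fixed {e : List ℕ} {x : ℝ} (hx : cfMap e x = x) (n : ℕ) :
    cfMap (wrep e n) x = x := by
  induction n with
  | zero => rfl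
  | succ n ih => rw [wrep_succ, cfMap_append, ih, hx]

theorem abs_cfTheta_sub_le {e P : List ℕ} (he : IsBin e) (hl : 2 ≤ e.length) (hP : IsBin P)
    {x : ℝ} (hx : x ∈ Icc (0 : ℝ) 1) (hfix : cfMap e.reverse x = x) (n : ℕ) :
    |cfTheta (P ++ wrep e n) - x| ≤ (1 / 4) ^ n := by
  have hb : IsBin (wrep e.reverse n) := isBin_wrep (isBin_reverse.2 he) n
  rw [cfTheta_append, reverse_wrep]
  nth_rewrite 1 [← cfMap_wrep_fixed hfix n]
  refine (abs_cfMap_sub_le_inv hb (cfTheta_mem hP) hx).trans ?_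
  have h1 : 2 ^ n ≤ cfq (wrep e.reverse n) :=
    two_pow_le_cfq hb (by rw [length_wrep, List.length_reverse]; nlinarith)
  rw [one_div_pow]
  apply one_div_le_one_div_of_le (by positivity)
  calc (4 : ℝ) ^ n = (2 ^ n) ^ 2 := by rw [← pow_mul, mul_comm, pow_mul]; norm_num
    _ ≤ _ := by gcongr

theorem abs_log_one_add_sub_le {x y : ℝ} (hx : 0 ≤ x) (hy : 0 ≤ y) :
    |Real.log (1 + x) - Real.log (1 + y)| ≤ |x - y| := by
  wlog h : y ≤ x generalizing x y
  · rw [abs_sub_comm, abs_sub_comm x]; exact this hy hx (le_of_not_ge h)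
  have h1 : Real.log (1 + y) ≤ Real.log (1 + x) := Real.log_le_log (by linarith) (by linarith)
  rw [abs_of_nonneg (by linarith), abs_of_nonneg (by linarith), ← Real.log_div (by linarith)
    (by linarith)]
  have h2 := Real.log_le_sub_one_of_pos (x := (1 + x) / (1 + y)) (by positivity)
  refine h2.trans ?_
  rw [sub_le_iff_le_add, div_le_iff₀ (by linarith)]
  nlinarith

/-- Inserting one more copy of `e` multiplies denominators by almost a constant. -/
theorem abs_log_cfDen_step_le {e P : List ℕ} (he : IsBin e) (hl : 2 ≤ e.length) (hP : IsBin P)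
    {x : ℝ} (hx : x ∈ Icc (0 : ℝ) 1) (hfix : cfMap e.reverse x = x) (n : ℕ) {y : ℝ}
    (hy : y ∈ Icc (0 : ℝ) 1) :
    |Real.log (cfDen (P ++ wrep e (n + 1)) y) - Real.log (cfDen (P ++ wrep e n) y) -
      Real.log (cfq e * (1 + x * cfMap e 0))| ≤ 3 * (1 / 4) ^ n := by
  set w := P ++ wrep e n with hw
  have hwb : IsBin w := isBin_append.2 ⟨hP, isBin_wrep he n⟩
  have hwe : P ++ wrep e (n + 1) = w ++ e := by rw [wrep_succ_right, hw, List.append_assoc]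
  have h1 : |cfTheta w - x| ≤ (1 / 4) ^ n := abs_cfTheta_sub_le he hl hP hx hfix n
  have h2 : |cfTheta (w ++ e) - x| ≤ (1 / 4) ^ n := by
    rw [← hwe]
    refine (abs_cfTheta_sub_le he hl hP hx hfix (n + 1)).trans ?_
    exact pow_le_pow_of_le_one (by norm_num) (by norm_num) (Nat.le_succ n)
  have hweb : IsBin (w ++ e) := isBin_append.2 ⟨hwb, he⟩
  have t1 := cfTheta_mem hwb
  have t2 := cfTheta_mem hweb
  have f0 := cfMap_mem_Icc he zero_mem_Icc01
  have q1 := cfq_pos hwb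
  have q2 := cfq_pos he
  rw [hwe, cfDen_eq hweb hy, cfDen_eq hwb hy, cfq_append hwb he]
  have p1 : 0 < 1 + cfTheta w * cfMap e 0 := by have := mul_nonneg t1.1 f0.1; linarith
  have p2 : 0 < 1 + cfTheta (w ++ e) * y := by have := mul_nonneg t2.1 hy.1; linarith
  have p3 : 0 < 1 + cfTheta w * y := by have := mul_nonneg t1.1 hy.1; linarith
  have p4 : 0 < 1 + x * cfMap e 0 := by have := mul_nonneg hx.1 f0.1; linarith
  rw [Real.log_mul (by positivity) p2.ne', Real.log_mul (by positivity) q2.ne',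
    Real.log_mul q1.ne' p1.ne', Real.log_mul q1.ne' p3.ne', Real.log_mul q2.ne' p4.ne']
  have b1 := abs_log_one_add_sub_le (mul_nonneg t1.1 f0.1) (mul_nonneg hx.1 f0.1)
  have b2 := abs_log_one_add_sub_le (mul_nonneg t2.1 hy.1) (mul_nonneg t1.1 hy.1)
  rw [← sub_mul, abs_mul, abs_of_nonneg f0.1] at b1
  rw [← sub_mul, abs_mul, abs_of_nonneg hy.1] at b2
  have b3 : |cfTheta (w ++ e) - cfTheta w| ≤ 2 * (1 / 4) ^ n := by
    rw [abs_le] at *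
    constructor <;> linarith [h1.1, h1.2, h2.1, h2.2]
  have c1 : |cfTheta w - x| * cfMap e 0 ≤ (1 / 4) ^ n := by
    nlinarith [abs_nonneg (cfTheta w - x), f0.1, f0.2]
  have c2 : |cfTheta (w ++ e) - cfTheta w| * y ≤ 2 * (1 / 4) ^ n := by
    nlinarith [abs_nonneg (cfTheta (w ++ e) - cfTheta w), hy.1, hy.2]
  have d1 := b1.trans c1
  have d2 := b2.trans c2
  rw [abs_le] at d1 d2 ⊢
  constructor <;> linarith [d1.1, d1.2, d2.1, d2.2]

theorem abs_log_cfDen_wrep_le {e P : List ℕ} (he : IsBin e) (hl : 2 ≤ e.length) (hP : IsBin P)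
    {x : ℝ} (hx : x ∈ Icc (0 : ℝ) 1) (hfix : cfMap e.reverse x = x) (n m : ℕ) {y : ℝ}
    (hy : y ∈ Icc (0 : ℝ) 1) :
    |Real.log (cfDen (P ++ wrep e (n + m)) y) - Real.log (cfDen (P ++ wrep e n) y) -
      m * Real.log (cfq e * (1 + x * cfMap e 0))| ≤ 4 * (1 / 4) ^ n := by
  have key : |Real.log (cfDen (P ++ wrep e (n + m)) y) - Real.log (cfDen (P ++ wrep e n) y) -
      m * Real.log (cfq e * (1 + x * cfMap e 0))| ≤ 4 * ((1 / 4) ^ n - (1 / 4) ^ (n + m)) := by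
    induction m with
    | zero => simp
    | succ m ih =>
      have h1 := abs_log_cfDen_step_le he hl hP hx hfix (n + m) hy
      rw [← add_assoc, pow_succ]
      rw [abs_le] at *
      push_cast
      constructor <;> linarith [h1.1, h1.2, ih.1, ih.2]
  refine key.trans ?_
  have : (0 : ℝ) < (1 / 4) ^ (n + m) := by positivity
  linarith

theorem irrational_log_ratio :
    Irrational (Real.log (17 + 12 * √2) / Real.log ((87 + √7565) / 2)) := by
  have s2 : √2 ^ 2 = 2 := Real.sq_sqrt (by norm_num)
  have s7 : √7565 ^ 2 = 7565 := Real.sq_sqrt (by norm_num)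
  have p2 : 0 < √2 := by positivity
  have p7 : 0 < √7565 := by positivity
  have la : 0 < Real.log (17 + 12 * √2) := Real.log_pos (by linarith)
  have lb : 0 < Real.log ((87 + √7565) / 2) := Real.log_pos (by linarith)
  rintro ⟨r, hr⟩
  have hrpos : 0 < r := by
    have : (0 : ℝ) < r := by rw [hr]; positivity
    exact_mod_cast this
  have hnum : 0 < r.num := Rat.num_pos.2 hrpos
  obtain ⟨n, hn⟩ : ∃ n : ℕ, r.num = n := ⟨r.num.toNat, by omega⟩
  have hn0 : 0 < n := by omega
  set m := r.den with hm
  have hm0 : 0 < m := r.den_pos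
  have heq : m * Real.log (17 + 12 * √2) = n * Real.log ((87 + √7565) / 2) := by
    have e1 : (r : ℝ) = n / m := by
      rw [Rat.cast_def, hn]; simp [hm]
    rw [e1, div_eq_div_iff (by positivity) lb.ne'] at hr
    linarith
  have hpow : (17 + 12 * √2) ^ m = ((87 + √7565) / 2) ^ n := by
    rw [← Real.log_pow, ← Real.log_pow] at heq
    exact Real.log_injOn_pos (by simp only [mem_Ioi]; positivity)
      (by simp only [mem_Ioi]; positivity) heq
  have hA : ∀ k : ℕ, ∃ A B : ℕ, 0 < A ∧ (0 < k → 0 < B) ∧ (17 + 12 * √2) ^ k = A + B * √2 ∧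
      (17 - 12 * √2) ^ k = A - B * √2 := by
    intro k
    induction k with
    | zero => exact ⟨1, 0, by simp⟩
    | succ k ih =>
      obtain ⟨A, B, h0, -, h1, h2⟩ := ih
      refine ⟨17 * A + 24 * B, 12 * A + 17 * B, by omega, fun _ => by omega, ?_, ?_⟩
      · rw [pow_succ, h1]; push_cast; linear_combination (12 * B : ℝ) * s2
      · rw [pow_succ, h2]; push_cast; linear_combination (12 * B : ℝ) * s2
  have hU : ∀ k : ℕ, ∃ U V : ℕ, (87 + √7565) ^ k = U + V * √7565 ∧
      (87 - √7565) ^ k = U - V * √7565 := by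
    intro k
    induction k with
    | zero => exact ⟨1, 0, by simp⟩
    | succ k ih =>
      obtain ⟨U, V, h1, h2⟩ := ih
      refine ⟨87 * U + 7565 * V, U + 87 * V, ?_, ?_⟩
      · rw [pow_succ, h1]; push_cast; linear_combination (V : ℝ) * s7
      · rw [pow_succ, h2]; push_cast; linear_combination (V : ℝ) * s7
  have hinv : (17 - 12 * √2) ^ m = ((87 - √7565) / 2) ^ n := by
    have e1 : (17 - 12 * √2) ^ m * (17 + 12 * √2) ^ m = 1 := by
      rw [← mul_pow]; convert one_pow m using 2; linear_combination (-144 : ℝ) * s2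
    have e2 : ((87 - √7565) / 2) ^ n * ((87 + √7565) / 2) ^ n = 1 := by
      rw [← mul_pow]; convert one_pow n using 2; linear_combination (-1 / 4 : ℝ) * s7
    rw [hpow] at e1
    exact mul_right_cancel₀ (b := ((87 + √7565) / 2) ^ n) (by positivity) (e1.trans e2.symm)
  obtain ⟨A, B, -, hB, a1, a2⟩ := hA m
  obtain ⟨U, V, u1, u2⟩ := hU n
  rw [div_pow, a1, u1, eq_div_iff (by positivity)] at hpow
  rw [div_pow, a2, u2, eq_div_iff (by positivity)] at hinv
  have hsub : (2 : ℝ) ^ n * B * √2 = V * √7565 := by linarith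
  have hsq : (2 : ℝ) * (2 ^ n * B) ^ 2 = 7565 * V ^ 2 := by
    have := congrArg (fun t => t ^ 2) hsub
    simp only [mul_pow] at this
    rw [s2, s7] at this
    linarith
  have hnat : 2 * (2 ^ n * B) ^ 2 = 7565 * V ^ 2 := by exact_mod_cast hsq
  have hX : 2 ^ n * B ≠ 0 := by have := hB hm0; positivity
  have hV : V ≠ 0 := by
    rintro rfl
    have : 0 < (2 ^ n * B) ^ 2 := by positivity
    omega
  have h1 : padicValNat 2 (2 * (2 ^ n * B) ^ 2) = 1 + 2 * padicValNat 2 (2 ^ n * B) := by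
    rw [padicValNat.mul (by norm_num) (pow_ne_zero _ hX), padicValNat.pow]
    simp
  have h2 : padicValNat 2 (7565 * V ^ 2) = 2 * padicValNat 2 V := by
    rw [padicValNat.mul (by norm_num) (pow_ne_zero _ hV), padicValNat.pow,
      padicValNat.eq_zero_of_not_dvd (by norm_num), zero_add]
  rw [hnat, h2] at h1
  omega

theorem isBin_2222 : IsBin [2, 2, 2, 2] := by simp [IsBin]
theorem isBin_112222 : IsBin [1, 1, 2, 2, 2, 2] := by simp [IsBin]

/-- A finite family of words whose insertion realizes finely spaced scale changes. -/
theorem exists_rotation_words (M : ℕ) (hM : 0 < M) : ∃ c : ℕ → List ℕ,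
    (∀ i, ∃ m n, c i = wrep [2, 2, 2, 2] (m + 1) ++ wrep [1, 1, 2, 2, 2, 2] (n + 1)) ∧
    (∀ P, IsBin P → ∀ ξ ∈ Icc (0 : ℝ) 1, ∀ i j, i < j → j < M →
      Real.exp ((j - i) / M) * cfDen (P ++ c i) ξ ≤ cfDen (P ++ c j) ξ) ∧
    (∀ P, IsBin P → ∀ ξ ∈ Icc (0 : ℝ) 1, ∀ i j, i < M → j < M →
      cfDen (P ++ c j) ξ ≤ Real.exp 5 * cfDen (P ++ c i) ξ) := by
  have hMpos : (0 : ℝ) < M := by exact_mod_cast hM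
  set a := Real.log (17 + 12 * √2) with ha
  set b := Real.log ((87 + √7565) / 2) with hb
  have hdense := dense_addSubgroupClosure_pair_iff.2 irrational_log_ratio
  have hmn : ∀ i : ℕ, ∃ m n : ℤ, 3 * i / M < m * a + n * b ∧ m * a + n * b < 3 * i / M + 1 / M := by
    intro i
    obtain ⟨x, hx1, hx2⟩ := hdense.exists_between
      (show (3 * i / M : ℝ) < 3 * i / M + 1 / M by
        have : 0 < 1 / (M : ℝ) := by positivity
        linarith)
    obtain ⟨m, n, h⟩ := AddSubgroup.mem_closure_pair.1 hx1
    refine ⟨m, n, ?_⟩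
    rw [zsmul_eq_mul, zsmul_eq_mul] at h
    rw [h]; exact hx2
  choose m n hlow hhigh using hmn
  obtain ⟨K, hK⟩ : ∃ K : ℕ, (1 / 4 : ℝ) ^ K < 1 / (16 * M) :=
    exists_pow_lt_of_lt_one (by positivity) (by norm_num)
  let D : ℕ := ∑ i ∈ Finset.range M, ((m i).natAbs + (n i).natAbs)
  have hD : ∀ i < M, 0 ≤ m i + D ∧ 0 ≤ n i + D := by
    intro i hi
    have : (m i).natAbs + (n i).natAbs ≤ D :=
      Finset.single_le_sum (f := fun i => (m i).natAbs + (n i).natAbs)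
        (fun _ _ => Nat.zero_le _) (Finset.mem_range.2 hi)
    omega
  let e1 : List ℕ := [2, 2, 2, 2]
  let e2 : List ℕ := [1, 1, 2, 2, 2, 2]
  let c : ℕ → List ℕ := fun i => wrep e1 (K + 1 + (m i + D).toNat) ++
    wrep e2 (K + 1 + (n i + D).toNat)
  have h2 : √2 ^ 2 = 2 := Real.sq_sqrt (by norm_num)
  have h7 : √7565 ^ 2 = 7565 := Real.sq_sqrt (by norm_num)
  have b2 : 1 ≤ √2 ∧ √2 ≤ 2 := by constructor <;> nlinarith [Real.sqrt_nonneg 2]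
  have b7 : 86 ≤ √7565 ∧ √7565 ≤ 87 := by constructor <;> nlinarith [Real.sqrt_nonneg 7565]
  have fix1 : cfMap e1.reverse (√2 - 1) = √2 - 1 := by
    have e : cfMap e1.reverse (√2 - 1) = (5 * (√2 - 1) + 12) / (12 * (√2 - 1) + 29) := by
      have : 0 ≤ √2 - 1 := by linarith [b2.1]
      generalize √2 - 1 = t at *
      simp only [e1, List.reverse_cons, List.reverse_nil, List.nil_append, List.cons_append,
        cfMap_cons, cfMap_nil]
      push_cast
      field_simp
      ring
    rw [e, div_eq_iff (by linarith [b2.1])]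
    linear_combination (-12 : ℝ) * h2
  have fix2 : cfMap e2.reverse ((√7565 - 53) / 82) = (√7565 - 53) / 82 := by
    have e : cfMap e2.reverse ((√7565 - 53) / 82) =
        (17 * ((√7565 - 53) / 82) + 29) / (41 * ((√7565 - 53) / 82) + 70) := by
      have : 0 ≤ (√7565 - 53) / 82 := by linarith [b7.1]
      generalize (√7565 - 53) / 82 = t at *
      simp only [e2, List.reverse_cons, List.reverse_nil, List.nil_append, List.cons_append,
        cfMap_cons, cfMap_nil]
      push_cast
      field_simp
      ring
    rw [e, div_eq_iff (by linarith [b7.1])]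
    linear_combination (-1 / 164 : ℝ) * h7
  have lam1 : cfq e1 * (1 + (√2 - 1) * cfMap e1 0) = 17 + 12 * √2 := by
    simp only [e1, cfq, cfDen_cons, cfDen_nil, cfMap_cons, cfMap_nil]; push_cast; ring
  have lam2 : cfq e2 * (1 + ((√7565 - 53) / 82) * cfMap e2 0) = (87 + √7565) / 2 := by
    simp only [e2, cfq, cfDen_cons, cfDen_nil, cfMap_cons, cfMap_nil]; push_cast; ring
  have main : ∀ P, IsBin P → ∀ ξ ∈ Icc (0 : ℝ) 1, ∃ A : ℝ, ∀ i < M,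
      |Real.log (cfDen (P ++ c i) ξ) - A - (m i * a + n i * b)| ≤ 1 / (2 * M) := by
    intro P hP ξ hξ
    have hb1 := isBin_2222
    have hb2 := isBin_112222
    set y := cfMap (wrep e2 (K + 1)) ξ
    have hy : y ∈ Icc (0 : ℝ) 1 := cfMap_mem_Icc (isBin_wrep hb2 _) hξ
    refine ⟨Real.log (cfDen (P ++ wrep e1 (K + 1)) y) + Real.log (cfDen (wrep e2 (K + 1)) ξ) +
      D * a + D * b, fun i hi => ?_⟩
    obtain ⟨hm0, hn0⟩ := hD i hi
    set m' := (m i + D).toNat with hm'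
    set n' := (n i + D).toNat with hn'
    have em : (m' : ℝ) = m i + D := by
      have : (m' : ℤ) = m i + D := by omega
      exact_mod_cast this
    have en : (n' : ℝ) = n i + D := by
      have : (n' : ℤ) = n i + D := by omega
      exact_mod_cast this
    have s1 := abs_log_cfDen_wrep_le hb1 (by norm_num) hP
      (x := √2 - 1) ⟨by linarith [b2.1], by linarith [b2.2]⟩ fix1 (K + 1) m' hy
    have s2 := abs_log_cfDen_wrep_le (P := P ++ wrep e1 (K + 1 + m')) hb2 (by norm_num)
      (isBin_append.2 ⟨hP, isBin_wrep hb1 _⟩)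
      (x := (√7565 - 53) / 82) ⟨by linarith [b7.1], by linarith [b7.2]⟩ fix2 (K + 1) n' hξ
    rw [lam1, ← ha, em] at s1
    rw [lam2, ← hb, en] at s2
    have e : Real.log (cfDen (P ++ wrep e1 (K + 1 + m') ++ wrep e2 (K + 1)) ξ) =
        Real.log (cfDen (P ++ wrep e1 (K + 1 + m')) y) + Real.log (cfDen (wrep e2 (K + 1)) ξ) := by
      rw [cfDen_append, Real.log_mul]
      · exact (cfDen_pos (isBin_append.2 ⟨hP, isBin_wrep hb1 _⟩) hy).ne'
      · exact (cfDen_pos (isBin_wrep hb2 _) hξ).ne'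
    rw [e] at s2
    have ec : P ++ c i = P ++ wrep e1 (K + 1 + m') ++ wrep e2 (K + 1 + n') := by
      simp [c, hm', hn']
    rw [ec]
    have hsmall : 2 * (4 * (1 / 4 : ℝ) ^ (K + 1)) ≤ 1 / (2 * M) := by
      have : 1 / (2 * (M : ℝ)) = 8 * (1 / (16 * M)) := by field_simp; norm_num
      have hM0 : 0 < 1 / (16 * (M : ℝ)) := by positivity
      rw [this, pow_succ]
      linarith
    rw [abs_le] at s1 s2 ⊢
    constructor <;> linarith [s1.1, s1.2, s2.1, s2.2]
  have hbin : ∀ i, IsBin (c i) := fun i =>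
    isBin_append.2 ⟨isBin_wrep isBin_2222 _, isBin_wrep isBin_112222 _⟩
  refine ⟨c, fun i => ⟨K + (m i + D).toNat, K + (n i + D).toNat, ?_⟩, ?_, ?_⟩
  · simp only [c, e1, e2]; congr 2 <;> ring
  · intro P hP ξ hξ i j hij hj
    obtain ⟨A, hA⟩ := main P hP ξ hξ
    have i1 := hA i (hij.trans hj)
    have j1 := hA j hj
    have pi := cfDen_pos (isBin_append.2 ⟨hP, hbin i⟩) hξ
    have pj := cfDen_pos (isBin_append.2 ⟨hP, hbin j⟩) hξ
    rw [← Real.log_le_log_iff (by positivity) pj, Real.log_mul (Real.exp_pos _).ne' pi.ne',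
      Real.log_exp]
    have hij' : (i : ℝ) + 1 ≤ j := by exact_mod_cast hij
    have l1 := hhigh i
    have l2 := hlow j
    rw [abs_le] at i1 j1
    have e1 : ((j : ℝ) - i) / M ≤ 3 * j / M - (3 * i / M + 1 / M) - 1 / M := by
      rw [← sub_nonneg]
      have : 3 * (j : ℝ) / M - (3 * i / M + 1 / M) - 1 / M - (j - i) / M = 2 * (j - (i + 1)) / M := by
        field_simp; ring
      rw [this]
      exact div_nonneg (by linarith) hMpos.le
    have e2 : 1 / (2 * (M : ℝ)) + 1 / (2 * M) = 1 / M := by field_simp; norm_num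
    linarith [i1.2, j1.1]
  · intro P hP ξ hξ i j hi hj
    obtain ⟨A, hA⟩ := main P hP ξ hξ
    have i1 := hA i hi
    have j1 := hA j hj
    have pi := cfDen_pos (isBin_append.2 ⟨hP, hbin i⟩) hξ
    have pj := cfDen_pos (isBin_append.2 ⟨hP, hbin j⟩) hξ
    rw [← Real.log_le_log_iff pj (by positivity), Real.log_mul (Real.exp_pos _).ne' pi.ne',
      Real.log_exp]
    have l1 := hlow i
    have l2 := hhigh j
    rw [abs_le] at i1 j1
    have hj' : 3 * (j : ℝ) / M ≤ 3 := by
      rw [div_le_iff₀ hMpos]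
      have : (j : ℝ) ≤ M := by exact_mod_cast hj.le
      linarith
    have hi' : 0 ≤ 3 * (i : ℝ) / M := by positivity
    have hM1 : 1 / (M : ℝ) ≤ 1 := by
      rw [div_le_one hMpos]; exact_mod_cast hM
    have e2 : 1 / (2 * (M : ℝ)) + 1 / (2 * M) = 1 / M := by field_simp; norm_num
    linarith [i1.1, j1.2]

end rotation

section blocks

theorem cfq_2222 : cfq [2, 2, 2, 2] = 29 := by
  simp [cfq]; norm_num

theorem exists_pad {w : List ℕ} (hw : IsBin w) {R : ℝ} (h : cfq w ≤ 58 * R) :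
    ∃ j, R ≤ cfq (w ++ wrep [2, 2, 2, 2] j) ∧ cfq (w ++ wrep [2, 2, 2, 2] j) ≤ 58 * R := by
  classical
  have hb : ∀ j, IsBin (w ++ wrep [2, 2, 2, 2] j) := fun j =>
    isBin_append.2 ⟨hw, isBin_wrep isBin_2222 j⟩
  have hex : ∃ j, R ≤ cfq (w ++ wrep [2, 2, 2, 2] j) := by
    obtain ⟨n, hn⟩ := pow_unbounded_of_one_lt R (by norm_num : (1 : ℝ) < 2)
    refine ⟨n, hn.le.trans (two_pow_le_cfq (hb n) ?_)⟩
    simp [length_wrep]; omega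
  refine ⟨Nat.find hex, Nat.find_spec hex, ?_⟩
  rcases hj : Nat.find hex with _ | j
  · simpa using h
  · have h1 := Nat.find_min hex (m := j) (by omega)
    push Not at h1
    rw [wrep_succ_right, ← List.append_assoc]
    have := cfq_append_le (hb j) isBin_2222
    rw [cfq_2222] at this
    linarith

open Classical in
/-- Append copies of `2222` to a word until its continuant reaches the scale `R`. -/
noncomputable def padWord (w : List ℕ) (R : ℝ) : List ℕ :=
  if h : ∃ j, R ≤ cfq (w ++ wrep [2, 2, 2, 2] j) ∧ cfq (w ++ wrep [2, 2, 2, 2] j) ≤ 58 * R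
  then wrep [2, 2, 2, 2] h.choose else []

theorem isBin_padWord (w : List ℕ) (R : ℝ) : IsBin (padWord w R) := by
  unfold padWord
  split_ifs
  · exact isBin_wrep isBin_2222 _
  · simp

theorem padWord_spec {w : List ℕ} (hw : IsBin w) {R : ℝ} (h : cfq w ≤ 58 * R) :
    R ≤ cfq (w ++ padWord w R) ∧ cfq (w ++ padWord w R) ≤ 58 * R := by
  have hex := exists_pad hw h
  rw [padWord, dif_pos hex]
  exact hex.choose_spec

/-- A set of binary words closed under concatenation and containing the words used for padding
and for adjusting scales. -/
structure IsWordMonoid (𝓜 : Set (List ℕ)) : Prop where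
  bin : ∀ w ∈ 𝓜, IsBin w
  nil : [] ∈ 𝓜
  append : ∀ u ∈ 𝓜, ∀ v ∈ 𝓜, u ++ v ∈ 𝓜
  mem_2222 : [2, 2, 2, 2] ∈ 𝓜
  mem_112222 : [1, 1, 2, 2, 2, 2] ∈ 𝓜

variable {𝓜 : Set (List ℕ)}

theorem IsWordMonoid.wrep (h𝓜 : IsWordMonoid 𝓜) {e : List ℕ} (he : e ∈ 𝓜) (n : ℕ) :
    wrep e n ∈ 𝓜 := by
  induction n with
  | zero => exact h𝓜.nil
  | succ n ih => rw [wrep_succ]; exact h𝓜.append _ he _ ih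

theorem IsWordMonoid.padWord (h𝓜 : IsWordMonoid 𝓜) (w : List ℕ) (R : ℝ) :
    padWord w R ∈ 𝓜 := by
  unfold _root_.padWord
  split_ifs
  · exact h𝓜.wrep h𝓜.mem_2222 _
  · exact h𝓜.nil

theorem IsWordMonoid.flatMap (h𝓜 : IsWordMonoid 𝓜) {ι : Type*} {wd : ι → List ℕ}
    (hwd : ∀ i, wd i ∈ 𝓜) (l : List ι) : l.flatMap wd ∈ 𝓜 := by
  induction l with
  | nil => exact h𝓜.nil
  | cons a l ih => rw [List.flatMap_cons]; exact h𝓜.append _ (hwd a) _ ih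

/-- Two words neither of which is a prefix of the other branch at some letter. -/
theorem exists_branch {u v : List ℕ} (h : ¬ u <+: v) (h' : ¬ v <+: u) :
    ∃ w a b x y, a ≠ b ∧ u = w ++ a :: x ∧ v = w ++ b :: y := by
  induction u generalizing v with
  | nil => exact absurd (List.nil_prefix) h
  | cons c u ih =>
    rcases v with _ | ⟨d, v⟩
    · exact absurd (List.nil_prefix) h'
    · by_cases hcd : c = d
      · subst hcd
        obtain ⟨w, a, b, x, y, hab, h1, h2⟩ := ih (v := v)
          (fun hp => h (by simpa using hp)) (fun hp => h' (by simpa using hp))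
        exact ⟨c :: w, a, b, x, y, hab, by simp [h1], by simp [h2]⟩
      · exact ⟨[], c, d, u, v, hcd, rfl, rfl⟩

theorem cfq_flatMap_le {ι : Type*} {wd : ι → List ℕ} {L : ℝ} (hL : 0 ≤ L)
    (hb : ∀ i, IsBin (wd i)) (hwd : ∀ i, 2 * cfq (wd i) ≤ L) (l : List ι) :
    IsBin (l.flatMap wd) ∧ cfq (l.flatMap wd) ≤ L ^ l.length := by
  induction l with
  | nil => simp [cfq]
  | cons a l ih =>
    rw [List.flatMap_cons]
    refine ⟨isBin_append.2 ⟨hb a, ih.1⟩, (cfq_append_le (hb a) ih.1).trans ?_⟩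
    rw [List.length_cons, pow_succ, mul_comm]
    exact mul_le_mul ih.2 (hwd a) (by linarith [cfq_pos (hb a)]) (by positivity)

/-- Concatenations of code words whose index sequences differ branch early. -/
theorem exists_branch_flatMap {ι : Type*} {wd : ι → List ℕ} {L : ℝ} (hL : 0 ≤ L)
    (hb : ∀ i, IsBin (wd i)) (hwd : ∀ i, 2 * cfq (wd i) ≤ L)
    (hpf : ∀ i j, wd i <+: wd j → i = j) {k : ℕ} {f f' : Fin k → ι} {m : Fin k}
    (h : ∀ i < m, f i = f' i) (hm : f m ≠ f' m) :
    ∃ w a b x y, a ≠ b ∧ (List.ofFn f).flatMap wd = w ++ a :: x ∧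
      (List.ofFn f').flatMap wd = w ++ b :: y ∧ cfq w ≤ L ^ ((m : ℕ) + 1) := by
  have hsplit : ∀ g : Fin k → ι, List.ofFn g =
      (List.ofFn g).take m ++ g m :: (List.ofFn g).drop (m + 1) := by
    intro g
    conv_lhs => rw [← List.take_append_drop m (List.ofFn g)]
    rw [List.drop_eq_getElem_cons (by simp), List.getElem_ofFn]
  have htake : (List.ofFn f).take m = (List.ofFn f').take m := by
    apply List.ext_getElem (by simp)
    intro i h1 _
    simp only [List.length_take, List.length_ofFn] at h1
    simp only [List.getElem_take, List.getElem_ofFn]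
    exact h _ (by rw [Fin.lt_def]; simp; omega)
  obtain ⟨w, a, b, x, y, hab, h1, h2⟩ := exists_branch (fun hp => hm (hpf _ _ hp))
    (fun hp => hm (hpf _ _ hp).symm)
  set r := (List.ofFn f).take m with hr
  refine ⟨r.flatMap wd ++ w, a, b, x ++ ((List.ofFn f).drop (m + 1)).flatMap wd,
    y ++ ((List.ofFn f').drop (m + 1)).flatMap wd, hab, ?_, ?_, ?_⟩
  · conv_lhs => rw [hsplit f, ← hr]
    simp [h1]
  · conv_lhs => rw [hsplit f', ← htake]
    simp [h2]
  · have hlen : (r ++ [f m]).length = (m : ℕ) + 1 := by simp [hr]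
    have := cfq_flatMap_le hL hb hwd (r ++ [f m])
    rw [hlen] at this
    refine (cfq_mono_isPrefix this.1 ?_).trans this.2
    simp [h1]

theorem card_filter_agree_le {k : ℕ} {D : Type*} [Fintype D] [DecidableEq D] {L : ℝ}
    (hL : 0 ≤ L) (hD : (Fintype.card D : ℝ) ≤ L) (e : Fin k → D) (m : Fin k) :
    ((Finset.univ.filter fun e' : Fin k → D => ∀ i < m, e i = e' i).card : ℝ) *
      L ^ (m : ℕ) ≤ L ^ k := by
  have h1 : (Finset.univ.filter fun e' : Fin k → D => ∀ i < m, e i = e' i) =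
      Fintype.piFinset fun i => if i < m then {e i} else Finset.univ := by
    ext e'
    simp only [Finset.mem_filter, Finset.mem_univ, true_and, Fintype.mem_piFinset]
    refine forall_congr' fun i => ?_
    split_ifs with hi <;> simp [hi, eq_comm]
  have h2 : L ^ (m : ℕ) = ∏ i : Fin k, if i < m then L else 1 := by
    rw [Finset.prod_ite, Finset.prod_const, Finset.prod_const_one, mul_one]
    congr 1
    have : (Finset.univ.filter fun i : Fin k => i < m) = Finset.Iio m := by ext; simp
    rw [this, Fin.card_Iio]
  have h3 : L ^ k = ∏ _i : Fin k, L := by simp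
  rw [h1, Fintype.card_piFinset, h2, h3]
  push_cast
  rw [← Finset.prod_mul_distrib]
  refine Finset.prod_le_prod (fun i _ => ?_) (fun i _ => ?_)
  · split_ifs <;> positivity
  · split_ifs <;> simp [hD]

open Classical in
/-- A geometrically spread family of displacements rarely cancels a given one. -/
theorem card_filter_cancel_le {M : ℕ} (hM : 0 < M) {x : ℕ → ℝ} {y ρ S : ℝ} (hρ : 0 < ρ)
    (hS : 0 < S) (hx0 : ∀ i < M, 0 ≤ x i)
    (hx : ∀ i j, i < j → j < M → Real.exp (2 * ((j - i) / M)) * x j ≤ x i)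
    (hx' : ∀ i j, i < M → j < M → x i ≤ Real.exp 10 * x j)
    (hxy : (∀ i < M, S ≤ x i) ∨ S ≤ |y|) :
    (((Finset.range M).filter fun i => |x i + y| ≤ ρ).card : ℝ) ≤
      1 + 2 * Real.exp 10 * M * (ρ / S) := by
  have hMpos : (0 : ℝ) < M := by exact_mod_cast hM
  have he : 1 ≤ Real.exp 10 := Real.one_le_exp (by norm_num)
  set G := (Finset.range M).filter fun i => |x i + y| ≤ ρ with hG
  rcases le_or_gt (S / 2) ρ with hbig | hsmall
  · have h1 : (G.card : ℝ) ≤ M := by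
      exact_mod_cast (Finset.card_filter_le _ _).trans (by simp)
    have h2 : 1 / 2 ≤ ρ / S := by rw [div_le_div_iff₀ (by norm_num) hS]; linarith
    have h3 : (M : ℝ) ≤ 2 * Real.exp 10 * M * (ρ / S) := by
      calc (M : ℝ) = 2 * 1 * M * (1 / 2) := by ring
        _ ≤ _ := by gcongr
    linarith
  rcases G.eq_empty_or_nonempty with hemp | hne
  · rw [hemp]; simp; positivity
  set i0 := G.min' hne with hi0
  have hi0G : i0 ∈ G := G.min'_mem hne
  have hmem : ∀ i ∈ G, i < M ∧ |x i + y| ≤ ρ := fun i hi => by simpa [hG] using hi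
  have hx0S : S / 2 ≤ x i0 := by
    rcases hxy with h | h
    · linarith [h i0 (hmem i0 hi0G).1]
    · have h1 := (hmem i0 hi0G).2
      have h2 : |y| ≤ |x i0 + y| + |x i0| := by
        have := abs_sub (x i0 + y) (x i0); simpa using this
      rw [abs_of_nonneg (hx0 i0 (hmem i0 hi0G).1)] at h2
      linarith
  have hdist : ∀ j ∈ G, (j : ℝ) ≤ i0 + 2 * Real.exp 10 * M * (ρ / S) := by
    intro j hj
    rcases (G.min'_le j hj).eq_or_lt with h | h
    · rw [← hi0] at h; rw [← h]
      have : 0 ≤ 2 * Real.exp 10 * M * (ρ / S) := by positivity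
      linarith
    · rw [← hi0] at h
      have hjM := (hmem j hj).1
      have h1 := hx i0 j h hjM
      have h2 := hx' i0 j (h.trans hjM) hjM
      have h3 : 2 * ((j - i0 : ℝ) / M) + 1 ≤ Real.exp (2 * ((j - i0) / M)) :=
        Real.add_one_le_exp _
      have h4 : x i0 - x j ≤ 2 * ρ := by
        have a1 := abs_le.1 (hmem j hj).2
        have a2 := abs_le.1 (hmem i0 hi0G).2
        linarith [a1.1, a2.2]
      have h5 := mul_le_mul_of_nonneg_right h3 (hx0 j hjM)
      have h6 : (j - i0 : ℝ) / M * x j ≤ ρ := by nlinarith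
      have hij : (0 : ℝ) ≤ j - i0 := sub_nonneg.2 (by exact_mod_cast h.le)
      have h7 : (j - i0 : ℝ) / M * (S / 2) ≤ Real.exp 10 * ρ := by
        calc (j - i0 : ℝ) / M * (S / 2) ≤ (j - i0 : ℝ) / M * (Real.exp 10 * x j) := by
              gcongr; exact hx0S.trans h2
          _ = Real.exp 10 * ((j - i0 : ℝ) / M * x j) := by ring
          _ ≤ _ := by gcongr
      have h8 : (j - i0 : ℝ) = (j - i0 : ℝ) / M * (S / 2) * (2 * M / S) := by
        field_simp
      have h9 : (j - i0 : ℝ) ≤ Real.exp 10 * ρ * (2 * M / S) := by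
        rw [h8]; gcongr
      have : Real.exp 10 * ρ * (2 * M / S) = 2 * Real.exp 10 * M * (ρ / S) := by ring
      linarith
  have hsub : G ⊆ Finset.Icc i0 (i0 + ⌊2 * Real.exp 10 * M * (ρ / S)⌋₊) := by
    intro j hj
    rw [Finset.mem_Icc]
    refine ⟨G.min'_le j hj, ?_⟩
    have h1 := G.min'_le j hj
    have h2 : j - i0 ≤ ⌊2 * Real.exp 10 * M * (ρ / S)⌋₊ := by
      apply Nat.le_floor
      rw [Nat.cast_sub h1]; linarith [hdist j hj]
    omega
  have hcard := Finset.card_le_card hsub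
  rw [Nat.card_Icc] at hcard
  have h1 : (G.card : ℝ) ≤ (⌊2 * Real.exp 10 * M * (ρ / S)⌋₊ : ℝ) + 1 := by
    exact_mod_cast hcard.trans (by omega)
  have h2 := Nat.floor_le (show 0 ≤ 2 * Real.exp 10 * M * (ρ / S) by positivity)
  linarith

end blocks

section overlaps

theorem half_mem_binHull : (1 / 2 : ℝ) ∈ binHull := by
  unfold binHull; constructor <;> norm_num

theorem half_mem_Icc01 : (1 / 2 : ℝ) ∈ Icc (0 : ℝ) 1 := binHull_subset half_mem_binHull

/-- The properties of a family of words realising `M` multiplicatively spread scales. -/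
structure IsRotationFamily (M : ℕ) (c : ℕ → List ℕ) : Prop where
  bin : ∀ i, IsBin (c i)
  even : ∀ i, Even (c i).length
  expand : ∀ P, IsBin P → ∀ ξ ∈ Icc (0 : ℝ) 1, ∀ i j, i < j → j < M →
    Real.exp ((j - i) / M) * cfDen (P ++ c i) ξ ≤ cfDen (P ++ c j) ξ
  bounded : ∀ P, IsBin P → ∀ ξ ∈ Icc (0 : ℝ) 1, ∀ i j, i < M → j < M →
    cfDen (P ++ c j) ξ ≤ Real.exp 5 * cfDen (P ++ c i) ξ

theorem IsWordMonoid.exists_rotationFamily {𝓜 : Set (List ℕ)} (h𝓜 : IsWordMonoid 𝓜) {M : ℕ}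
    (hM : 0 < M) : ∃ c, IsRotationFamily M c ∧ ∀ i, c i ∈ 𝓜 := by
  obtain ⟨c, h1, h2, h3⟩ := exists_rotation_words M hM
  refine ⟨c, ⟨fun i => ?_, fun i => ?_, h2, h3⟩, fun i => ?_⟩ <;> obtain ⟨m, n, h⟩ := h1 i <;>
    rw [h]
  · exact isBin_append.2 ⟨isBin_wrep isBin_2222 _, isBin_wrep isBin_112222 _⟩
  · rw [List.length_append, length_wrep, length_wrep]
    exact ⟨2 * (m + 1) + 3 * (n + 1), by simp; ring⟩
  · exact h𝓜.append _ (h𝓜.wrep h𝓜.mem_2222 _) _ (h𝓜.wrep h𝓜.mem_112222 _)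

theorem IsRotationFamily.displacement {M : ℕ} {c : ℕ → List ℕ} (hc : IsRotationFamily M c)
    {P : List ℕ} (hP : IsBin P) {ξ ξ' : ℝ} (hξ : ξ ∈ Icc (0 : ℝ) 1) (hξ' : ξ' ∈ Icc (0 : ℝ) 1) :
    ∃ (σ : ℝ) (x : ℕ → ℝ), |σ| = 1 ∧
      (∀ i, cfMap (P ++ c i) ξ - cfMap (P ++ c i) ξ' = σ * x i) ∧ (∀ i, 0 ≤ x i) ∧
      (∀ i j, i < j → j < M → Real.exp (2 * ((j - i) / M)) * x j ≤ x i) ∧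
      (∀ i j, i < M → j < M → x i ≤ Real.exp 10 * x j) := by
  have hb : ∀ i, IsBin (P ++ c i) := fun i => isBin_append.2 ⟨hP, hc.bin i⟩
  have p1 : ∀ i, 0 < cfDen (P ++ c i) ξ := fun i => cfDen_pos (hb i) hξ
  have p2 : ∀ i, 0 < cfDen (P ++ c i) ξ' := fun i => cfDen_pos (hb i) hξ'
  refine ⟨(-1) ^ P.length * (if 0 ≤ ξ - ξ' then 1 else -1),
    fun i => |ξ - ξ'| / (cfDen (P ++ c i) ξ * cfDen (P ++ c i) ξ'), ?_, ?_, ?_, ?_, ?_⟩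
  · split_ifs <;> simp
  · intro i
    rw [cfMap_sub (hb i) hξ hξ', List.length_append, pow_add, (hc.even i).neg_one_pow]
    split_ifs with h
    · rw [abs_of_nonneg h]; ring
    · rw [abs_of_neg (not_le.1 h)]; ring
  · intro i
    exact div_nonneg (abs_nonneg _) (mul_pos (p1 i) (p2 i)).le
  · intro i j hij hj
    have e1 := hc.expand P hP ξ hξ i j hij hj
    have e2 := hc.expand P hP ξ' hξ' i j hij hj
    have e3 := mul_le_mul e1 e2 (mul_pos (Real.exp_pos _) (p2 i)).le (p1 j).le
    rw [← mul_div_assoc, div_le_div_iff₀ (mul_pos (p1 j) (p2 j)) (mul_pos (p1 i) (p2 i)), two_mul,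
      Real.exp_add]
    nlinarith [abs_nonneg (ξ - ξ')]
  · intro i j hi hj
    have e1 := hc.bounded P hP ξ hξ i j hi hj
    have e2 := hc.bounded P hP ξ' hξ' i j hi hj
    have e3 := mul_le_mul e1 e2 (p2 j).le (mul_pos (Real.exp_pos _) (p1 i)).le
    rw [← mul_div_assoc, div_le_div_iff₀ (mul_pos (p1 i) (p2 i)) (mul_pos (p1 j) (p2 j)),
      show (10 : ℝ) = 5 + 5 by norm_num, Real.exp_add]
    nlinarith [abs_nonneg (ξ - ξ')]

theorem separated_of_branch {Z u B B' t t' w x y : List ℕ} {a b : ℕ} (hZ : IsBin Z) (hu : IsBin u)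
    (hB : IsBin B) (hB' : IsBin B') (ht : IsBin t) (ht' : IsBin t') (hab : a ≠ b)
    (e : B = w ++ a :: x) (e' : B' = w ++ b :: y) {α β γ : ℝ}
    (hα : cfq Z ≤ α) (hβ : cfq u ≤ β) (hγ : cfq w ≤ γ) :
    1 / (32 * (4 * α * β * γ) ^ 2) ≤
      |cfMap Z (cfMap (u ++ B ++ t) (1 / 2)) - cfMap Z (cfMap (u ++ B' ++ t') (1 / 2))| := by
  subst e e'
  obtain ⟨hw, hax⟩ := isBin_append.1 hB
  obtain ⟨ha, hx⟩ := isBin_cons.1 hax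
  obtain ⟨hb, hy⟩ := isBin_cons.1 (isBin_append.1 hB').2
  have hbin : IsBin (Z ++ u ++ w) := isBin_append.2 ⟨isBin_append.2 ⟨hZ, hu⟩, hw⟩
  have h := cfMap_separated (w := Z ++ u ++ w) (u := x ++ t) (v := y ++ t') hbin ha hb hab
    (isBin_append.2 ⟨hx, ht⟩) (isBin_append.2 ⟨hy, ht'⟩) half_mem_binHull half_mem_binHull
  rw [← cfMap_append, ← cfMap_append]
  simp only [List.append_assoc, List.cons_append] at h ⊢
  refine le_trans ?_ h
  have h1 := cfq_append_le (isBin_append.2 ⟨hZ, hu⟩) hw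
  have h2 := cfq_append_le hZ hu
  have q1 := cfq_pos hZ
  have q2 := cfq_pos hu
  have q3 := cfq_pos hw
  have q5 : 0 < α := q1.trans_le hα
  have q6 : 0 < β := q2.trans_le hβ
  rw [List.append_assoc] at h1 hbin
  have q4 := cfq_pos hbin
  have h3 : cfq (Z ++ (u ++ w)) ≤ 4 * α * β * γ := by
    calc _ ≤ 2 * cfq (Z ++ u) * cfq w := h1
      _ ≤ 2 * (2 * cfq Z * cfq u) * cfq w := by gcongr
      _ = 4 * cfq Z * cfq u * cfq w := by ring
      _ ≤ 4 * α * β * γ := by gcongr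
  gcongr

/-- The constant in the bound for the number of overlapping letters. -/
noncomputable def overlapConst : ℝ := 2 * Real.exp 10 * (20 * Real.exp 10 * 8 * 232 ^ 2 * Real.exp 10)

theorem overlapConst_pos : 0 < overlapConst := by unfold overlapConst; positivity

open Classical in
theorem sum_overlap_le {H k M : ℕ} {wd : Fin H → List ℕ} {L : ℝ} (hL : 1 ≤ L) (hHL : (H : ℝ) ≤ L)
    (hb : ∀ i, IsBin (wd i)) (hwd : ∀ i, 2 * cfq (wd i) ≤ L)
    (hpf : ∀ i j, wd i <+: wd j → i = j) (hM : 0 < M) (hHM : (H * H) ^ k ≤ M)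
    {c : ℕ → List ℕ} (hc : IsRotationFamily M c) {P Q u v : List ℕ} (hP : IsBin P) (hQ : IsBin Q)
    (hu : IsBin u) (hv : IsBin v) {R T : ℝ} (hR : 0 < R) (hT : 0 < T)
    (hPR : ∀ i < M, cfq (P ++ c i) ≤ Real.exp 5 * R) (hQR : cfq Q ≤ Real.exp 5 * R)
    (huT : cfq u ≤ 58 * T) (hvT : cfq v ≤ 58 * T)
    {s t : (Fin k → Fin H × Fin H) → List ℕ} (hs : ∀ e, IsBin (s e)) (ht : ∀ e, IsBin (t e))
    {ξ η : (Fin k → Fin H × Fin H) → ℝ}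
    (hξ : ∀ e, ξ e = cfMap (u ++ (List.ofFn fun i => (e i).1).flatMap wd ++ s e) (1 / 2))
    (hη : ∀ e, η e = cfMap (v ++ (List.ofFn fun i => (e i).2).flatMap wd ++ t e) (1 / 2))
    (e : Fin k → Fin H × Fin H) :
    ∑ e', (((Finset.range M).filter fun i =>
      |cfMap (P ++ c i) (ξ e) - cfMap (P ++ c i) (ξ e') + (cfMap Q (η e) - cfMap Q (η e'))| ≤
        20 * Real.exp 10 / (R * T * (2 * L ^ k)) ^ 2).card : ℝ) ≤
      (2 + overlapConst * k * L ^ 2) * M := by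
  have hL0 : 0 < L := by linarith
  set ρ := 20 * Real.exp 10 / (R * T * (2 * L ^ k)) ^ 2 with hρ
  have hρ0 : 0 < ρ := by positivity
  have hbw : ∀ l : List (Fin H), IsBin (l.flatMap wd) := fun l =>
    (cfq_flatMap_le hL0.le hb hwd l).1
  have hξ01 : ∀ e, ξ e ∈ Icc (0 : ℝ) 1 := fun e => by
    rw [hξ]
    exact cfMap_mem_Icc (isBin_append.2 ⟨isBin_append.2 ⟨hu, hbw _⟩, hs e⟩) half_mem_Icc01
  have key : ∀ e', (((Finset.range M).filter fun i =>
      |cfMap (P ++ c i) (ξ e) - cfMap (P ++ c i) (ξ e') + (cfMap Q (η e) - cfMap Q (η e'))| ≤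
        ρ).card : ℝ) ≤ 1 + (if e' = e then (M : ℝ) else 0) +
      ∑ m : Fin k, if (∀ i < m, e i = e' i) then
        overlapConst * M * (L ^ (2 * ((m : ℕ) + 1)) / L ^ (2 * k)) else 0 := by
    intro e'
    have hsum0 : 0 ≤ ∑ m : Fin k, if (∀ i < m, e i = e' i) then
        overlapConst * M * (L ^ (2 * ((m : ℕ) + 1)) / L ^ (2 * k)) else 0 :=
      Finset.sum_nonneg fun m _ => by
        have := overlapConst_pos
        split_ifs <;> positivity
    by_cases hee : e' = e
    · rw [if_pos hee]
      have : (((Finset.range M).filter fun i =>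
        |cfMap (P ++ c i) (ξ e) - cfMap (P ++ c i) (ξ e') + (cfMap Q (η e) - cfMap Q (η e'))| ≤
        ρ).card : ℝ) ≤ M := by exact_mod_cast (Finset.card_filter_le _ _).trans (by simp)
      linarith
    · have hex : ∃ m, e m ≠ e' m := by
        by_contra hcon
        push Not at hcon
        exact hee (funext fun i => (hcon i).symm)
      obtain ⟨m, hm, hmin⟩ : ∃ m, e m ≠ e' m ∧ ∀ i < m, e i = e' i := by
        have hne : (Finset.univ.filter fun m => e m ≠ e' m).Nonempty :=
          hex.imp fun m hm => by simpa using hm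
        refine ⟨Finset.min' _ hne, by simpa using Finset.min'_mem _ hne, fun i hi => ?_⟩
        by_contra hcon
        exact absurd (Finset.min'_le _ i (by simpa using hcon)) (not_le.2 hi)
      obtain ⟨σ, x, hσ, hx, hx0, hx1, hx2⟩ := hc.displacement hP (hξ01 e) (hξ01 e')
      set y := cfMap Q (η e) - cfMap Q (η e') with hy
      set S := 1 / (32 * (4 * (Real.exp 5 * R) * (58 * T) * L ^ ((m : ℕ) + 1)) ^ 2) with hS
      have hxy : (∀ i < M, S ≤ x i) ∨ S ≤ |σ * y| := by
        by_cases h1 : (e m).1 = (e' m).1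
        · right
          have h2 : (e m).2 ≠ (e' m).2 := fun h2 => hm (Prod.ext h1 h2)
          obtain ⟨w, a, b, x, z, hab, e1, e2, hw⟩ := exists_branch_flatMap hL0.le hb hwd hpf
            (f := fun i => (e i).2) (f' := fun i => (e' i).2) (m := m)
            (fun i hi => by simp only [hmin i hi]) h2
          rw [abs_mul, hσ, one_mul, hy, hη, hη]
          exact separated_of_branch hQ hv (hbw _) (hbw _) (ht _) (ht _) hab e1 e2 hQR hvT hw
        · left
          intro i hi
          obtain ⟨w, a, b, x', z, hab, e1, e2, hw⟩ := exists_branch_flatMap hL0.le hb hwd hpf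
            (f := fun i => (e i).1) (f' := fun i => (e' i).1) (m := m)
            (fun i hi => by simp only [hmin i hi]) h1
          have h3 : |cfMap (P ++ c i) (ξ e) - cfMap (P ++ c i) (ξ e')| = x i := by
            rw [hx, abs_mul, hσ, one_mul, abs_of_nonneg (hx0 i)]
          rw [← h3, hξ, hξ]
          exact separated_of_branch (isBin_append.2 ⟨hP, hc.bin i⟩) hu (hbw _) (hbw _) (hs _) (hs _)
            hab e1 e2 (hPR i hi) huT hw
      have hcount := card_filter_cancel_le hM hρ0 (by positivity : 0 < S) (fun i _ => hx0 i)
        hx1 hx2 hxy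
      have hfe : ∀ i, |cfMap (P ++ c i) (ξ e) - cfMap (P ++ c i) (ξ e') + y| = |x i + σ * y| := by
        intro i
        have hσ2 : σ * σ = 1 := by rw [← abs_mul_abs_self, hσ, one_mul]
        have : x i + σ * y = σ * (σ * x i + y) := by rw [mul_add, ← mul_assoc, hσ2, one_mul]
        rw [this, abs_mul, hσ, one_mul, hx]
      simp only [hfe]
      refine hcount.trans ?_
      have hval : 2 * Real.exp 10 * M * (ρ / S) =
          overlapConst * M * (L ^ (2 * ((m : ℕ) + 1)) / L ^ (2 * k)) := by
        have e10 : Real.exp 10 = Real.exp 5 ^ 2 := by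
          rw [← Real.exp_nat_mul]; norm_num
        rw [hρ, hS, overlapConst, e10, pow_mul', pow_mul']
        field_simp
        ring
      rw [hval, if_neg hee, add_zero]
      gcongr
      refine le_trans ?_ (Finset.single_le_sum (f := fun m : Fin k => if (∀ i < m, e i = e' i) then
        overlapConst * M * (L ^ (2 * ((m : ℕ) + 1)) / L ^ (2 * k)) else 0) (fun j _ => ?_)
        (Finset.mem_univ m))
      · rw [if_pos hmin]
      · have := overlapConst_pos
        split_ifs <;> positivity
  refine (Finset.sum_le_sum fun e' _ => key e').trans ?_
  rw [Finset.sum_add_distrib, Finset.sum_add_distrib, Finset.sum_comm (s := Finset.univ)]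
  have t1 : ∑ _e' : Fin k → Fin H × Fin H, (1 : ℝ) ≤ M := by
    simp only [Finset.sum_const, Finset.card_univ, Fintype.card_fun, Fintype.card_prod,
      Fintype.card_fin, nsmul_eq_mul, mul_one]
    exact_mod_cast hHM
  have t2 : ∑ e' : Fin k → Fin H × Fin H, (if e' = e then (M : ℝ) else 0) = M := by simp
  have t3 : ∀ m : Fin k, ∑ e' : Fin k → Fin H × Fin H, (if (∀ i < m, e i = e' i) then
        overlapConst * M * (L ^ (2 * ((m : ℕ) + 1)) / L ^ (2 * k)) else 0) ≤
        overlapConst * M * L ^ 2 := by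
    intro m
    have h1 := card_filter_agree_le (L := L ^ 2) (by positivity)
      (by simp only [Fintype.card_prod, Fintype.card_fin]; push_cast; nlinarith) e m
    rw [← Finset.sum_filter, Finset.sum_const, nsmul_eq_mul]
    have h2 : L ^ (2 * ((m : ℕ) + 1)) / L ^ (2 * k) = (L ^ 2) ^ (m : ℕ) * L ^ 2 / (L ^ 2) ^ k := by
      rw [pow_mul, pow_mul, pow_succ]
    rw [h2]
    have := overlapConst_pos
    calc _ = ((Finset.univ.filter fun e' : Fin k → Fin H × Fin H =>
          ∀ i < m, e i = e' i).card * (L ^ 2) ^ (m : ℕ)) * (overlapConst * M * L ^ 2) /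
          (L ^ 2) ^ k := by ring
      _ ≤ (L ^ 2) ^ k * (overlapConst * M * L ^ 2) / (L ^ 2) ^ k := by
          gcongr
      _ = _ := by field_simp
  have t4 := Finset.sum_le_sum fun (m : Fin k) (_ : m ∈ Finset.univ) => t3 m
  rw [Finset.sum_const, Finset.card_univ, Fintype.card_fin, nsmul_eq_mul] at t4
  rw [t2]
  calc _ ≤ (M : ℝ) + M + k * (overlapConst * M * L ^ 2) := by gcongr
    _ = _ := by ring

end overlaps

section tree

variable {E : Type*}

/-- Append a block to a node of scale `s.2` and pad to the next scale. -/
noncomputable def treeStep (bw : E → List ℕ) (τ : ℝ) (s : List ℕ × ℝ) (e : E) : List ℕ × ℝ :=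
  (s.1 ++ bw e ++ padWord (s.1 ++ bw e) (τ * s.2), τ * s.2)

/-- The word attached to a path in the tree of blocks. -/
noncomputable def treeNode (bw : E → List ℕ) (τ : ℝ) (l : List E) : List ℕ × ℝ :=
  l.foldl (treeStep bw τ) ([], 1)

theorem treeNode_snoc (bw : E → List ℕ) (τ : ℝ) (l : List E) (e : E) :
    treeNode bw τ (l ++ [e]) = treeStep bw τ (treeNode bw τ l) e := by
  simp [treeNode]

/-- The word of the state lies in `𝓜` and its continuant is comparable to the scale. -/
structure IsTreeState (𝓜 : Set (List ℕ)) (s : List ℕ × ℝ) : Prop where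
  mem : s.1 ∈ 𝓜
  pos : 0 < s.2
  ge : s.2 ≤ cfq s.1
  le : cfq s.1 ≤ 58 * s.2

variable {𝓜 : Set (List ℕ)} {bw : E → List ℕ} {τ K : ℝ}

theorem IsTreeState.foldl (h𝓜 : IsWordMonoid 𝓜) (hbw : ∀ e, bw e ∈ 𝓜) (hK : ∀ e, cfq (bw e) ≤ K)
    (hτ : 2 * K ≤ τ) (hτ0 : 0 < τ) {s : List ℕ × ℝ} (hs : IsTreeState 𝓜 s) (l : List E) :
    IsTreeState 𝓜 (l.foldl (treeStep bw τ) s) ∧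
      (l.foldl (treeStep bw τ) s).2 = τ ^ l.length * s.2 ∧
      ∃ t, IsBin t ∧ (l.foldl (treeStep bw τ) s).1 = s.1 ++ t := by
  induction l generalizing s with
  | nil => exact ⟨hs, by simp, [], by simp, by simp⟩
  | cons e l ih =>
    have hbs := h𝓜.bin _ hs.mem
    have hbe := h𝓜.bin _ (hbw e)
    have hle : cfq (s.1 ++ bw e) ≤ 58 * (τ * s.2) := by
      have h1 := cfq_append_le hbs hbe
      have h2 : 2 * cfq s.1 * cfq (bw e) ≤ cfq s.1 * τ := by nlinarith [cfq_pos hbs, hK e]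
      nlinarith [hs.le]
    have hpad := padWord_spec (isBin_append.2 ⟨hbs, hbe⟩) hle
    have hst : IsTreeState 𝓜 (treeStep bw τ s e) :=
      ⟨h𝓜.append _ (h𝓜.append _ hs.mem _ (hbw e)) _ (h𝓜.padWord _ _), mul_pos hτ0 hs.pos,
        hpad.1, hpad.2⟩
    obtain ⟨h1, h2, t, ht, h3⟩ := ih hst
    refine ⟨h1, ?_, bw e ++ (padWord (s.1 ++ bw e) (τ * s.2) ++ t), ?_, ?_⟩
    · rw [List.foldl_cons, h2, treeStep, List.length_cons]; ring
    · exact isBin_append.2 ⟨hbe, isBin_append.2 ⟨isBin_padWord _ _, ht⟩⟩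
    · rw [List.foldl_cons, h3, treeStep]; simp

theorem treeNode_spec (h𝓜 : IsWordMonoid 𝓜) (hbw : ∀ e, bw e ∈ 𝓜) (hK : ∀ e, cfq (bw e) ≤ K)
    (hτ : 2 * K ≤ τ) (hτ0 : 0 < τ) (l l' : List E) :
    IsTreeState 𝓜 (treeNode bw τ l) ∧ (treeNode bw τ l).2 = τ ^ l.length ∧
      ∃ t, IsBin t ∧ (treeNode bw τ (l ++ l')).1 = (treeNode bw τ l).1 ++ t := by
  have h0 : IsTreeState 𝓜 (([] : List ℕ), (1 : ℝ)) :=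
    ⟨h𝓜.nil, one_pos, by simp [cfq], by norm_num [cfq]⟩
  obtain ⟨h1, h2, -⟩ := h0.foldl h𝓜 hbw hK hτ hτ0 l
  obtain ⟨-, -, h3⟩ := h1.foldl h𝓜 hbw hK hτ hτ0 l'
  refine ⟨h1, by rw [treeNode, h2, mul_one], ?_⟩
  rwa [treeNode, treeNode, List.foldl_append]

theorem abs_cfMap_extend_sub_le {Z W t : List ℕ} (hZ : IsBin Z) (hW : IsBin W) (ht : IsBin t)
    {x y : ℝ} (hx : x ∈ Icc (0 : ℝ) 1) (hy : y ∈ Icc (0 : ℝ) 1) {α β : ℝ} (hα : 0 < α)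
    (hβ : 0 < β) (hαZ : α ≤ cfq Z) (hβW : β ≤ cfq W) :
    |cfMap Z (cfMap (W ++ t) x) - cfMap Z (cfMap W y)| ≤ 1 / (α * β) ^ 2 := by
  rw [cfMap_append W t, ← cfMap_append Z W, ← cfMap_append Z W]
  refine (abs_cfMap_sub_le_inv (isBin_append.2 ⟨hZ, hW⟩) (cfMap_mem_Icc ht hx) hy).trans ?_
  have h := cfq_append_ge hZ hW
  gcongr
  exact (mul_le_mul hαZ hβW hβ.le (hα.le.trans hαZ)).trans h

theorem exp_five_gt : 58 * 2 ≤ Real.exp 5 := by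
  have h := Real.exp_one_gt_d9
  have : Real.exp 5 = Real.exp 1 ^ 5 := by rw [← Real.exp_nat_mul]; norm_num
  rw [this]
  calc (58 * 2 : ℝ) ≤ 2.7 ^ 5 := by norm_num
    _ ≤ _ := by gcongr; linarith

/-- The left and right words of a block of pairs of code words. -/
def pairBlock {H k : ℕ} (wd : Fin H → List ℕ) (π : Fin H × Fin H → Fin H)
    (e : Fin k → Fin H × Fin H) : List ℕ := (List.ofFn fun i => π (e i)).flatMap wd

set_option maxHeartbeats 1000000 in
theorem exists_children (h𝓜 : IsWordMonoid 𝓜) {H : ℕ} (k : ℕ) {wd : Fin H → List ℕ} {L : ℝ}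
    (hH : 0 < H) (hL : 1 ≤ L) (hHL : (H : ℝ) ≤ L) (hwd𝓜 : ∀ i, wd i ∈ 𝓜)
    (hwd : ∀ i, 2 * cfq (wd i) ≤ L) (hpf : ∀ i j, wd i <+: wd j → i = j) :
    ∃ C : ℝ, 58 < C ∧ ∀ N : ℕ, 0 < N → ∀ P Q R, IsBin P → IsBin Q → 0 < R →
      R ≤ cfq P → cfq P ≤ 58 * R → R ≤ cfq Q → cfq Q ≤ 58 * R →
      ∃ (S : Finset (List (Fin k → Fin H × Fin H)))
        (u v : List (Fin k → Fin H × Fin H) → List ℕ),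
        (((H * H : ℕ) : ℝ) ^ k) ^ N ≤ 2 * (2 + overlapConst * k * L ^ 2) ^ (2 * N) * S.card ∧
        (∀ l, u l ∈ 𝓜 ∧ v l ∈ 𝓜) ∧
        (∀ l ∈ S, C * (2 * L ^ k) ^ N * R ≤ cfq (P ++ u l) ∧
          cfq (P ++ u l) ≤ 58 * (C * (2 * L ^ k) ^ N * R) ∧
          C * (2 * L ^ k) ^ N * R ≤ cfq (Q ++ v l) ∧
          cfq (Q ++ v l) ≤ 58 * (C * (2 * L ^ k) ^ N * R)) ∧
        ∀ l ∈ S, ∀ l' ∈ S, l ≠ l' → ∀ x ∈ Icc (0 : ℝ) 1, ∀ y ∈ Icc (0 : ℝ) 1,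
          ∀ x' ∈ Icc (0 : ℝ) 1, ∀ y' ∈ Icc (0 : ℝ) 1,
          1 / (C * (2 * L ^ k) ^ N * R) ^ 2 ≤
            |cfMap (P ++ u l) x + cfMap (Q ++ v l) y -
              (cfMap (P ++ u l') x' + cfMap (Q ++ v l') y')| := by
  classical
  have hL0 : 0 < L := by linarith
  set M := (H * H) ^ k with hM
  have hM0 : 0 < M := by positivity
  obtain ⟨c, hc, hc𝓜⟩ := h𝓜.exists_rotationFamily hM0
  set τ := 2 * L ^ k with hτ
  have hτ1 : 1 ≤ τ := by nlinarith [one_le_pow₀ hL (n := k)]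
  have hτ0 : 0 < τ := by linarith
  have hwdb : ∀ i, IsBin (wd i) := fun i => h𝓜.bin _ (hwd𝓜 i)
  have hbw𝓜 : ∀ π e, pairBlock (k := k) wd π e ∈ 𝓜 := fun π e => h𝓜.flatMap hwd𝓜 _
  have hbwK : ∀ π e, cfq (pairBlock (k := k) wd π e) ≤ L ^ k := fun π e => by
    have h := (cfq_flatMap_le hL0.le hwdb hwd (List.ofFn fun i => π (e i))).2
    rwa [List.length_ofFn] at h
  set nd := fun (π : Fin H × Fin H → Fin H) (l : List (Fin k → Fin H × Fin H)) =>
    (treeNode (pairBlock wd π) τ l).1 with hnd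
  have hspec := fun π l l' => treeNode_spec h𝓜 (hbw𝓜 π) (hbwK π) hτ.ge hτ0 l l'
  have nd𝓜 : ∀ π l, nd π l ∈ 𝓜 := fun π l => (hspec π l []).1.mem
  have ndb : ∀ π l, IsBin (nd π l) := fun π l => h𝓜.bin _ (nd𝓜 π l)
  have ndge : ∀ π l, τ ^ l.length ≤ cfq (nd π l) := fun π l => by
    rw [← (hspec π l []).2.1]; exact (hspec π l []).1.ge
  have ndle : ∀ π l, cfq (nd π l) ≤ 58 * τ ^ l.length := fun π l => by
    rw [← (hspec π l []).2.1]; exact (hspec π l []).1.le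
  have he5 := exp_five_gt
  have he0 : 0 < Real.exp 5 := Real.exp_pos 5
  have e10 : Real.exp 10 = Real.exp 5 ^ 2 := by rw [← Real.exp_nat_mul]; norm_num
  have he10 : 1 ≤ Real.exp 10 := Real.one_le_exp (by norm_num)
  have hq0 := one_le_cfq (hc.bin 0)
  refine ⟨2 * Real.exp 5 * 116 * cfq (c 0), by nlinarith, ?_⟩
  intro N hN P Q R hP hQ hR hP1 hP2 hQ1 hQ2
  have hPc : ∀ i, IsBin (P ++ c i) := fun i => isBin_append.2 ⟨hP, hc.bin i⟩
  set R' := cfq (P ++ c 0) with hR'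
  have hRR' : R ≤ R' := hP1.trans (cfq_mono_isPrefix (hPc 0) (List.prefix_append _ _))
  have hR'0 : 0 < R' := hR.trans_le hRR'
  have hR'le : R' ≤ 116 * R * cfq (c 0) := by
    have := cfq_append_le hP (hc.bin 0)
    nlinarith
  have hPle : ∀ i < M, cfq (P ++ c i) ≤ Real.exp 5 * R' := fun i hi =>
    hc.bounded P hP 0 zero_mem_Icc01 0 i hM0 hi
  have hPge : ∀ i < M, R' / Real.exp 5 ≤ cfq (P ++ c i) := fun i hi => by
    rw [div_le_iff₀ he0, mul_comm]
    exact hc.bounded P hP 0 zero_mem_Icc01 i 0 hi hM0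
  obtain ⟨hQ'1, hQ'2⟩ := padWord_spec (R := R') hQ (by linarith)
  set Q' := Q ++ padWord Q R' with hQ'
  have hQ'b : IsBin Q' := isBin_append.2 ⟨hQ, isBin_padWord _ _⟩
  set z := fun (i : ℕ) (l : List (Fin k → Fin H × Fin H)) =>
    cfMap (P ++ c i) (cfMap (nd Prod.fst l) (1 / 2)) + cfMap Q' (cfMap (nd Prod.snd l) (1 / 2))
    with hz
  set O := fun (i : ℕ) (p : List (Fin k → Fin H × Fin H)) (e e' : Fin k → Fin H × Fin H) =>
    i < M → |cfMap (P ++ c i) (cfMap (nd Prod.fst (p ++ [e])) (1 / 2)) -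
      cfMap (P ++ c i) (cfMap (nd Prod.fst (p ++ [e'])) (1 / 2)) +
      (cfMap Q' (cfMap (nd Prod.snd (p ++ [e])) (1 / 2)) -
        cfMap Q' (cfMap (nd Prod.snd (p ++ [e'])) (1 / 2)))| ≤
      20 * Real.exp 10 / (R' * τ ^ p.length * τ) ^ 2 with hOdef
  have hO : ∀ i p e, O i p e e := fun i p e _ => by
    simp only [sub_self, add_zero, abs_zero]; positivity
  have close : ∀ i < M, ∀ l l' x y t t', IsBin t → IsBin t' → x ∈ Icc (0 : ℝ) 1 → y ∈ Icc (0 : ℝ) 1 →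
      |cfMap (P ++ c i) (cfMap (nd Prod.fst l ++ t) x) + cfMap Q' (cfMap (nd Prod.snd l' ++ t') y) -
        (cfMap (P ++ c i) (cfMap (nd Prod.fst l) (1 / 2)) +
          cfMap Q' (cfMap (nd Prod.snd l') (1 / 2)))| ≤
      Real.exp 10 / (R' * τ ^ l.length) ^ 2 + 1 / (R' * τ ^ l'.length) ^ 2 := by
    intro i hi l l' x y t t' ht ht' hx hy
    have h1 := abs_cfMap_extend_sub_le (hPc i) (ndb Prod.fst l) ht hx half_mem_Icc01
      (by positivity) (by positivity) (hPge i hi) (ndge Prod.fst l)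
    have h2 := abs_cfMap_extend_sub_le hQ'b (ndb Prod.snd l') ht' hy half_mem_Icc01
      hR'0 (by positivity) hQ'1 (ndge Prod.snd l')
    have h3 : 1 / (R' / Real.exp 5 * τ ^ l.length) ^ 2 =
        Real.exp 10 / (R' * τ ^ l.length) ^ 2 := by
      rw [e10]; field_simp
    rw [h3] at h1
    rw [abs_le] at h1 h2 ⊢
    constructor <;> linarith [h1.1, h1.2, h2.1, h2.2]
  have hoverlap : ∀ p e, ∑ i ∈ Finset.range M, (overlapCount (O i p) e : ℝ) ≤
      (2 + overlapConst * k * L ^ 2) * (Finset.range M).card := by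
    intro p e
    have h := sum_overlap_le (s := fun e => padWord ((treeNode (pairBlock wd Prod.fst) τ p).1 ++
        pairBlock wd Prod.fst e) (τ * (treeNode (pairBlock (k := k) wd Prod.fst) τ p).2))
      (t := fun e => padWord ((treeNode (pairBlock wd Prod.snd) τ p).1 ++
        pairBlock wd Prod.snd e) (τ * (treeNode (pairBlock (k := k) wd Prod.snd) τ p).2))
      (ξ := fun e => cfMap (nd Prod.fst (p ++ [e])) (1 / 2))
      (η := fun e => cfMap (nd Prod.snd (p ++ [e])) (1 / 2))
      hL hHL hwdb hwd hpf hM0 le_rfl hc hP hQ'b (ndb Prod.fst p) (ndb Prod.snd p) hR'0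
      (pow_pos hτ0 p.length) hPle (hQ'2.trans (by nlinarith)) (ndle _ p) (ndle _ p)
      (fun e => isBin_padWord _ _) (fun e => isBin_padWord _ _)
      (fun e => by simp only [hnd, treeNode_snoc, treeStep, pairBlock])
      (fun e => by simp only [hnd, treeNode_snoc, treeStep, pairBlock]) e
    rw [Finset.card_range]
    refine le_trans (le_of_eq ?_) h
    have := Finset.sum_card_bipartiteAbove_eq_sum_card_bipartiteBelow (s := Finset.range M)
      (t := (Finset.univ : Finset (Fin k → Fin H × Fin H))) (fun i e' => O i p e e')
    simp only [Finset.bipartiteAbove, Finset.bipartiteBelow] at this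
    simp only [overlapCount]
    rw [← Nat.cast_sum, ← Nat.cast_sum]
    congr 1
    refine Eq.trans (Finset.sum_congr rfl fun i _ => ?_)
      (this.trans (Finset.sum_congr rfl fun e' _ => ?_)) <;> refine congrArg Finset.card ?_
    · congr
    · ext i
      simp only [Finset.mem_filter, Finset.mem_range]
      exact and_congr_right fun hi => by simp only [hOdef, hi, true_imp_iff, hτ]
  have hg : 1 < 2 + overlapConst * k * L ^ 2 := by
    have := overlapConst_pos
    have : 0 ≤ overlapConst * k * L ^ 2 := by positivity
    linarith
  have hpowle : ∀ n ≤ N, 1 / (R' * τ ^ N) ^ 2 ≤ 1 / (R' * τ ^ n) ^ 2 := fun n hn => by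
    gcongr
  obtain ⟨i, hiM, S, hS, hsep, hcard⟩ := exists_separated_paths
    (Finset.nonempty_range_iff.2 hM0.ne') hO hg hoverlap hN z
    (Δ := 8 * Real.exp 10 / (R' * τ ^ N) ^ 2) (by positivity) (by
      intro i r e s e' s' hlen hlen' hle hiM
      obtain ⟨t1, ht1, E1⟩ := (hspec Prod.fst (r ++ [e]) s).2.2
      obtain ⟨t2, ht2, E2⟩ := (hspec Prod.snd (r ++ [e]) s).2.2
      obtain ⟨t3, ht3, E3⟩ := (hspec Prod.fst (r ++ [e']) s').2.2
      obtain ⟨t4, ht4, E4⟩ := (hspec Prod.snd (r ++ [e']) s').2.2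
      rw [List.append_assoc, List.singleton_append] at E1 E2 E3 E4
      have c1 := close i hiM (r ++ [e]) (r ++ [e]) (1 / 2) (1 / 2) t1 t2 ht1 ht2 half_mem_Icc01
        half_mem_Icc01
      have c2 := close i hiM (r ++ [e']) (r ++ [e']) (1 / 2) (1 / 2) t3 t4 ht3 ht4 half_mem_Icc01
        half_mem_Icc01
      have E1' : nd Prod.fst (r ++ e :: s) = nd Prod.fst (r ++ [e]) ++ t1 := E1
      have E2' : nd Prod.snd (r ++ e :: s) = nd Prod.snd (r ++ [e]) ++ t2 := E2
      have E3' : nd Prod.fst (r ++ e' :: s') = nd Prod.fst (r ++ [e']) ++ t3 := E3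
      have E4' : nd Prod.snd (r ++ e' :: s') = nd Prod.snd (r ++ [e']) ++ t4 := E4
      simp only [hz] at hle
      rw [← E1', ← E2'] at c1
      rw [← E3', ← E4'] at c2
      simp only [List.length_append, List.length_cons, List.length_nil, zero_add] at c1 c2 hlen
      have h1 := hpowle (r.length + 1) (by omega)
      rw [mul_assoc R', ← pow_succ]
      set X := 1 / (R' * τ ^ (r.length + 1)) ^ 2 with hX
      have hX0 : 0 < X := by positivity
      rw [div_eq_mul_one_div (Real.exp 10), ← hX] at c1 c2
      rw [div_eq_mul_one_div (20 * Real.exp 10), ← hX]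
      rw [div_eq_mul_one_div (8 * Real.exp 10)] at hle
      have h2 : 2 * (8 * Real.exp 10 * (1 / (R' * τ ^ N) ^ 2)) ≤ 16 * Real.exp 10 * X := by
        nlinarith
      have h3 : X ≤ Real.exp 10 * X := by nlinarith
      rw [abs_le] at hle c1 c2 ⊢
      constructor <;> linarith [hle.1, hle.2, c1.1, c1.2, c2.1, c2.2])
  have hiM' := Finset.mem_range.1 hiM
  set Λ := 2 * Real.exp 5 * 116 * cfq (c 0) * τ ^ N * R with hΛ
  have hτN : 0 < τ ^ N := by positivity
  have hΛge : 2 * Real.exp 5 * R' * τ ^ N ≤ Λ := by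
    rw [hΛ]
    calc 2 * Real.exp 5 * R' * τ ^ N ≤ 2 * Real.exp 5 * (116 * R * cfq (c 0)) * τ ^ N := by gcongr
      _ = _ := by ring
  have hR'τ : 0 < R' * τ ^ N := by positivity
  have hlen : ∀ l ∈ S, l.length = N := fun l hl => mem_pathsOfLength.1 (hS hl)
  set u := fun l => c i ++ nd Prod.fst l ++ padWord (P ++ c i ++ nd Prod.fst l) Λ with hu
  set v := fun l => padWord Q R' ++ nd Prod.snd l ++ padWord (Q' ++ nd Prod.snd l) Λ with hv
  have hPu : ∀ l, P ++ u l = P ++ c i ++ (nd Prod.fst l ++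
      padWord (P ++ c i ++ nd Prod.fst l) Λ) := fun l => by simp [hu]
  have hQv : ∀ l, Q ++ v l = Q' ++ (nd Prod.snd l ++
      padWord (Q' ++ nd Prod.snd l) Λ) := fun l => by simp [hv, hQ']
  refine ⟨S, u, v, ?_, ?_, ?_, ?_⟩
  · simpa using hcard
  · exact fun l => ⟨h𝓜.append _ (h𝓜.append _ (hc𝓜 i) _ (nd𝓜 _ l)) _ (h𝓜.padWord _ _),
      h𝓜.append _ (h𝓜.append _ (h𝓜.padWord _ _) _ (nd𝓜 _ l)) _ (h𝓜.padWord _ _)⟩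
  · intro l hl
    have b1 := ndle Prod.fst l
    have b2 := ndle Prod.snd l
    rw [hlen l hl] at b1 b2
    have q1 := cfq_append_le (hPc i) (ndb Prod.fst l)
    have q2 := cfq_append_le hQ'b (ndb Prod.snd l)
    have p1 : cfq (P ++ c i ++ nd Prod.fst l) ≤ 58 * Λ := by
      calc _ ≤ 2 * cfq (P ++ c i) * cfq (nd Prod.fst l) := q1
        _ ≤ 2 * (Real.exp 5 * R') * (58 * τ ^ N) := by
            have := (cfq_pos (ndb Prod.fst l)).le
            gcongr
            exact hPle i hiM'
        _ = 58 * (2 * Real.exp 5 * R' * τ ^ N) := by ring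
        _ ≤ _ := by linarith
    have p2 : cfq (Q' ++ nd Prod.snd l) ≤ 58 * Λ := by
      calc _ ≤ 2 * cfq Q' * cfq (nd Prod.snd l) := q2
        _ ≤ 2 * (58 * R') * (58 * τ ^ N) := by
            have := (cfq_pos (ndb Prod.snd l)).le
            gcongr
        _ = 58 * (58 * 2 * R' * τ ^ N) := by ring
        _ ≤ 58 * (2 * Real.exp 5 * R' * τ ^ N) := by
            have : 58 * 2 ≤ 2 * Real.exp 5 := by linarith
            gcongr
        _ ≤ _ := by linarith
    have r1 := padWord_spec (isBin_append.2 ⟨hPc i, ndb Prod.fst l⟩) p1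
    have r2 := padWord_spec (isBin_append.2 ⟨hQ'b, ndb Prod.snd l⟩) p2
    rw [hPu, hQv, ← List.append_assoc (P ++ c i), ← List.append_assoc Q']
    exact ⟨r1.1, r1.2, r2.1, r2.2⟩
  · intro l hl l' hl' hll x hx y hy x' hx' y' hy'
    have c1 := close i hiM' l l x y (padWord (P ++ c i ++ nd Prod.fst l) Λ)
      (padWord (Q' ++ nd Prod.snd l) Λ) (isBin_padWord _ _) (isBin_padWord _ _) hx hy
    have c2 := close i hiM' l' l' x' y' (padWord (P ++ c i ++ nd Prod.fst l') Λ)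
      (padWord (Q' ++ nd Prod.snd l') Λ) (isBin_padWord _ _) (isBin_padWord _ _) hx' hy'
    have h1 := hsep l hl l' hl' hll
    simp only [hz] at h1
    rw [hlen l hl, ← cfMap_append, ← cfMap_append, ← hPu, ← hQv] at c1
    rw [hlen l' hl', ← cfMap_append, ← cfMap_append, ← hPu, ← hQv] at c2
    have h2 : 1 / Λ ^ 2 ≤ 1 / (R' * τ ^ N) ^ 2 := by
      gcongr
      nlinarith
    set X := 1 / (R' * τ ^ N) ^ 2 with hX
    have hX0 : 0 < X := by positivity
    rw [div_eq_mul_one_div (8 * Real.exp 10), ← hX] at h1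
    rw [div_eq_mul_one_div (Real.exp 10), ← hX] at c1 c2
    refine h2.trans ?_
    have h3 : X ≤ Real.exp 10 * X := by nlinarith
    set A := cfMap (P ++ u l) x + cfMap (Q ++ v l) y
    set B := cfMap (P ++ u l') x' + cfMap (Q ++ v l') y'
    set a := cfMap (P ++ c i) (cfMap (nd Prod.fst l) (1 / 2)) +
      cfMap Q' (cfMap (nd Prod.snd l) (1 / 2))
    set b := cfMap (P ++ c i) (cfMap (nd Prod.fst l') (1 / 2)) +
      cfMap Q' (cfMap (nd Prod.snd l') (1 / 2))
    have h5 : |a - b| ≤ |A - a| + |A - B| + |B - b| := by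
      have e1 : a - b = -(A - a) + (A - B) + (B - b) := by ring
      rw [e1]
      refine (abs_add_three _ _ _).trans ?_
      rw [abs_neg]
    linarith

end tree

section sums

variable {𝓜 : Set (List ℕ)}

/-- The infinite sequences having arbitrarily long prefixes in `𝓜`. -/
def omegaSeqs (𝓜 : Set (List ℕ)) : Set (ℕ → ℕ) := {a | ∀ n, ∃ m ≥ n, seqTake a m ∈ 𝓜}

theorem getElem_seqTake (a : ℕ → ℕ) {n i : ℕ} (h : i < (seqTake a n).length) :
    (seqTake a n)[i] = a i := by
  simp [seqTake]

theorem binSeq_of_mem_omegaSeqs (h𝓜 : ∀ w ∈ 𝓜, IsBin w) {a : ℕ → ℕ} (ha : a ∈ omegaSeqs 𝓜) :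
    BinSeq a := by
  intro n
  obtain ⟨m, hm, h⟩ := ha (n + 1)
  have h1 : n < (seqTake a m).length := by simp; omega
  have := h𝓜 _ h (seqTake a m)[n] (List.getElem_mem h1)
  rwa [getElem_seqTake] at this

/-- An increasing sequence of words converges to an infinite sequence. -/
theorem exists_seq_of_prefixes {W : ℕ → List ℕ} (hpre : ∀ n, W n <+: W (n + 1))
    (hlen : ∀ n, (W n).length < (W (n + 1)).length) :
    (∀ n, n ≤ (W n).length) ∧ ∃ a, ∀ n, seqTake a (W n).length = W n := by
  have hn : ∀ n, n ≤ (W n).length := by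
    intro n
    induction n with
    | zero => simp
    | succ n ih => have := hlen n; omega
  have hmono : ∀ m n, m ≤ n → W m <+: W n := by
    intro m n h
    induction n, h using Nat.le_induction with
    | base => exact List.prefix_rfl
    | succ n _ ih => exact ih.trans (hpre n)
  refine ⟨hn, fun i => (W (i + 1)).getD i 0, fun n => List.ext_getElem (by simp) ?_⟩
  intro i h1 h2
  rw [getElem_seqTake, List.getD_eq_getElem _ _ (by have := hn (i + 1); omega)]
  rcases le_total (i + 1) n with h | h
  · exact (hmono _ _ h).getElem _
  · exact ((hmono _ _ h).getElem _).symm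

theorem exists_mem_omegaSeqs (h𝓜 : ∀ w ∈ 𝓜, IsBin w) {P : List ℕ} (hP : IsBin P)
    {W : ℕ → List ℕ} (hW : ∀ n, ∃ t ∈ 𝓜, W n = P ++ t) (hpre : ∀ n, W n <+: W (n + 1))
    (hlen : ∀ n, (W n).length < (W (n + 1)).length) :
    ∃ a ∈ omegaSeqs 𝓜, ∀ n, ∃ x ∈ binHull, cfMap P (cfv a) = cfMap (W n) x := by
  obtain ⟨hn, A, hA⟩ := exists_seq_of_prefixes hpre hlen
  have hAP : seqApp P (shift A P.length) = A := by
    obtain ⟨t, -, h⟩ := hW 0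
    have h1 := hA 0
    rw [h, List.length_append, seqTake_add] at h1
    rw [← (List.append_inj h1 (by simp)).1, length_seqTake, seqApp_seqTake_shift]
  have hmem : shift A P.length ∈ omegaSeqs 𝓜 := by
    intro n
    obtain ⟨t, ht, h⟩ := hW (n + P.length)
    have h1 := hA (n + P.length)
    have h2 := hn (n + P.length)
    rw [h, List.length_append, seqTake_add] at h1
    rw [h, List.length_append] at h2
    refine ⟨t.length, by omega, ?_⟩
    rw [(List.append_inj h1 (by simp)).2]; exact ht
  have hbin := binSeq_of_mem_omegaSeqs h𝓜 hmem
  refine ⟨_, hmem, fun n => ?_⟩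
  have hAbin : BinSeq A := by rw [← hAP]; exact binSeq_append hP hbin
  refine ⟨_, cfv_mem_binHull (hAbin.drop (W n).length), ?_⟩
  rw [← cfv_append hP hbin.posSeq, hAP, cfv_take_drop hAbin.posSeq (W n).length, hA]

theorem length_lt_of_cfq_lt {u v : List ℕ} (h : cfq u < cfq (u ++ v)) :
    u.length < (u ++ v).length := by
  rcases v with _ | ⟨a, v⟩
  · simp at h
  · simp

/-- If every pair of words has `H` well separated pairs of extensions, then sums of continued
fractions have large dimension. -/
theorem le_dimH_of_extensions (h𝓜 : IsWordMonoid 𝓜) {H : ℕ} {Λ σ : ℝ} (hΛ : 58 < Λ)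
    (hσ : (Λ ^ 2) ^ σ ≤ H)
    (hstep : ∀ P Q R, IsBin P → IsBin Q → 0 < R →
      R ≤ cfq P → cfq P ≤ 58 * R → R ≤ cfq Q → cfq Q ≤ 58 * R →
      ∃ u v : Fin H → List ℕ, (∀ h, u h ∈ 𝓜 ∧ v h ∈ 𝓜) ∧
        (∀ h, Λ * R ≤ cfq (P ++ u h) ∧ cfq (P ++ u h) ≤ 58 * (Λ * R) ∧
          Λ * R ≤ cfq (Q ++ v h) ∧ cfq (Q ++ v h) ≤ 58 * (Λ * R)) ∧
        ∀ h h', h ≠ h' → ∀ x ∈ Icc (0 : ℝ) 1, ∀ y ∈ Icc (0 : ℝ) 1,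
          ∀ x' ∈ Icc (0 : ℝ) 1, ∀ y' ∈ Icc (0 : ℝ) 1,
          1 / (Λ * R) ^ 2 ≤ |cfMap (P ++ u h) x + cfMap (Q ++ v h) y -
              (cfMap (P ++ u h') x' + cfMap (Q ++ v h') y')|)
    {P Q : List ℕ} (hP : IsBin P) (hQ : IsBin Q) :
    ENNReal.ofReal σ ≤
      dimH {z | ∃ a ∈ omegaSeqs 𝓜, ∃ b ∈ omegaSeqs 𝓜, z = cfMap P (cfv a) + cfMap Q (cfv b)} := by
  choose! U V hUV𝓜 hUVq hUVsep using hstep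
  set R₀ := max (cfq P) (cfq Q) with hR₀
  have hR₀0 : 0 < R₀ := lt_max_of_lt_left (cfq_pos hP)
  have hΛ0 : 0 < Λ := by linarith
  have hp := padWord_spec (R := R₀) hP (by linarith [le_max_left (cfq P) (cfq Q)])
  have hq := padWord_spec (R := R₀) hQ (by linarith [le_max_right (cfq P) (cfq Q)])
  set st : (ℕ → Fin H) → ℕ → List ℕ × List ℕ := fun ω n => Nat.rec
    (P ++ padWord P R₀, Q ++ padWord Q R₀)
    (fun n s => (s.1 ++ U s.1 s.2 (R₀ * Λ ^ n) (ω n), s.2 ++ V s.1 s.2 (R₀ * Λ ^ n) (ω n))) n with hst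
  have st0 : ∀ ω, st ω 0 = (P ++ padWord P R₀, Q ++ padWord Q R₀) := fun ω => rfl
  have st1 : ∀ ω n, st ω (n + 1) =
      ((st ω n).1 ++ U (st ω n).1 (st ω n).2 (R₀ * Λ ^ n) (ω n),
        (st ω n).2 ++ V (st ω n).1 (st ω n).2 (R₀ * Λ ^ n) (ω n)) := fun ω n => rfl
  have hRn : ∀ n, 0 < R₀ * Λ ^ n := fun n => by positivity
  have hsucc : ∀ n, Λ * (R₀ * Λ ^ n) = R₀ * Λ ^ (n + 1) := fun n => by ring
  have inv : ∀ ω n, (∃ t ∈ 𝓜, (st ω n).1 = P ++ t) ∧ (∃ t ∈ 𝓜, (st ω n).2 = Q ++ t) ∧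
      IsBin (st ω n).1 ∧ IsBin (st ω n).2 ∧
      R₀ * Λ ^ n ≤ cfq (st ω n).1 ∧ cfq (st ω n).1 ≤ 58 * (R₀ * Λ ^ n) ∧
      R₀ * Λ ^ n ≤ cfq (st ω n).2 ∧ cfq (st ω n).2 ≤ 58 * (R₀ * Λ ^ n) := by
    intro ω n
    induction n with
    | zero =>
      simp only [st0, pow_zero, mul_one]
      exact ⟨⟨_, h𝓜.padWord _ _, rfl⟩, ⟨_, h𝓜.padWord _ _, rfl⟩,
        isBin_append.2 ⟨hP, isBin_padWord _ _⟩, isBin_append.2 ⟨hQ, isBin_padWord _ _⟩,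
        hp.1, hp.2, hq.1, hq.2⟩
    | succ n ih =>
      obtain ⟨⟨t, ht, e⟩, ⟨t', ht', e'⟩, b, b', i1, i2, i3, i4⟩ := ih
      have m := hUV𝓜 _ _ _ b b' (hRn n) i1 i2 i3 i4 (ω n)
      have q := hUVq _ _ _ b b' (hRn n) i1 i2 i3 i4 (ω n)
      rw [hsucc] at q
      simp only [st1]
      refine ⟨⟨t ++ _, h𝓜.append _ ht _ m.1, ?_⟩, ⟨t' ++ _, h𝓜.append _ ht' _ m.2, ?_⟩,
        isBin_append.2 ⟨b, h𝓜.bin _ m.1⟩, isBin_append.2 ⟨b', h𝓜.bin _ m.2⟩, q⟩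
      · rw [← List.append_assoc, ← e]
      · rw [← List.append_assoc, ← e']
  have hgrow : ∀ n, 58 * (R₀ * Λ ^ n) < R₀ * Λ ^ (n + 1) := fun n => by
    rw [← hsucc]; exact mul_lt_mul_of_pos_right hΛ (hRn n)
  have hA : ∀ ω, ∃ a ∈ omegaSeqs 𝓜, ∀ n, ∃ x ∈ binHull,
      cfMap P (cfv a) = cfMap (st ω n).1 x := fun ω =>
    exists_mem_omegaSeqs h𝓜.bin hP (fun n => (inv ω n).1) (fun n => List.prefix_append _ _)
      (fun n => length_lt_of_cfq_lt (by
        obtain ⟨-, -, -, -, -, i2, -, -⟩ := inv ω n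
        obtain ⟨-, -, -, -, i1, -, -, -⟩ := inv ω (n + 1)
        exact (i2.trans_lt (hgrow n)).trans_le i1))
  have hB : ∀ ω, ∃ a ∈ omegaSeqs 𝓜, ∀ n, ∃ x ∈ binHull,
      cfMap Q (cfv a) = cfMap (st ω n).2 x := fun ω =>
    exists_mem_omegaSeqs h𝓜.bin hQ (fun n => (inv ω n).2.1) (fun n => List.prefix_append _ _)
      (fun n => length_lt_of_cfq_lt (by
        obtain ⟨-, -, -, -, -, -, -, i2⟩ := inv ω n
        obtain ⟨-, -, -, -, -, -, i1, -⟩ := inv ω (n + 1)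
        exact (i2.trans_lt (hgrow n)).trans_le i1))
  choose A hA𝓜 hAx using hA
  choose B hB𝓜 hBx using hB
  have hdep : ∀ ω ω' n, (∀ j < n, ω j = ω' j) → st ω n = st ω' n := by
    intro ω ω' n h
    induction n with
    | zero => rfl
    | succ n ih => rw [st1, st1, ih fun j hj => h j (by omega), h n (by omega)]
  refine (le_dimH_range_of_separated (c := 1 / (Λ * R₀) ^ 2) (by positivity)
    (by nlinarith : 1 < Λ ^ 2) hσ (fun ω => cfMap P (cfv (A ω)) + cfMap Q (cfv (B ω))) ?_).trans
    (dimH_mono ?_)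
  · intro ω ω' i hj hi
    obtain ⟨x, hx, ex⟩ := hAx ω (i + 1)
    obtain ⟨x', hx', ex'⟩ := hAx ω' (i + 1)
    obtain ⟨y, hy, ey⟩ := hBx ω (i + 1)
    obtain ⟨y', hy', ey'⟩ := hBx ω' (i + 1)
    obtain ⟨-, -, b, b', i1, i2, i3, i4⟩ := inv ω i
    have h := hUVsep _ _ _ b b' (hRn i) i1 i2 i3 i4 _ _ hi _ (binHull_subset hx) _
      (binHull_subset hy) _ (binHull_subset hx') _ (binHull_subset hy')
    rw [ex, ey, ex', ey', st1, st1, ← hdep ω ω' i hj]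
    have e1 : 1 / (Λ * (R₀ * Λ ^ i)) ^ 2 * (Λ ^ 2) ^ i = 1 / (Λ * R₀) ^ 2 := by
      rw [← pow_mul, mul_comm 2 i, pow_mul]; field_simp
    rw [← e1]
    gcongr
  · rintro _ ⟨ω, rfl⟩
    exact ⟨A ω, hA𝓜 ω, B ω, hB𝓜 ω, rfl⟩

theorem exists_block_length {H L σ : ℝ} (C : ℝ) (hL : 0 < L) (h : L ^ σ < H) :
    ∃ k : ℕ, (2 * L ^ k) ^ σ * (2 + C * k * L ^ 2) < H ^ k := by
  have hLσ : 0 < L ^ σ := Real.rpow_pos_of_pos hL σ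
  set ρ := H / L ^ σ with hρ
  have hρ1 : 1 < ρ := (one_lt_div hLσ).2 h
  have t1 := tendsto_pow_const_div_const_pow_of_one_lt 1 hρ1
  have t0 := tendsto_pow_const_div_const_pow_of_one_lt 0 hρ1
  have t := (t0.const_mul (2 ^ σ * 2)).add (t1.const_mul (2 ^ σ * (C * L ^ 2)))
  simp only [mul_zero, add_zero] at t
  obtain ⟨k, hk⟩ := (t.eventually (gt_mem_nhds one_pos)).exists
  refine ⟨k, ?_⟩
  have hρk : 0 < ρ ^ k := by positivity
  have h1 : 2 ^ σ * (2 + C * k * L ^ 2) < ρ ^ k := by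
    have : (2 ^ σ * (2 + C * k * L ^ 2)) / ρ ^ k < 1 := by
      refine lt_of_eq_of_lt ?_ hk
      ring
    rwa [div_lt_one hρk] at this
  rw [Real.mul_rpow (by norm_num) (by positivity), ← Real.rpow_natCast, ← Real.rpow_mul hL.le,
    mul_comm (k : ℝ) σ, Real.rpow_mul hL.le, Real.rpow_natCast]
  have h2 : H ^ k = (L ^ σ) ^ k * ρ ^ k := by
    rw [← mul_pow, hρ]; congr 1; field_simp
  rw [h2]
  have : 0 < (L ^ σ) ^ k := by positivity
  nlinarith

/-- Sums of two continued fractions built from a prefix-free code of `H` words with continuants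
at most `L / 2` have dimension at least `log H / log L`. -/
theorem le_dimH_sum (h𝓜 : IsWordMonoid 𝓜) {H : ℕ} {wd : Fin H → List ℕ} {L σ : ℝ}
    (hL : 1 ≤ L) (hHL : (H : ℝ) ≤ L) (hσH : L ^ σ < H) (hwd𝓜 : ∀ i, wd i ∈ 𝓜)
    (hwd : ∀ i, 2 * cfq (wd i) ≤ L) (hpf : ∀ i j, wd i <+: wd j → i = j)
    {P Q : List ℕ} (hP : IsBin P) (hQ : IsBin Q) :
    ENNReal.ofReal σ ≤
      dimH {z | ∃ a ∈ omegaSeqs 𝓜, ∃ b ∈ omegaSeqs 𝓜, z = cfMap P (cfv a) + cfMap Q (cfv b)} := by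
  have hL0 : 0 < L := by linarith
  have hH : 0 < H := by
    have := (Real.rpow_pos_of_pos hL0 σ).trans hσH
    exact_mod_cast this
  obtain ⟨k, hk⟩ := exists_block_length overlapConst hL0 hσH
  obtain ⟨C, hC, hch⟩ := exists_children h𝓜 k hH hL hHL hwd𝓜 hwd hpf
  set τ := 2 * L ^ k with hτ
  set g := 2 + overlapConst * k * L ^ 2 with hg
  have hτ1 : 1 ≤ τ := by nlinarith [one_le_pow₀ hL (n := k)]
  have hτ0 : 0 < τ := by linarith
  have hC0 : 0 < C := by linarith
  have hg0 : 0 < g := by have := overlapConst_pos; positivity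
  have hX : 0 < (τ ^ σ * g) ^ 2 := by positivity
  have hXY : 1 < ((H : ℝ) ^ k) ^ 2 / (τ ^ σ * g) ^ 2 := by
    rw [one_lt_div hX]; gcongr
  obtain ⟨N, hN⟩ := pow_unbounded_of_one_lt (2 * (C ^ 2) ^ σ) hXY
  have hN' : 2 * (C ^ 2) ^ σ < (((H : ℝ) ^ k) ^ 2 / (τ ^ σ * g) ^ 2) ^ (N + 1) :=
    hN.trans (pow_lt_pow_right₀ hXY (Nat.lt_succ_self N))
  have hΛ : 58 < C * τ ^ (N + 1) := by nlinarith [one_le_pow₀ hτ1 (n := N + 1)]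
  refine le_dimH_of_extensions (Λ := C * τ ^ (N + 1)) (H := ⌈((C * τ ^ (N + 1)) ^ 2) ^ σ⌉₊) h𝓜 hΛ
    (Nat.le_ceil _) ?_ hP hQ
  intro P Q R hP hQ hR i1 i2 i3 i4
  obtain ⟨S, u, v, hcard, hmem, hq, hsep⟩ := hch (N + 1) N.succ_pos P Q R hP hQ hR i1 i2 i3 i4
  have hle : ⌈((C * τ ^ (N + 1)) ^ 2) ^ σ⌉₊ ≤ S.card := by
    apply Nat.ceil_le.2
    have e1 : ((C * τ ^ (N + 1)) ^ 2) ^ σ = (C ^ 2) ^ σ * ((τ ^ σ) ^ 2) ^ (N + 1) := by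
      rw [mul_pow, Real.mul_rpow (by positivity) (by positivity)]
      congr 1
      rw [← Real.rpow_natCast (τ ^ σ) 2, ← Real.rpow_natCast _ (N + 1), ← Real.rpow_natCast _ 2,
        ← Real.rpow_natCast _ (N + 1), ← Real.rpow_mul hτ0.le, ← Real.rpow_mul hτ0.le,
        ← Real.rpow_mul hτ0.le, ← Real.rpow_mul hτ0.le]
      ring_nf
    have e2 : (((H * H : ℕ) : ℝ) ^ k) ^ (N + 1) = (((H : ℝ) ^ k) ^ 2) ^ (N + 1) := by
      push_cast; ring
    rw [e2] at hcard
    have hgp : 0 < g ^ (2 * (N + 1)) := by positivity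
    rw [div_pow, lt_div_iff₀ (by positivity)] at hN'
    have h3 : 2 * (C ^ 2) ^ σ * ((τ ^ σ * g) ^ 2) ^ (N + 1) =
        2 * g ^ (2 * (N + 1)) * (((C * τ ^ (N + 1)) ^ 2) ^ σ) := by
      rw [e1, mul_pow (τ ^ σ), mul_pow, pow_mul g]; ring
    rw [h3] at hN'
    exact le_of_mul_le_mul_left (hN'.le.trans hcard) (by positivity)
  set f : Fin ⌈((C * τ ^ (N + 1)) ^ 2) ^ σ⌉₊ → S := fun h => S.equivFin.symm (Fin.castLE hle h)
    with hf
  have hfinj : Function.Injective f := fun a b hab => by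
    simpa [hf] using hab
  exact ⟨fun h => u (f h), fun h => v (f h), fun h => hmem _, fun h => hq _ (f h).2,
    fun h h' hne => hsep _ (f h).2 _ (f h').2 fun e => hne (hfinj (Subtype.ext e))⟩

end sums

section pressure

/-- The words of length `n` with letters `1` and `2`. -/
def binWords : ℕ → Finset (List ℕ)
  | 0 => {[]}
  | n + 1 => (binWords n).image (List.cons 1) ∪ (binWords n).image (List.cons 2)

theorem mem_binWords {n : ℕ} {w : List ℕ} : w ∈ binWords n ↔ IsBin w ∧ w.length = n := by
  induction n generalizing w with
  | zero => simp only [binWords, Finset.mem_singleton, List.length_eq_zero_iff]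
            exact ⟨fun h => ⟨by simp [h, IsBin], h⟩, fun h => h.2⟩
  | succ n ih =>
    simp only [binWords, Finset.mem_union, Finset.mem_image, ih]
    constructor
    · rintro (⟨u, ⟨hu, hl⟩, rfl⟩ | ⟨u, ⟨hu, hl⟩, rfl⟩)
      · exact ⟨isBin_cons.2 ⟨Or.inl rfl, hu⟩, by simp [hl]⟩
      · exact ⟨isBin_cons.2 ⟨Or.inr rfl, hu⟩, by simp [hl]⟩
    · rintro ⟨hw, hl⟩
      rcases w with _ | ⟨a, u⟩
      · simp at hl
      · obtain ⟨ha, hu⟩ := isBin_cons.1 hw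
        have hl' : u.length = n := by simpa using hl
        rcases ha with rfl | rfl
        · exact Or.inl ⟨u, ⟨hu, hl'⟩, rfl⟩
        · exact Or.inr ⟨u, ⟨hu, hl'⟩, rfl⟩

open Classical in
/-- The words of length `n` with letters `1` and `2` belonging to `𝓛`. -/
noncomputable def levelWords (𝓛 : Set (List ℕ)) (n : ℕ) : Finset (List ℕ) :=
  (binWords n).filter (· ∈ 𝓛)

theorem mem_levelWords {𝓛 : Set (List ℕ)} {n : ℕ} {w : List ℕ} :
    w ∈ levelWords 𝓛 n ↔ w ∈ 𝓛 ∧ IsBin w ∧ w.length = n := by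
  classical
  rw [levelWords, Finset.mem_filter, mem_binWords, and_comm]

/-- The partition function of `𝓛` at level `n`. -/
noncomputable def levelSum (𝓛 : Set (List ℕ)) (σ : ℝ) (n : ℕ) : ℝ :=
  ∑ w ∈ levelWords 𝓛 n, cfq w ^ (-σ)

/-- A set of words containing all factors of its elements. -/
def FactorClosed (𝓛 : Set (List ℕ)) : Prop := ∀ w ∈ 𝓛, ∀ u, u <:+: w → u ∈ 𝓛

variable {𝓛 : Set (List ℕ)} {σ : ℝ}

theorem levelSum_nonneg (n : ℕ) : 0 ≤ levelSum 𝓛 σ n :=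
  Finset.sum_nonneg fun _ hw => Real.rpow_nonneg (cfq_pos (mem_levelWords.1 hw).2.1).le _

theorem levelSum_add_le (h𝓛 : FactorClosed 𝓛) (hσ : 0 ≤ σ) (n m : ℕ) :
    levelSum 𝓛 σ (n + m) ≤ levelSum 𝓛 σ n * levelSum 𝓛 σ m := by
  rw [levelSum, levelSum, levelSum, Finset.sum_mul_sum, ← Finset.sum_product']
  set f : List ℕ → List ℕ × List ℕ := fun w => (w.take n, w.drop n) with hf
  have hinj : Set.InjOn f (levelWords 𝓛 (n + m)) := fun u _ v _ h => by
    rw [← List.take_append_drop n u, ← List.take_append_drop n v]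
    simp only [hf, Prod.mk.injEq] at h
    rw [h.1, h.2]
  calc ∑ w ∈ levelWords 𝓛 (n + m), cfq w ^ (-σ)
      ≤ ∑ w ∈ levelWords 𝓛 (n + m), cfq (f w).1 ^ (-σ) * cfq (f w).2 ^ (-σ) := by
        refine Finset.sum_le_sum fun w hw => ?_
        obtain ⟨-, hb, -⟩ := mem_levelWords.1 hw
        have hbu : IsBin (w.take n) := hb.of_isInfix (List.take_prefix n w).isInfix
        have hbv : IsBin (w.drop n) := hb.of_isInfix (List.drop_suffix n w).isInfix
        have h := cfq_append_ge hbu hbv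
        rw [List.take_append_drop] at h
        have p1 := cfq_pos hbu
        have p2 := cfq_pos hbv
        rw [← Real.mul_rpow p1.le p2.le]
        exact Real.rpow_le_rpow_of_nonpos (mul_pos p1 p2) h (by linarith)
    _ = ∑ p ∈ (levelWords 𝓛 (n + m)).image f, cfq p.1 ^ (-σ) * cfq p.2 ^ (-σ) :=
        (Finset.sum_image (f := fun p : List ℕ × List ℕ => cfq p.1 ^ (-σ) * cfq p.2 ^ (-σ)) hinj).symm
    _ ≤ _ := by
        refine Finset.sum_le_sum_of_subset_of_nonneg ?_ ?_
        · intro p hp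
          obtain ⟨w, hw, rfl⟩ := Finset.mem_image.1 hp
          obtain ⟨hL, hb, hl⟩ := mem_levelWords.1 hw
          rw [Finset.mem_product, mem_levelWords, mem_levelWords]
          have i1 : w.take n <:+: w := (List.take_prefix n w).isInfix
          have i2 : w.drop n <:+: w := (List.drop_suffix n w).isInfix
          exact ⟨⟨h𝓛 w hL _ i1, hb.of_isInfix i1, by simp [hf, hl]⟩,
            ⟨h𝓛 w hL _ i2, hb.of_isInfix i2, by simp [hf, hl]⟩⟩
        · intro p hp _
          rw [Finset.mem_product, mem_levelWords, mem_levelWords] at hp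
          exact mul_nonneg (Real.rpow_nonneg (cfq_pos hp.1.2.1).le _)
            (Real.rpow_nonneg (cfq_pos hp.2.2.1).le _)

theorem exists_sum_levelSum_le (h𝓛 : FactorClosed 𝓛) (hσ : 0 ≤ σ) {N : ℕ} (hN : 0 < N)
    (h : levelSum 𝓛 σ N < 1) : ∃ Z : ℝ, 0 ≤ Z ∧ ∀ M, ∑ n ∈ Finset.range M, levelSum 𝓛 σ n ≤ Z := by
  set S : ℕ → ℝ := fun M => ∑ n ∈ Finset.range M, levelSum 𝓛 σ n with hS
  have hS0 : ∀ M, 0 ≤ S M := fun M => Finset.sum_nonneg fun n _ => levelSum_nonneg n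
  set z := levelSum 𝓛 σ N with hz
  have hz0 : 0 ≤ z := levelSum_nonneg N
  refine ⟨S N / (1 - z), div_nonneg (hS0 N) (by linarith), fun M => ?_⟩
  have hfix : S N + z * (S N / (1 - z)) = S N / (1 - z) := by
    have : 1 - z ≠ 0 := by linarith
    field_simp; ring
  induction M using Nat.strong_induction_on with
  | _ M ih =>
    rcases lt_or_ge M N with hM | hM
    · refine (Finset.sum_le_sum_of_subset_of_nonneg (Finset.range_mono hM.le)
        fun n _ _ => levelSum_nonneg n).trans ?_
      rw [← hfix]
      have := div_nonneg (hS0 N) (by linarith : 0 ≤ 1 - z)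
      nlinarith [mul_nonneg hz0 this]
    · obtain ⟨K, rfl⟩ := Nat.exists_eq_add_of_le hM
      rw [Finset.sum_range_add, ← hfix]
      gcongr
      refine (Finset.sum_le_sum fun n _ => levelSum_add_le h𝓛 hσ N n).trans ?_
      rw [← Finset.mul_sum]
      gcongr
      exact ih K (by omega)

theorem seqTake_snoc (a : ℕ → ℕ) (n : ℕ) : seqTake a (n + 1) = seqTake a n ++ [a n] := by
  simp [seqTake, List.range_succ]

/-- The words of `𝓛` whose continuant is comparable with `T`. -/
theorem exists_stopping_words (h𝓛 : FactorClosed 𝓛) (hσ : 0 ≤ σ) {N : ℕ} (hN : 0 < N)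
    (h : levelSum 𝓛 σ N < 1) : ∃ Z : ℝ, 0 ≤ Z ∧ ∀ T : ℝ, 1 ≤ T → ∃ S : Finset (List ℕ),
      (S.card : ℝ) ≤ Z * T ^ σ ∧ (∀ w ∈ S, IsBin w ∧ T ≤ cfq w) ∧
      ∀ a, BinSeq a → (∀ n, seqTake a n ∈ 𝓛) → ∃ n, seqTake a n ∈ S := by
  classical
  obtain ⟨Z, hZ0, hZ⟩ := exists_sum_levelSum_le h𝓛 hσ hN h
  refine ⟨Z * 3 ^ σ, by positivity, fun T hT => ?_⟩
  set M := 2 * (⌈3 * T⌉₊ + 1) with hM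
  set S := ((Finset.range M).biUnion (levelWords 𝓛)).filter (fun w => T ≤ cfq w ∧ cfq w ≤ 3 * T)
    with hS
  have hSb : ∀ w ∈ S, IsBin w ∧ T ≤ cfq w ∧ cfq w ≤ 3 * T := by
    intro w hw
    rw [hS, Finset.mem_filter, Finset.mem_biUnion] at hw
    obtain ⟨⟨n, -, hn⟩, h1⟩ := hw
    exact ⟨(mem_levelWords.1 hn).2.1, h1⟩
  refine ⟨S, ?_, fun w hw => ⟨(hSb w hw).1, (hSb w hw).2.1⟩, ?_⟩
  · have h1 : (S.card : ℝ) * (3 * T) ^ (-σ) ≤ Z := by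
      calc (S.card : ℝ) * (3 * T) ^ (-σ) = ∑ w ∈ S, (3 * T) ^ (-σ) := by simp
        _ ≤ ∑ w ∈ S, cfq w ^ (-σ) := Finset.sum_le_sum fun w hw =>
            Real.rpow_le_rpow_of_nonpos (cfq_pos (hSb w hw).1) (hSb w hw).2.2 (by linarith)
        _ ≤ ∑ w ∈ (Finset.range M).biUnion (levelWords 𝓛), cfq w ^ (-σ) := by
            refine Finset.sum_le_sum_of_subset_of_nonneg (Finset.filter_subset _ _) fun w hw _ => ?_
            obtain ⟨n, -, hn⟩ := Finset.mem_biUnion.1 hw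
            exact Real.rpow_nonneg (cfq_pos (mem_levelWords.1 hn).2.1).le _
        _ = ∑ n ∈ Finset.range M, levelSum 𝓛 σ n := by
            refine Finset.sum_biUnion fun i _ j _ hij => ?_
            refine Finset.disjoint_left.2 fun w h1 h2 => hij ?_
            rw [← (mem_levelWords.1 h1).2.2, ← (mem_levelWords.1 h2).2.2]
        _ ≤ Z := hZ M
    have h2 : 0 < (3 * T) ^ σ := by positivity
    rw [Real.rpow_neg (by positivity), ← div_eq_mul_inv, div_le_iff₀ h2,
      Real.mul_rpow (by norm_num) (by linarith)] at h1
    linarith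
  · intro a ha haL
    have hex : ∃ n, T ≤ cfq (seqTake a n) := by
      refine ⟨2 * ⌈T⌉₊, ?_⟩
      have h1 := two_pow_le_cfq (n := ⌈T⌉₊) (ha.isBin_take (2 * ⌈T⌉₊)) (by simp)
      have h2 : ((⌈T⌉₊ : ℕ) : ℝ) ≤ 2 ^ ⌈T⌉₊ := by exact_mod_cast (Nat.lt_two_pow_self).le
      linarith [Nat.le_ceil T]
    set n := Nat.find hex with hn
    have h1 : T ≤ cfq (seqTake a n) := Nat.find_spec hex
    have h2 : cfq (seqTake a n) ≤ 3 * T := by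
      rcases Nat.eq_zero_or_pos n with h0 | h0
      · rw [h0]; simp [cfq]; linarith
      · obtain ⟨k, hk⟩ := Nat.exists_eq_succ_of_ne_zero h0.ne'
        have h3 : cfq (seqTake a k) < T := not_le.1 (Nat.find_min hex (by omega))
        rw [hk, seqTake_snoc]
        have := cfq_snoc_le (ha.isBin_take k) (ha k)
        linarith
    refine ⟨n, ?_⟩
    rw [hS, Finset.mem_filter, Finset.mem_biUnion]
    refine ⟨⟨n, ?_, mem_levelWords.2 ⟨haL n, ha.isBin_take n, by simp⟩⟩, h1, h2⟩
    rw [Finset.mem_range]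
    by_contra hlt
    have h3 := two_pow_le_cfq (n := ⌈3 * T⌉₊ + 1) (ha.isBin_take n) (by simp; omega)
    have h4 : ((⌈3 * T⌉₊ + 1 : ℕ) : ℝ) < 2 ^ (⌈3 * T⌉₊ + 1) := by exact_mod_cast Nat.lt_two_pow_self
    push_cast at h4
    linarith [Nat.le_ceil (3 * T)]

/-- A set covered at every scale `T⁻²` by `O(T ^ (2σ))` balls has dimension at most `σ`. -/
theorem dimH_le_of_cover {E : Set ℝ} {σ C c : ℝ} (hσ : 0 ≤ σ) (hc : 0 < c)
    (h : ∀ T : ℝ, 1 ≤ T → ∃ S : Finset ℝ, (S.card : ℝ) ≤ C * T ^ (2 * σ) ∧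
      E ⊆ ⋃ x ∈ S, Metric.closedBall x (c / T ^ 2)) : dimH E ≤ ENNReal.ofReal σ := by
  choose! S hcard hcov using h
  set T : ℕ → ℝ := fun n => n + 1 with hT
  have hT1 : ∀ n, 1 ≤ T n := fun n => by simp [hT]
  set r : ℕ → ℝ≥0∞ := fun n => ENNReal.ofReal (2 * (c / T n ^ 2)) with hr
  have hr0 : Tendsto r atTop (nhds 0) := by
    rw [← ENNReal.ofReal_zero]
    refine ENNReal.tendsto_ofReal ?_
    have h1 : Tendsto T atTop atTop := tendsto_atTop_add_const_right _ _ tendsto_natCast_atTop_atTop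
    have h2 : Tendsto (fun n => T n ^ 2) atTop atTop := (tendsto_pow_atTop two_ne_zero).comp h1
    simpa using (h2.const_div_atTop c).const_mul 2
  have hdiam : ∀ n (x : ℝ), Metric.ediam (Metric.closedBall x (c / T n ^ 2)) ≤ r n := by
    intro n x
    rw [Real.closedBall_eq_Icc, Real.ediam_Icc]
    exact ENNReal.ofReal_le_ofReal (by linarith)
  have key := Measure.hausdorffMeasure_le_liminf_sum (β := ℕ) (ι := fun n => S (T n)) σ E
    r hr0 (fun n i => Metric.closedBall (i : ℝ) (c / T n ^ 2))
    (Eventually.of_forall fun n i => hdiam n i)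
    (Eventually.of_forall fun n => (hcov _ (hT1 n)).trans (by
      intro y hy
      simp only [mem_iUnion] at hy ⊢
      obtain ⟨x, hx, hy⟩ := hy
      exact ⟨⟨x, hx⟩, hy⟩))
  have hbound : ∀ n, ∑ i : S (T n), Metric.ediam (Metric.closedBall (i : ℝ) (c / T n ^ 2)) ^ σ ≤
      ENNReal.ofReal (C * (2 * c) ^ σ) := by
    intro n
    have hTn : 0 < T n := by linarith [hT1 n]
    calc ∑ i : S (T n), Metric.ediam (Metric.closedBall (i : ℝ) (c / T n ^ 2)) ^ σ
        ≤ ∑ i : S (T n), ENNReal.ofReal ((2 * (c / T n ^ 2)) ^ σ) := by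
          refine Finset.sum_le_sum fun i _ => ?_
          rw [← ENNReal.ofReal_rpow_of_nonneg (by positivity) hσ]
          exact ENNReal.rpow_le_rpow (hdiam n i) hσ
      _ = ENNReal.ofReal ((S (T n)).card * (2 * (c / T n ^ 2)) ^ σ) := by
          rw [ENNReal.ofReal_mul (by positivity)]; simp
      _ ≤ _ := by
          refine ENNReal.ofReal_le_ofReal ?_
          calc _ ≤ C * T n ^ (2 * σ) * (2 * (c / T n ^ 2)) ^ σ := by
                gcongr; exact hcard _ (hT1 n)
            _ = C * (2 * c) ^ σ := by
                rw [← mul_div_assoc, Real.div_rpow (by positivity) (by positivity),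
                  Real.rpow_mul hTn.le, Real.rpow_two]
                field_simp
  refine dimH_le_of_hausdorffMeasure_ne_top (d := ⟨σ, hσ⟩) ?_ |>.trans ?_
  · refine ne_top_of_le_ne_top (ENNReal.ofReal_ne_top (r := C * (2 * c) ^ σ)) (key.trans ?_)
    exact (liminf_le_liminf (Eventually.of_forall hbound)).trans (by simp)
  · exact (ENNReal.ofReal_eq_coe_nnreal hσ).ge

theorem cfv_mem_closedBall {a : ℕ → ℕ} (ha : BinSeq a) {n : ℕ} {T : ℝ} (hT : 1 ≤ T)
    (h : T ≤ cfq (seqTake a n)) : |cfv a - cfMap (seqTake a n) 0| ≤ 1 / T ^ 2 := by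
  rw [cfv_take_drop ha.posSeq n]
  refine (abs_cfMap_sub_le_inv (ha.isBin_take n) (cfv_mem_Icc (ha.drop n).posSeq)
    zero_mem_Icc01).trans ?_
  gcongr

theorem dimH_cfv_le (h𝓛 : FactorClosed 𝓛) (hσ : 0 ≤ σ) {N : ℕ} (hN : 0 < N)
    (h : levelSum 𝓛 σ N < 1) :
    dimH {x | ∃ a, BinSeq a ∧ (∀ n, seqTake a n ∈ 𝓛) ∧ x = cfv a} ≤ ENNReal.ofReal (σ / 2) := by
  classical
  obtain ⟨Z, hZ0, hZ⟩ := exists_stopping_words h𝓛 hσ hN h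
  refine dimH_le_of_cover (C := Z) (c := 1) (by linarith) one_pos fun T hT => ?_
  obtain ⟨S, hc, hSq, hS⟩ := hZ T hT
  refine ⟨S.image fun w => cfMap w 0, ?_, ?_⟩
  · rw [mul_div_cancel₀ _ two_ne_zero]
    exact (Nat.cast_le.2 Finset.card_image_le).trans hc
  · rintro _ ⟨a, ha, haL, rfl⟩
    obtain ⟨n, hn⟩ := hS a ha haL
    simp only [mem_iUnion]
    refine ⟨_, Finset.mem_image_of_mem _ hn, ?_⟩
    rw [Metric.mem_closedBall, Real.dist_eq]
    exact cfv_mem_closedBall ha hT (hSq _ hn).2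

theorem dimH_closure_sum_le (h𝓛 : FactorClosed 𝓛) (hσ : 0 ≤ σ) {N : ℕ} (hN : 0 < N)
    (h : levelSum 𝓛 σ N < 1) :
    dimH (closure {z : ℝ | ∃ d : ℕ, (d = 1 ∨ d = 2) ∧ ∃ a b, BinSeq a ∧ BinSeq b ∧
      (∀ n, seqTake a n ∈ 𝓛) ∧ (∀ n, seqTake b n ∈ 𝓛) ∧ z = d + cfv a + cfv b}) ≤
      ENNReal.ofReal σ := by
  classical
  obtain ⟨Z, hZ0, hZ⟩ := exists_stopping_words h𝓛 hσ hN h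
  refine dimH_le_of_cover (C := 2 * Z ^ 2) (c := 2) hσ two_pos fun T hT => ?_
  obtain ⟨S, hc, hSq, hS⟩ := hZ T hT
  refine ⟨(({1, 2} : Finset ℕ) ×ˢ (S ×ˢ S)).image
    fun p => (p.1 : ℝ) + cfMap p.2.1 0 + cfMap p.2.2 0, ?_, ?_⟩
  · refine (Nat.cast_le.2 Finset.card_image_le).trans ?_
    rw [Finset.card_product, Finset.card_product]
    have h2 : (({1, 2} : Finset ℕ).card : ℝ) = 2 := by norm_num
    push_cast
    rw [h2, two_mul σ, Real.rpow_add (by linarith)]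
    nlinarith [mul_le_mul hc hc (by positivity) (by positivity)]
  · refine closure_minimal ?_ ?_
    · rintro _ ⟨d, hd, a, b, ha, hb, haL, hbL, rfl⟩
      obtain ⟨n, hn⟩ := hS a ha haL
      obtain ⟨m, hm⟩ := hS b hb hbL
      simp only [mem_iUnion]
      refine ⟨_, Finset.mem_image_of_mem _ (a := (d, seqTake a n, seqTake b m)) ?_, ?_⟩
      · simp [hd, hn, hm]
      · rw [Metric.mem_closedBall, Real.dist_eq]
        have h1 := cfv_mem_closedBall ha hT (hSq _ hn).2
        have h2 := cfv_mem_closedBall hb hT (hSq _ hm).2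
        rw [abs_le] at *
        have e : 2 / T ^ 2 = 1 / T ^ 2 + 1 / T ^ 2 := by ring
        constructor <;> simp only [e] <;> linarith [h1.1, h1.2, h2.1, h2.2]
    · exact Set.Finite.isClosed_biUnion (Finset.finite_toSet _) fun x _ => Metric.isClosed_closedBall

end pressure

section codes

theorem cfq_flatMap_le_prod {ι : Type*} {wd : ι → List ℕ} (hb : ∀ i, IsBin (wd i)) (l : List ι) :
    IsBin (l.flatMap wd) ∧ cfq (l.flatMap wd) ≤ (l.map fun i => 2 * cfq (wd i)).prod := by
  induction l with
  | nil => simp [cfq]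
  | cons a l ih =>
    rw [List.flatMap_cons, List.map_cons, List.prod_cons]
    refine ⟨isBin_append.2 ⟨hb a, ih.1⟩, (cfq_append_le (hb a) ih.1).trans ?_⟩
    have := cfq_pos (hb a)
    gcongr
    exact ih.2

/-- A prefix-free code of large total weight can be replaced by a homogeneous one. -/
theorem exists_homogeneous_code {𝓐 : Finset (List ℕ)} {σ : ℝ} (hb : ∀ w ∈ 𝓐, IsBin w)
    (hpf : ∀ u ∈ 𝓐, ∀ v ∈ 𝓐, u <+: v → u = v) (hσ : 0 ≤ σ) (hσ1 : σ < 1)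
    (hsum : 1 < ∑ w ∈ 𝓐, (2 * cfq w) ^ (-σ)) :
    ∃ (H : ℕ) (L : ℝ) (wd : Fin H → List ℕ), 1 ≤ L ∧ (H : ℝ) ≤ L ∧ L ^ σ < H ∧
      (∀ i, 2 * cfq (wd i) ≤ L) ∧ (∀ i j, wd i <+: wd j → i = j) ∧
      ∀ i, ∃ l : List 𝓐, wd i = l.flatMap Subtype.val := by
  classical
  set wd₀ : 𝓐 → List ℕ := Subtype.val with hwd₀
  have hb₀ : ∀ i, IsBin (wd₀ i) := fun i => hb _ i.2
  have hpf₀ : ∀ i j, wd₀ i <+: wd₀ j → i = j := fun i j h => Subtype.ext (hpf _ i.2 _ j.2 h)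
  set S := ∑ w ∈ 𝓐, (2 * cfq w) ^ (-σ) with hS
  set L₀ : ℝ := ∑ i : 𝓐, 2 * cfq (wd₀ i) with hL₀
  have hq₀ : ∀ i, 0 < 2 * cfq (wd₀ i) := fun i => by linarith [cfq_pos (hb₀ i)]
  have hle₀ : ∀ i, 2 * cfq (wd₀ i) ≤ L₀ := fun i =>
    Finset.single_le_sum (f := fun i => 2 * cfq (wd₀ i)) (fun i _ => (hq₀ i).le) (Finset.mem_univ i)
  have hL₀0 : 0 ≤ L₀ := Finset.sum_nonneg fun i _ => (hq₀ i).le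
  obtain ⟨B, hB⟩ := pow_unbounded_of_one_lt L₀ (one_lt_two (α := ℝ))
  obtain ⟨k, hk⟩ := exists_block_length (B : ℝ) one_pos (σ := 2 * σ) (by rwa [Real.one_rpow])
  rw [one_pow, mul_one, one_pow, mul_one] at hk
  set W : (Fin k → 𝓐) → List ℕ := fun f => (List.ofFn f).flatMap wd₀ with hW
  have hWb : ∀ f, IsBin (W f) := fun f => (cfq_flatMap_le_prod hb₀ _).1
  have hWq : ∀ f, cfq (W f) ≤ ∏ i, 2 * cfq (wd₀ (f i)) := fun f => by
    have := (cfq_flatMap_le_prod hb₀ (List.ofFn f)).2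
    rwa [List.map_ofFn, List.prod_ofFn] at this
  have hWL : ∀ f, cfq (W f) < 2 ^ (B * k + 1) := fun f => by
    refine ((cfq_flatMap_le hL₀0 hb₀ hle₀ (List.ofFn f)).2.trans ?_).trans_lt
      (pow_lt_pow_right₀ one_lt_two (Nat.lt_succ_self (B * k)))
    rw [List.length_ofFn, pow_mul]
    gcongr
  set c : (Fin k → 𝓐) → ℕ := fun f => Nat.log 2 ⌊cfq (W f)⌋₊ with hc
  have hfl : ∀ f, ⌊cfq (W f)⌋₊ ≠ 0 := fun f =>
    (Nat.floor_pos.2 (one_le_cfq (hWb f))).ne'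
  have hc1 : ∀ f, (2 : ℝ) ^ c f ≤ cfq (W f) := fun f => by
    have h1 : ((2 ^ c f : ℕ) : ℝ) ≤ (⌊cfq (W f)⌋₊ : ℝ) := Nat.cast_le.2 (Nat.pow_log_le_self 2 (hfl f))
    push_cast at h1
    exact h1.trans (Nat.floor_le (cfq_pos (hWb f)).le)
  have hc2 : ∀ f, cfq (W f) < (2 : ℝ) ^ (c f + 1) := fun f => by
    have h1 : ⌊cfq (W f)⌋₊ < 2 ^ (c f + 1) := Nat.lt_pow_succ_log_self one_lt_two _
    have := (Nat.floor_lt (cfq_pos (hWb f)).le).1 h1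
    exact_mod_cast this
  have hcm : ∀ f, c f ∈ Finset.range (B * k + 1) := fun f => by
    rw [Finset.mem_range]
    exact (pow_lt_pow_iff_right₀ (one_lt_two (α := ℝ))).1 ((hc1 f).trans_lt (hWL f))
  have htot : S ^ k ≤ ∑ f, cfq (W f) ^ (-σ) := by
    rw [hS, ← Finset.sum_coe_sort, Fintype.sum_pow]
    refine Finset.sum_le_sum fun f _ => ?_
    rw [Real.finsetProd_rpow _ _ fun i _ => (hq₀ (f i)).le]
    exact Real.rpow_le_rpow_of_nonpos (cfq_pos (hWb f)) (hWq f) (by linarith)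
  obtain ⟨j, -, hj⟩ : ∃ j ∈ Finset.range (B * k + 1),
      (2 : ℝ) ^ (2 * σ) < ∑ f with c f = j, cfq (W f) ^ (-σ) := by
    refine Finset.exists_lt_of_sum_lt ?_
    rw [Finset.sum_fiberwise_of_maps_to fun f _ => hcm f]
    refine lt_of_lt_of_le ?_ (hk.le.trans htot)
    have : 0 < (2 : ℝ) ^ (2 * σ) := by positivity
    rw [Finset.sum_const, Finset.card_range, nsmul_eq_mul]
    push_cast
    nlinarith
  set F := Finset.univ.filter fun f => c f = j with hF
  have hcard : ((2 ^ (j + 2) : ℕ) : ℝ) ^ σ < F.card := by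
    have h1 : ∑ f ∈ F, cfq (W f) ^ (-σ) ≤ F.card * ((2 : ℝ) ^ j) ^ (-σ) := by
      rw [← nsmul_eq_mul, ← Finset.sum_const]
      refine Finset.sum_le_sum fun f hf => ?_
      rw [← (Finset.mem_filter.1 hf).2]
      exact Real.rpow_le_rpow_of_nonpos (by positivity) (hc1 f) (by linarith)
    have h2 := hj.trans_le h1
    have h3 : 0 < ((2 : ℝ) ^ j) ^ σ := by positivity
    rw [Real.rpow_neg (by positivity), ← div_eq_mul_inv, lt_div_iff₀ h3] at h2
    refine lt_of_eq_of_lt ?_ h2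
    push_cast
    rw [pow_add, Real.mul_rpow (by positivity) (by positivity), mul_comm, Real.rpow_mul (by norm_num),
      Real.rpow_two]
  set L : ℕ := 2 ^ (j + 2) with hL
  have hL1 : 1 < L := Nat.one_lt_two_pow (by omega)
  have hL1' : (1 : ℝ) < L := by exact_mod_cast hL1
  have hLσ : (L : ℝ) ^ σ < L := by
    conv_rhs => rw [← Real.rpow_one (L : ℝ)]
    exact Real.rpow_lt_rpow_of_exponent_lt hL1' hσ1
  have hLσ0 : 0 ≤ (L : ℝ) ^ σ := by positivity
  have hHF : ⌊(L : ℝ) ^ σ⌋₊ + 1 ≤ F.card := (Nat.floor_lt hLσ0).2 hcard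
  set e : Fin (⌊(L : ℝ) ^ σ⌋₊ + 1) → F := fun h => F.equivFin.symm (Fin.castLE hHF h) with he
  have heinj : Function.Injective e := fun a b hab => by simpa [he] using hab
  refine ⟨⌊(L : ℝ) ^ σ⌋₊ + 1, L, fun i => W (e i), hL1'.le, ?_, ?_, fun i => ?_, fun i i' h => ?_,
    fun i => ⟨_, rfl⟩⟩
  · exact_mod_cast (Nat.floor_lt hLσ0).2 hLσ
  · push_cast; exact Nat.lt_floor_add_one _
  · have h1 := hc2 (e i)
    rw [(Finset.mem_filter.1 (e i).2).2] at h1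
    have h2 : (L : ℝ) = 2 ^ (j + 1) * 2 := by rw [hL]; push_cast; ring
    change 2 * cfq (W (e i)) ≤ L
    linarith
  · refine heinj (Subtype.ext ?_)
    by_contra hne
    obtain ⟨m, hm, hmin⟩ : ∃ m, (e i).1 m ≠ (e i').1 m ∧ ∀ l < m, (e i).1 l = (e i').1 l := by
      have hex : ∃ m, (e i).1 m ≠ (e i').1 m := Function.ne_iff.1 hne
      obtain ⟨m, hm, hmin⟩ := WellFounded.has_min (wellFounded_lt (α := Fin k))
        {m | (e i).1 m ≠ (e i').1 m} hex
      exact ⟨m, hm, fun l hl => not_not.1 fun h => hmin l h hl⟩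
    obtain ⟨w, a, b, x, y, hab, h1, h2, -⟩ := exists_branch_flatMap hL₀0 hb₀ hle₀ hpf₀ hmin hm
    simp only [hW] at h
    rw [h1, h2] at h
    rw [List.prefix_append_right_inj] at h
    exact hab (List.cons_prefix_cons.1 h).1

variable {𝓜 : Set (List ℕ)} {𝓐 : Finset (List ℕ)} {σ : ℝ}

/-- Sums of two continued fractions built from a prefix-free code of total weight larger than one
have large dimension. -/
theorem le_dimH_sum_of_code (h𝓜 : IsWordMonoid 𝓜) (h𝓐 : ∀ w ∈ 𝓐, w ∈ 𝓜)
    (hpf : ∀ u ∈ 𝓐, ∀ v ∈ 𝓐, u <+: v → u = v) (hσ : 0 ≤ σ) (hσ1 : σ < 1)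
    (hsum : 1 < ∑ w ∈ 𝓐, (2 * cfq w) ^ (-σ)) {P Q : List ℕ} (hP : IsBin P) (hQ : IsBin Q) :
    ENNReal.ofReal σ ≤
      dimH {z | ∃ a ∈ omegaSeqs 𝓜, ∃ b ∈ omegaSeqs 𝓜, z = cfMap P (cfv a) + cfMap Q (cfv b)} := by
  obtain ⟨H, L, wd, hL, hHL, hLσ, hwd, hpf', hl⟩ := exists_homogeneous_code
    (fun w hw => h𝓜.bin w (h𝓐 w hw)) hpf hσ hσ1 hsum
  refine le_dimH_sum h𝓜 hL hHL hLσ (fun i => ?_) hwd hpf' hP hQ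
  obtain ⟨l, e⟩ := hl i
  rw [e]
  exact h𝓜.flatMap (fun w => h𝓐 _ w.2) l

/-- Continued fractions built from a prefix-free code of total weight larger than one
have large dimension. -/
theorem le_dimH_cfv_of_code (h𝓜 : IsWordMonoid 𝓜) (h𝓐 : ∀ w ∈ 𝓐, w ∈ 𝓜)
    (hpf : ∀ u ∈ 𝓐, ∀ v ∈ 𝓐, u <+: v → u = v) (hσ : 0 ≤ σ) (hσ1 : σ < 1)
    (hsum : 1 < ∑ w ∈ 𝓐, (2 * cfq w) ^ (-σ)) :
    ENNReal.ofReal (σ / 2) ≤ dimH {x | ∃ a ∈ omegaSeqs 𝓜, x = cfv a} := by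
  obtain ⟨H, L, wd, hL, hHL, hLσ, hwd, hpf', hl⟩ := exists_homogeneous_code
    (fun w hw => h𝓜.bin w (h𝓐 w hw)) hpf hσ hσ1 hsum
  have hwd𝓜 : ∀ i, wd i ∈ 𝓜 := fun i => by
    obtain ⟨l, e⟩ := hl i
    rw [e]
    exact h𝓜.flatMap (fun w => h𝓐 _ w.2) l
  have hL0 : 0 < L := by linarith
  have hb : ∀ i, IsBin (wd i) := fun i => h𝓜.bin _ (hwd𝓜 i)
  have hH : 1 < H := by
    have := (Real.one_le_rpow hL hσ).trans_lt hLσ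
    exact_mod_cast this
  have hL1 : 1 < L := lt_of_lt_of_le (by exact_mod_cast hH) hHL
  have hne : ∀ i, wd i ≠ [] := fun i h => by
    have h1 : ∀ j, i = j := fun j => hpf' i j (by rw [h]; exact List.nil_prefix)
    have h2 := (h1 ⟨0, by omega⟩).symm.trans (h1 ⟨1, hH⟩)
    simp at h2
  set W : (ℕ → Fin H) → ℕ → List ℕ := fun ω n => (List.ofFn fun i : Fin n => ω i).flatMap wd with hW
  have hWs : ∀ ω n, W ω (n + 1) = W ω n ++ wd (ω n) := fun ω n => by
    simp only [hW]
    rw [List.ofFn_succ_last, List.flatMap_append]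
    simp
  have hA : ∀ ω, ∃ a ∈ omegaSeqs 𝓜, ∀ n, ∃ x ∈ binHull, cfMap [] (cfv a) = cfMap (W ω n) x := by
    intro ω
    refine exists_mem_omegaSeqs h𝓜.bin (by simp) (fun n => ⟨W ω n, h𝓜.flatMap hwd𝓜 _, rfl⟩)
      (fun n => by rw [hWs]; exact List.prefix_append _ _) (fun n => ?_)
    rw [hWs, List.length_append]
    have := List.length_pos_iff.2 (hne (ω n))
    omega
  choose A hA𝓜 hAx using hA
  refine (le_dimH_range_of_separated (c := 1 / (32 * L ^ 2)) (Λ := L ^ 2) (by positivity)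
    (by nlinarith) ?_ (fun ω => cfv (A ω)) ?_).trans (dimH_mono ?_)
  · rw [← Real.rpow_natCast, ← Real.rpow_mul hL0.le]
    push_cast
    rw [mul_div_cancel₀ _ two_ne_zero]
    exact hLσ.le
  · intro ω ω' i hj hi
    obtain ⟨x, hx, ex⟩ := hAx ω (i + 1)
    obtain ⟨x', hx', ex'⟩ := hAx ω' (i + 1)
    rw [cfMap_nil] at ex ex'
    obtain ⟨w, a, b, u, v, hab, h1, h2, hq⟩ := exists_branch_flatMap hL0.le hb hwd hpf'
      (f := fun l : Fin (i + 1) => ω l) (f' := fun l : Fin (i + 1) => ω' l) (m := Fin.last i)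
      (fun l hl => hj l hl) hi
    have hb1 := (cfq_flatMap_le hL0.le hb hwd (List.ofFn fun l : Fin (i + 1) => ω l)).1
    have hb2 := (cfq_flatMap_le hL0.le hb hwd (List.ofFn fun l : Fin (i + 1) => ω' l)).1
    rw [h1, isBin_append, isBin_cons] at hb1
    rw [h2, isBin_append, isBin_cons] at hb2
    rw [ex, ex']
    simp only [hW]
    rw [h1, h2]
    have hsep := cfMap_separated hb1.1 hb1.2.1 hb2.2.1 hab hb1.2.2 hb2.2.2 hx hx'
    have hw := cfq_pos hb1.1
    rw [Fin.val_last] at hq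
    calc 1 / (32 * L ^ 2) = 1 / (32 * (L ^ (i + 1)) ^ 2) * (L ^ 2) ^ i := by field_simp; ring
      _ ≤ 1 / (32 * cfq w ^ 2) * (L ^ 2) ^ i := by gcongr
      _ ≤ _ := by gcongr
  · rintro _ ⟨ω, rfl⟩
    exact ⟨A ω, hA𝓜 ω, rfl⟩

end codes

section goodWords

/-- The words without factor `v`. -/
def avoiding (v : List ℕ) : Set (List ℕ) := {w | ¬ v <:+: w}

/-- The words without factor `121`. -/
abbrev goodWords : Set (List ℕ) := avoiding [1, 2, 1]

theorem factorClosed_avoiding (v : List ℕ) : FactorClosed (avoiding v) :=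
  fun _ hw _ hu h => hw (h.trans hu)

theorem infix_seqTake {a : ℕ → ℕ} {w : List ℕ} {N : ℕ} :
    w <:+: seqTake a N ↔ ∃ n, n + w.length ≤ N ∧ seqTake (shift a n) w.length = w := by
  constructor
  · rintro ⟨s, t, h⟩
    have hl := congrArg List.length h
    simp only [List.length_append, length_seqTake] at hl
    refine ⟨s.length, by omega, ?_⟩
    rw [← hl, seqTake_add, seqTake_add] at h
    exact (List.append_inj (List.append_inj h (by simp)).1 (by simp)).2.symm
  · rintro ⟨n, hn, h⟩
    obtain ⟨k, rfl⟩ := Nat.exists_eq_add_of_le hn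
    rw [seqTake_add, seqTake_add, h]
    exact ⟨_, _, rfl⟩

theorem forall_seqTake_mem_avoiding {a : ℕ → ℕ} {v : List ℕ} :
    (∀ n, seqTake a n ∈ avoiding v) ↔ ∀ n, seqTake (shift a n) v.length ≠ v := by
  constructor
  · exact fun h n e => h (n + v.length) (infix_seqTake.2 ⟨n, le_rfl, e⟩)
  · rintro h n hv
    obtain ⟨m, -, e⟩ := infix_seqTake.1 hv
    exact h m e

/-- The sequences in `1, 2` without factor `121`. -/
def GoodSeq (a : ℕ → ℕ) : Prop := BinSeq a ∧ ∀ n, seqTake a n ∈ goodWords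

theorem goodSeq_iff {a : ℕ → ℕ} :
    GoodSeq a ↔ BinSeq a ∧ ∀ n, ¬(a n = 1 ∧ a (n + 1) = 2 ∧ a (n + 2) = 1) := by
  rw [GoodSeq, forall_seqTake_mem_avoiding]
  refine and_congr_right fun _ => forall_congr' fun n => ?_
  simp [seqTake, List.range_succ]

theorem GoodSeq.drop {a : ℕ → ℕ} (h : GoodSeq a) (n : ℕ) : GoodSeq (shift a n) := by
  rw [goodSeq_iff] at h ⊢
  exact ⟨h.1.drop n, fun m => h.2 (n + m)⟩

theorem K2_eq : K2 = {x | ∃ a, BinSeq a ∧ (∀ n, seqTake a n ∈ goodWords) ∧ x = cfv a} := by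
  ext x
  simp only [K2, mem_ofPred_eq]
  constructor
  · rintro ⟨-, a, h0, h1, h2, rfl⟩
    have hb : BinSeq (shift a 1) := fun n => h1 _ (by omega)
    have hg : GoodSeq (shift a 1) := goodSeq_iff.2 ⟨hb, fun n => by
      have := h2 (1 + n) (by omega)
      simpa [shift, add_assoc] using this⟩
    refine ⟨shift a 1, hb, hg.2, ?_⟩
    rw [cfVal_eq fun n => by have := one_le_cast_of_bin (h1 (n + 1) (by omega)); exact this, h0, cfv]
    simp [add_comm]
  · rintro ⟨a, hb, hg, rfl⟩
    have hg' : GoodSeq a := ⟨hb, hg⟩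
    refine ⟨⟨cfv_pos hb.posSeq, cfv_lt_one hb.posSeq⟩, fun n => if n = 0 then 0 else a (n - 1), rfl,
      fun n hn => ?_, fun n hn => ?_, ?_⟩
    · beta_reduce
      rw [if_neg (by omega)]; exact hb _
    · beta_reduce
      rw [if_neg (by omega), if_neg (by omega), if_neg (by omega)]
      have := (goodSeq_iff.1 hg').2 (n - 1)
      rwa [show n - 1 + 1 = n + 1 - 1 by omega, show n - 1 + 2 = n + 2 - 1 by omega] at this
    · rw [cfVal_eq fun n => by simpa using one_le_cast_of_bin (hb n), cfv]
      simp

/-- Words of `𝓖` starting with `11` or `2222` and ending with `2222`. -/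
def blockWords (𝓖 : Set (List ℕ)) : Set (List ℕ) :=
  {w | w = [] ∨ (IsBin w ∧ ([1, 1] <+: w ∨ [2, 2, 2, 2] <+: w) ∧ [2, 2, 2, 2] <:+ w ∧ w ∈ 𝓖)}

theorem isWordMonoid_blockWords {𝓖 : Set (List ℕ)} (h1 : [2, 2, 2, 2] ∈ 𝓖)
    (h2 : [1, 1, 2, 2, 2, 2] ∈ 𝓖)
    (h : ∀ u ∈ 𝓖, ∀ v ∈ 𝓖, [2, 2, 2, 2] <:+ u → [1, 1] <+: v ∨ [2, 2, 2, 2] <+: v → u ++ v ∈ 𝓖) :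
    IsWordMonoid (blockWords 𝓖) where
  bin := by
    rintro w (rfl | hw)
    · simp
    · exact hw.1
  nil := Or.inl rfl
  append := by
    rintro u (rfl | hu) v (rfl | hv)
    · exact Or.inl rfl
    · exact Or.inr hv
    · rw [List.append_nil]; exact Or.inr hu
    · exact Or.inr ⟨isBin_append.2 ⟨hu.1, hv.1⟩,
        hu.2.1.imp (fun h => h.trans (List.prefix_append _ _))
          (fun h => h.trans (List.prefix_append _ _)),
        hv.2.2.1.trans (List.suffix_append _ _),
        h u hu.2.2.2 v hv.2.2.2 hu.2.2.1 hv.2.1⟩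
  mem_2222 := Or.inr ⟨by simp [IsBin], Or.inr List.prefix_rfl, List.suffix_rfl, h1⟩
  mem_112222 := Or.inr ⟨by simp [IsBin], Or.inl ⟨[2, 2, 2, 2], rfl⟩, ⟨[1, 1], rfl⟩, h2⟩

/-- A word starting with `1` and without factor `e`, where `e` consists of `2`s, cannot straddle the
end of a word ending with `e`. -/
theorem straddle_eq_nil {e v p q u : List ℕ} (he : ∀ b ∈ e, b = 2) (hv : ¬ e <:+: v)
    (hv1 : v.head? = some 1) (hpq : v = p ++ q) (hu : e <:+ u) (hp : p <:+ u) : p = [] := by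
  rcases List.suffix_or_suffix_of_suffix hu hp with h | h
  · exact absurd (h.isInfix.trans (by rw [hpq]; exact (List.prefix_append _ _).isInfix)) hv
  · by_contra hne
    obtain ⟨b, p', rfl⟩ := List.exists_cons_of_ne_nil hne
    have h2 : b = 2 := he b (h.subset (by simp))
    rw [hpq] at hv1
    simp at hv1
    omega

theorem avoiding_append {e v u w : List ℕ} (he : ∀ b ∈ e, b = 2) (hv : ¬ e <:+: v)
    (hv1 : v.head? = some 1) (hu : u ∈ avoiding v) (hw : w ∈ avoiding v)
    (hu2 : e <:+ u) : u ++ w ∈ avoiding v := by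
  intro h
  rw [List.infix_append_iff] at h
  rcases h with h | h | ⟨p, q, hpq, hp, hq⟩
  · exact hu h
  · exact hw h
  · have := straddle_eq_nil he hv hv1 hpq hu2 hp
    rw [hpq, this, List.nil_append] at hw
    exact hw hq.isInfix

theorem reverse_mem_avoiding {v w : List ℕ} : w.reverse ∈ avoiding v.reverse ↔ w ∈ avoiding v := by
  simp [avoiding, List.reverse_infix]

theorem good_append_of_suffix {u w : List ℕ} (hu : u ∈ goodWords) (hw : w ∈ goodWords)
    (h : [2, 2] <:+ u) : u ++ w ∈ goodWords :=
  avoiding_append (e := [2, 2]) (by simp) (by decide) rfl hu hw h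

theorem reverse_mem_good {w : List ℕ} : w.reverse ∈ goodWords ↔ w ∈ goodWords :=
  reverse_mem_avoiding (v := [1, 2, 1])

theorem good_append_of_two_two {u w : List ℕ} (hu : u ∈ goodWords) (hw : w ∈ goodWords)
    (h : [2, 2] <+: w) : u ++ w ∈ goodWords := by
  rw [← reverse_mem_good, List.reverse_append]
  exact good_append_of_suffix (reverse_mem_good.2 hw) (reverse_mem_good.2 hu)
    (List.reverse_suffix.2 h : [2, 2].reverse <:+ _)

end goodWords

section criticalExponent

variable {𝓛 : Set (List ℕ)} {σ : ℝ}

theorem levelSum_zero (h : [] ∈ 𝓛) : levelSum 𝓛 σ 0 = 1 := by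
  have : levelWords 𝓛 0 = {[]} := by
    ext w
    rw [mem_levelWords, Finset.mem_singleton, List.length_eq_zero_iff]
    exact ⟨fun h => h.2.2, fun e => by subst e; exact ⟨h, by simp, rfl⟩⟩
  simp [levelSum, this, cfq]

theorem continuous_weight {S : Finset (List ℕ)} {f : List ℕ → ℝ} (hf : ∀ w ∈ S, 0 < f w) :
    Continuous fun σ : ℝ => ∑ w ∈ S, f w ^ (-σ) :=
  continuous_finsetSum _ fun w hw =>
    Continuous.rpow continuous_const continuous_neg fun _ => Or.inl (hf w hw).ne'

theorem continuous_levelSum (n : ℕ) : Continuous fun σ => levelSum 𝓛 σ n :=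
  continuous_weight fun _ hw => cfq_pos (mem_levelWords.1 hw).2.1

/-- The words `g₀ w g₁` with `w ∈ 𝓛` of length `n`. -/
noncomputable def markedWords (𝓛 : Set (List ℕ)) (g₀ g₁ : List ℕ) (n : ℕ) : Finset (List ℕ) :=
  (levelWords 𝓛 n).image fun w => g₀ ++ w ++ g₁

theorem mem_markedWords {g₀ g₁ u : List ℕ} {n : ℕ} :
    u ∈ markedWords 𝓛 g₀ g₁ n ↔ ∃ w ∈ 𝓛, IsBin w ∧ w.length = n ∧ u = g₀ ++ w ++ g₁ := by
  simp only [markedWords, Finset.mem_image, mem_levelWords]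
  exact ⟨fun ⟨w, ⟨h1, h2, h3⟩, h⟩ => ⟨w, h1, h2, h3, h.symm⟩,
    fun ⟨w, h1, h2, h3, h⟩ => ⟨w, ⟨h1, h2, h3⟩, h.symm⟩⟩

theorem le_weight_markedWords {g₀ g₁ : List ℕ} (h₀ : IsBin g₀) (h₁ : IsBin g₁) (hσ : 0 ≤ σ) (n : ℕ) :
    (8 * cfq g₀ * cfq g₁) ^ (-σ) * levelSum 𝓛 σ n ≤
      ∑ u ∈ markedWords 𝓛 g₀ g₁ n, (2 * cfq u) ^ (-σ) := by
  rw [markedWords, Finset.sum_image, levelSum, Finset.mul_sum]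
  · refine Finset.sum_le_sum fun w hw => ?_
    have hb := (mem_levelWords.1 hw).2.1
    have p0 := cfq_pos h₀
    have p1 := cfq_pos h₁
    have pw := cfq_pos hb
    have h0w := isBin_append.2 ⟨h₀, hb⟩
    rw [← Real.mul_rpow (by positivity) pw.le]
    refine Real.rpow_le_rpow_of_nonpos (by linarith [cfq_pos (isBin_append.2 ⟨h0w, h₁⟩)]) ?_
      (by linarith)
    have h1 := cfq_append_le h₀ hb
    have h2 := cfq_append_le h0w h₁
    nlinarith [mul_le_mul_of_nonneg_right h1 p1.le]
  · intro u _ v _ h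
    simpa using h

/-- If `𝓛` has at least exponent `σ`, then the marked words have a larger exponent. -/
theorem exists_larger_exponent {g₀ g₁ : List ℕ} (h₀ : IsBin g₀) (h₁ : IsBin g₁) (hσ : 0 ≤ σ)
    (hσ1 : σ < 1) (h : ∀ n, 1 ≤ levelSum 𝓛 σ n) :
    ∃ σ', σ < σ' ∧ σ' < 1 ∧ ∃ N,
      1 < ∑ u ∈ (Finset.range N).biUnion (markedWords 𝓛 g₀ g₁), (2 * cfq u) ^ (-σ') := by
  have p0 := cfq_pos h₀
  have p1 := cfq_pos h₁
  set c := (8 * cfq g₀ * cfq g₁) ^ (-σ) with hc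
  have hc0 : 0 < c := Real.rpow_pos_of_pos (by positivity) _
  obtain ⟨N, hN⟩ := exists_nat_gt (1 / c)
  rw [div_lt_iff₀ hc0] at hN
  set S := (Finset.range N).biUnion (markedWords 𝓛 g₀ g₁) with hS
  have hSb : ∀ u ∈ S, 0 < 2 * cfq u := by
    intro u hu
    obtain ⟨n, -, hn⟩ := Finset.mem_biUnion.1 hu
    obtain ⟨w, -, hw, -, rfl⟩ := mem_markedWords.1 hn
    linarith [cfq_pos (isBin_append.2 ⟨isBin_append.2 ⟨h₀, hw⟩, h₁⟩)]
  have h1 : 1 < ∑ u ∈ S, (2 * cfq u) ^ (-σ) := by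
    rw [hS, Finset.sum_biUnion]
    · refine hN.trans_le ?_
      rw [← nsmul_eq_mul]
      conv_lhs => rw [← Finset.card_range N, ← Finset.sum_const]
      refine Finset.sum_le_sum fun n _ => ?_
      refine le_trans ?_ (le_weight_markedWords h₀ h₁ hσ n)
      nlinarith [h n]
    · intro i _ j _ hij
      refine Finset.disjoint_left.2 fun u hu hv => hij ?_
      obtain ⟨w, -, -, hl, rfl⟩ := mem_markedWords.1 hu
      obtain ⟨w', -, -, hl', h⟩ := mem_markedWords.1 hv
      have := congrArg List.length h
      simp at this
      omega
  have hev := ((continuous_weight hSb).tendsto σ).eventually (lt_mem_nhds h1)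
  obtain ⟨ε, hε, hball⟩ := Metric.eventually_nhds_iff.1 hev
  refine ⟨σ + min (ε / 2) ((1 - σ) / 2), ?_, ?_, N, hball ?_⟩
  · have : 0 < min (ε / 2) ((1 - σ) / 2) := lt_min (by linarith) (by linarith)
    linarith
  · linarith [min_le_right (ε / 2) ((1 - σ) / 2)]
  · have h3 : 0 < min (ε / 2) ((1 - σ) / 2) := lt_min (by linarith) (by linarith)
    rw [Real.dist_eq, add_sub_cancel_left, abs_of_pos h3]
    linarith [min_le_left (ε / 2) ((1 - σ) / 2)]

/-- Below the exponent of `𝓛`, the marked words of a fixed large length have large weight. -/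
theorem exists_level_weight {g₀ g₁ : List ℕ} (h₀ : IsBin g₀) (h₁ : IsBin g₁) {σ' : ℝ} (hσ' : 0 ≤ σ')
    (hσ : σ' < σ) (h : ∀ n, 1 ≤ levelSum 𝓛 σ n) :
    ∃ n, 1 < ∑ u ∈ markedWords 𝓛 g₀ g₁ n, (2 * cfq u) ^ (-σ') := by
  have p0 := cfq_pos h₀
  have p1 := cfq_pos h₁
  set c := (8 * cfq g₀ * cfq g₁) ^ (-σ') with hc
  have hc0 : 0 < c := Real.rpow_pos_of_pos (by positivity) _
  obtain ⟨n, hn⟩ := pow_unbounded_of_one_lt (1 / c)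
    (Real.one_lt_rpow one_lt_two (sub_pos.2 hσ) : (1 : ℝ) < 2 ^ (σ - σ'))
  rw [div_lt_iff₀ hc0] at hn
  refine ⟨2 * n, lt_of_lt_of_le ?_ (le_weight_markedWords h₀ h₁ hσ' (2 * n))⟩
  have h2 : ((2 : ℝ) ^ (σ - σ')) ^ n * levelSum 𝓛 σ (2 * n) ≤ levelSum 𝓛 σ' (2 * n) := by
    rw [levelSum, levelSum, Finset.mul_sum]
    refine Finset.sum_le_sum fun w hw => ?_
    obtain ⟨-, hb, hl⟩ := mem_levelWords.1 hw
    have hq := two_pow_le_cfq (n := n) hb hl.ge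
    have pw := cfq_pos hb
    have e : cfq w ^ (-σ') = cfq w ^ (σ - σ') * cfq w ^ (-σ) := by
      rw [← Real.rpow_add pw]; ring_nf
    rw [e, ← Real.rpow_natCast, ← Real.rpow_mul (by norm_num), mul_comm (σ - σ'),
      Real.rpow_mul (by norm_num), Real.rpow_natCast]
    gcongr
  have h3 : 0 < ((2 : ℝ) ^ (σ - σ')) ^ n := by positivity
  have h4 : ((2 : ℝ) ^ (σ - σ')) ^ n ≤ levelSum 𝓛 σ' (2 * n) :=
    le_trans (le_mul_of_one_le_right h3.le (h _)) h2
  calc 1 < _ := hn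
    _ = c * ((2 : ℝ) ^ (σ - σ')) ^ n := mul_comm _ _
    _ ≤ _ := by gcongr

theorem prefix_markedWords {g₀ g₁ : List ℕ} {n : ℕ} :
    ∀ u ∈ markedWords 𝓛 g₀ g₁ n, ∀ v ∈ markedWords 𝓛 g₀ g₁ n, u <+: v → u = v := by
  intro u hu v hv h
  obtain ⟨w, -, -, hl, rfl⟩ := mem_markedWords.1 hu
  obtain ⟨w', -, -, hl', rfl⟩ := mem_markedWords.1 hv
  exact h.eq_of_length (by simp [hl, hl'])

theorem isWordMonoid_goodBlocks : IsWordMonoid (blockWords goodWords) :=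
  isWordMonoid_blockWords (by unfold goodWords avoiding; decide)
    (by unfold goodWords avoiding; decide)
    fun _ hu _ hv h _ => avoiding_append (e := [2, 2, 2, 2]) (by simp) (by decide) rfl hu hv h

theorem good_marked {w : List ℕ} (hw : w ∈ goodWords) :
    [1, 1, 2, 2] ++ w ++ [2, 2, 2, 2] ∈ goodWords :=
  good_append_of_two_two (good_append_of_suffix (by unfold goodWords avoiding; decide) hw
    ⟨[1, 1], rfl⟩) (by unfold goodWords avoiding; decide) ⟨[2, 2], rfl⟩

theorem marked_mem_blockWords {𝓖 : Set (List ℕ)} {w : List ℕ} (hw : IsBin w)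
    (h : [1, 1, 2, 2] ++ w ++ [2, 2, 2, 2] ∈ 𝓖) :
    [1, 1, 2, 2] ++ w ++ [2, 2, 2, 2] ∈ blockWords 𝓖 :=
  Or.inr ⟨isBin_append.2 ⟨isBin_append.2 ⟨by simp [IsBin], hw⟩, by simp [IsBin]⟩,
    Or.inl ⟨[2, 2] ++ w ++ [2, 2, 2, 2], by simp⟩, ⟨_, rfl⟩, h⟩

theorem dimH_K2_le {N : ℕ} (hσ : 0 ≤ σ) (hN : 0 < N) (h : levelSum goodWords σ N < 1) :
    dimH K2 ≤ ENNReal.ofReal (σ / 2) := by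
  rw [K2_eq]
  exact dimH_cfv_le (factorClosed_avoiding _) hσ hN h

theorem seqTake_mem_of_omegaSeqs {𝓖 : Set (List ℕ)} (h𝓖 : FactorClosed 𝓖) (hnil : [] ∈ 𝓖)
    {a : ℕ → ℕ} (ha : a ∈ omegaSeqs (blockWords 𝓖)) (n : ℕ) : seqTake a n ∈ 𝓖 := by
  obtain ⟨m, hm, h⟩ := ha n
  have hg : seqTake a m ∈ 𝓖 := by
    rcases h with h | h
    · rwa [h]
    · exact h.2.2.2
  refine h𝓖 _ hg _ ?_
  obtain ⟨k, rfl⟩ := Nat.exists_eq_add_of_le hm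
  rw [seqTake_add]
  exact (List.prefix_append _ _).isInfix

theorem omegaGood_subset_K2 : {x | ∃ a ∈ omegaSeqs (blockWords goodWords), x = cfv a} ⊆ K2 := by
  rw [K2_eq]
  rintro _ ⟨a, ha, rfl⟩
  exact ⟨a, binSeq_of_mem_omegaSeqs isWordMonoid_goodBlocks.bin ha,
    seqTake_mem_of_omegaSeqs (factorClosed_avoiding _) (by unfold avoiding; decide) ha, rfl⟩

theorem le_dimH_K2 {σ' : ℝ} (hσ' : 0 ≤ σ') (hσ1 : σ' < 1) (hσ : σ' < σ)
    (h : ∀ n, 1 ≤ levelSum goodWords σ n) : ENNReal.ofReal (σ' / 2) ≤ dimH K2 := by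
  obtain ⟨n, hn⟩ := exists_level_weight (g₀ := [1, 1, 2, 2]) (g₁ := [2, 2, 2, 2])
    (by simp [IsBin]) (by simp [IsBin]) hσ' hσ h
  refine (le_dimH_cfv_of_code isWordMonoid_goodBlocks (fun u hu => ?_) prefix_markedWords hσ' hσ1
    hn).trans (dimH_mono omegaGood_subset_K2)
  obtain ⟨w, hw, hb, -, rfl⟩ := mem_markedWords.1 hu
  exact marked_mem_blockWords hb (good_marked hw)

theorem levelSum_good_five : levelSum goodWords 1 5 < 1 := by
  have : levelWords goodWords 5 = (binWords 5).filter (fun w => ¬ [1, 2, 1] <:+: w) := by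
    ext w
    rw [mem_levelWords, Finset.mem_filter, mem_binWords, and_comm]
    rfl
  have h2 : (binWords 5).filter (fun w => ¬ [1, 2, 1] <:+: w) =
      {[1,1,1,1,1], [1,1,1,1,2], [1,1,1,2,2], [1,1,2,2,1], [1,1,2,2,2], [1,2,2,1,1], [1,2,2,1,2],
       [1,2,2,2,1], [1,2,2,2,2], [2,1,1,1,1], [2,1,1,1,2], [2,1,1,2,2], [2,1,2,2,1], [2,1,2,2,2],
       [2,2,1,1,1], [2,2,1,1,2], [2,2,1,2,2], [2,2,2,1,1], [2,2,2,1,2], [2,2,2,2,1],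
       [2,2,2,2,2]} := by decide
  rw [levelSum, this, h2]
  simp only [Real.rpow_neg_one]
  repeat rw [Finset.sum_insert (by decide)]
  rw [Finset.sum_singleton]
  simp only [cfq, cfDen_cons, cfDen_nil, cfMap_cons, cfMap_nil]
  norm_num

/-- The critical exponent `2 dim K₂`. -/
noncomputable def critExp : ℝ := 2 * (dimH K2).toReal

theorem dimH_K2_le_half : dimH K2 ≤ ENNReal.ofReal (1 / 2) :=
  dimH_K2_le zero_le_one (by norm_num) levelSum_good_five

theorem ofReal_critExp_half : ENNReal.ofReal (critExp / 2) = dimH K2 := by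
  rw [critExp, mul_div_cancel_left₀ _ two_ne_zero]
  exact ENNReal.ofReal_toReal (ne_top_of_le_ne_top ENNReal.ofReal_ne_top dimH_K2_le_half)

theorem critExp_nonneg : 0 ≤ critExp := by unfold critExp; positivity

theorem ofReal_critExp : ENNReal.ofReal critExp = 2 * dimH K2 := by
  rw [← ofReal_critExp_half, ← ENNReal.ofReal_ofNat, ← ENNReal.ofReal_mul (by norm_num)]
  congr 1; ring

theorem exists_lt_levelSum_lt_one {n : ℕ} {σ : ℝ} (h : levelSum 𝓛 σ n < 1) :
    ∃ σ' < σ, levelSum 𝓛 σ' n < 1 := by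
  have hev := ((continuous_levelSum (𝓛 := 𝓛) n).tendsto σ).eventually (gt_mem_nhds h)
  obtain ⟨ε, hε, hball⟩ := Metric.eventually_nhds_iff.1 hev
  refine ⟨σ - ε / 2, by linarith, hball ?_⟩
  rw [Real.dist_eq, abs_of_neg (by linarith)]
  linarith

theorem levelSum_good_pos (σ : ℝ) (n : ℕ) : 0 < levelSum goodWords σ n := by
  have h1 : List.replicate n 2 ∈ levelWords goodWords n := by
    refine mem_levelWords.2 ⟨fun h => ?_, fun d hd => Or.inr (List.eq_of_mem_replicate hd), by simp⟩
    have := List.eq_of_mem_replicate (h.subset (by simp : 1 ∈ [1, 2, 1]))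
    omega
  refine Finset.sum_pos (fun w hw => ?_) ⟨_, h1⟩
  exact Real.rpow_pos_of_pos (cfq_pos (mem_levelWords.1 hw).2.1) _

theorem critExp_le {n : ℕ} {σ : ℝ} (hσ : 0 ≤ σ) (hn : 0 < n) (h : levelSum goodWords σ n < 1) :
    critExp ≤ σ := by
  have h1 := dimH_K2_le hσ hn h
  rw [← ofReal_critExp_half, ENNReal.ofReal_le_ofReal_iff (by linarith)] at h1
  linarith

/-- If the partition function at `σ` is smaller than one, then `σ` exceeds the critical exponent. -/
theorem critExp_lt {n : ℕ} {σ : ℝ} (hσ : 0 < σ) (hn : 0 < n) (h : levelSum goodWords σ n < 1) :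
    critExp < σ := by
  obtain ⟨σ', hlt, h'⟩ := exists_lt_levelSum_lt_one h
  rcases le_total 0 σ' with h0 | h0
  · exact (critExp_le h0 hn h').trans_lt hlt
  · refine (critExp_le le_rfl hn (lt_of_le_of_lt ?_ h')).trans_lt hσ
    refine Finset.sum_le_sum fun w hw => ?_
    exact Real.rpow_le_rpow_of_exponent_le (one_le_cfq (mem_levelWords.1 hw).2.1) (by linarith)

theorem critExp_lt_one : critExp < 1 := critExp_lt one_pos (by norm_num) levelSum_good_five

theorem one_le_card_levelWords (n : ℕ) : 1 ≤ levelSum goodWords 0 n := by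
  have h := levelSum_good_pos 0 n
  simp only [levelSum, neg_zero, Real.rpow_zero, Finset.sum_const, nsmul_eq_mul, mul_one] at h ⊢
  exact_mod_cast h

theorem one_le_levelSum_critExp (n : ℕ) : 1 ≤ levelSum goodWords critExp n := by
  by_contra! h
  rcases Nat.eq_zero_or_pos n with rfl | hn
  · rw [levelSum_zero (by unfold goodWords avoiding; decide)] at h
    exact lt_irrefl _ h
  · rcases critExp_nonneg.eq_or_lt with h0 | h0
    · rw [← h0] at h
      exact h.not_ge (one_le_card_levelWords n)
    · exact lt_irrefl _ (critExp_lt h0 hn h)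

theorem exists_levelSum_lt_one {σ : ℝ} (h : critExp < σ) :
    ∃ n, 0 < n ∧ levelSum goodWords σ n < 1 := by
  by_contra! hcon
  have hall : ∀ n, 1 ≤ levelSum goodWords σ n := fun n => by
    rcases Nat.eq_zero_or_pos n with rfl | hn
    · rw [levelSum_zero (by unfold goodWords avoiding; decide)]
    · exact hcon n hn
  have hm : critExp < min σ 1 := lt_min h critExp_lt_one
  obtain ⟨σ', h1, h2⟩ := exists_between hm
  have hσ' : 0 ≤ σ' := critExp_nonneg.trans h1.le
  have h3 := le_dimH_K2 hσ' (h2.trans_le (min_le_right _ _)) (h2.trans_le (min_le_left _ _)) hall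
  rw [← ofReal_critExp_half,
    ENNReal.ofReal_le_ofReal_iff (by linarith [critExp_nonneg])] at h3
  linarith

end criticalExponent

section glue

variable {𝓜 : Set (List ℕ)} {α β : ℤ → ℕ}

/-- The terms of `α` read forwards from position `k`. -/
def fwd (α : ℤ → ℕ) (k : ℤ) : ℕ → ℕ := fun n => α (k + n)

/-- The terms of `α` read backwards from position `k`. -/
def bwd (α : ℤ → ℕ) (k : ℤ) : ℕ → ℕ := fun n => α (k - n)

/-- A bi-infinite sequence in `1, 2`. -/
def BinBi (α : ℤ → ℕ) : Prop := ∀ k, α k = 1 ∨ α k = 2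

theorem BinBi.pos (h : BinBi α) (k : ℤ) : 0 < α k := by rcases h k with h | h <;> omega
theorem BinBi.fwd (h : BinBi α) (k : ℤ) : BinSeq (fwd α k) := fun n => h (k + n)
theorem BinBi.bwd (h : BinBi α) (k : ℤ) : BinSeq (bwd α k) := fun n => h (k - n)

theorem BinBi.lambdaVal_eq (h : BinBi α) (k : ℤ) :
    lambdaVal α k = α k + cfv (_root_.fwd α (k + 1)) + cfv (_root_.bwd α (k - 1)) :=
  _root_.lambdaVal_eq h.pos k

theorem BinBi.lambdaVal_lt (h : BinBi α) (k : ℤ) : lambdaVal α k < 4 := by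
  have h1 := cfv_lt_one (h.fwd (k + 1)).posSeq
  have h2 := cfv_lt_one (h.bwd (k - 1)).posSeq
  have h3 := cast_le_two_of_bin (h k)
  rw [h.lambdaVal_eq]
  linarith

theorem BinBi.bddAbove (h : BinBi α) : BddAbove (range (lambdaVal α)) :=
  ⟨4, by rintro _ ⟨k, rfl⟩; exact (h.lambdaVal_lt k).le⟩

theorem BinBi.markovValue_mem (h : BinBi α) : markovValue α ∈ markovSpectrum :=
  ⟨α, h.pos, h.bddAbove, rfl⟩

theorem BinBi.le_markovValue (h : BinBi α) (k : ℤ) : lambdaVal α k ≤ markovValue α :=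
  le_ciSup h.bddAbove k

/-- Sequences agreeing near `j` have close values at `j`. -/
theorem exists_window (hα : BinBi α) (j : ℤ) {ε : ℝ} (hε : 0 < ε) :
    ∃ N : ℕ, ∀ β, BinBi β → (∀ k : ℤ, -N ≤ k → k ≤ N → β k = α k) →
      |lambdaVal β j - lambdaVal α j| < ε := by
  obtain ⟨n, hn⟩ := exists_pow_lt_of_lt_one (half_pos hε) (by norm_num : (1 / 2 : ℝ) < 1)
  refine ⟨2 * n + j.natAbs + 1, fun β hβ h => ?_⟩
  have key : ∀ {a b : ℕ → ℕ}, BinSeq a → BinSeq b → (∀ i < 2 * n, a i = b i) →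
      |cfv a - cfv b| < ε / 2 := by
    intro a b ha hb hab
    have h1 : seqTake a (2 * n) = seqTake b (2 * n) :=
      List.map_congr_left fun i hi => hab i (List.mem_range.1 hi)
    refine (abs_cfv_sub_le ha hb h1).trans_lt (lt_of_le_of_lt ?_ hn)
    have h2 : (2 : ℝ) ^ n ≤ cfq (seqTake a (2 * n)) :=
      two_pow_le_cfq (ha.isBin_take _) (by simp)
    have h3 : (1 : ℝ) ≤ 2 ^ n := one_le_pow₀ (by norm_num)
    rw [div_pow, one_pow]
    exact one_div_le_one_div_of_le (by positivity) (by nlinarith)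
  have h0 : β j = α j := h j (by omega) (by omega)
  have h1 := key (hβ.fwd (j + 1)) (hα.fwd (j + 1)) fun i hi => h _ (by omega) (by omega)
  have h2 := key (hβ.bwd (j - 1)) (hα.bwd (j - 1)) fun i hi => h _ (by omega) (by omega)
  rw [hβ.lambdaVal_eq, hα.lambdaVal_eq, h0]
  rw [abs_lt] at *
  constructor <;> linarith

/-- The bi-infinite sequence reading `P`, then `a`, from position `0` on to the right, and `Q`, then
`b`, from position `-1` on to the left. -/
def glue (P Q : List ℕ) (a b : ℕ → ℕ) : ℤ → ℕ
  | Int.ofNat n => seqApp P a n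
  | Int.negSucc n => seqApp Q b n

theorem glue_natCast (P Q : List ℕ) (a b : ℕ → ℕ) (n : ℕ) : glue P Q a b n = seqApp P a n := rfl

theorem glue_neg (P Q : List ℕ) (a b : ℕ → ℕ) (n : ℕ) :
    glue P Q a b (-1 - n) = seqApp Q b n := by
  rw [show (-1 - n : ℤ) = Int.negSucc n by omega]; rfl

theorem fwd_glue (P Q : List ℕ) (a b : ℕ → ℕ) (j : ℕ) :
    fwd (glue P Q a b) j = shift (seqApp P a) j := by
  funext n
  rw [fwd, ← Nat.cast_add, glue_natCast, shift_apply]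

theorem bwd_glue (P Q : List ℕ) (a b : ℕ → ℕ) (j : ℕ) :
    bwd (glue P Q a b) (-1 - j) = shift (seqApp Q b) j := by
  funext n
  rw [bwd, show (-1 - j - n : ℤ) = -1 - (j + n : ℕ) by push_cast; ring, glue_neg, shift_apply]

theorem bwd_glue_zero (P Q : List ℕ) (a b : ℕ → ℕ) :
    bwd (glue P Q a b) (-1) = seqApp Q b := by
  simpa using bwd_glue P Q a b 0

theorem glue_append (P Q u v : List ℕ) (a b : ℕ → ℕ) :
    glue (P ++ u) (Q ++ v) a b = glue P Q (seqApp u a) (seqApp v b) := by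
  funext k
  cases k <;> simp only [glue, seqApp_append]

theorem glue_shift (P P' Q : List ℕ) (a b : ℕ → ℕ) (k : ℤ) :
    glue (P ++ P') Q a b (P.length + k) = glue P' (P.reverse ++ Q) a b k := by
  rcases k with n | n
  · rw [Int.ofNat_eq_natCast, ← Nat.cast_add, glue_natCast, glue_natCast, seqApp_append,
      seqApp_add]
  · rw [show Int.negSucc n = -1 - (n : ℤ) by omega, glue_neg, seqApp_append]
    by_cases h : n < P.length
    · rw [seqApp_of_lt _ (by simpa using h),
        show (P.length + (-1 - n) : ℤ) = ((P.length - 1 - n : ℕ) : ℤ) by omega, glue_natCast,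
        seqApp_append, seqApp_of_lt _ (by omega), List.getElem_reverse]
    · obtain ⟨m, rfl⟩ := Nat.exists_eq_add_of_le (not_lt.1 h)
      rw [show (P.length + (-1 - ((P.length + m : ℕ) : ℤ)) : ℤ) = -1 - (m : ℤ) by push_cast; ring,
        glue_neg, ← P.length_reverse, seqApp_add]

theorem binBi_glue {P Q : List ℕ} (hP : IsBin P) (hQ : IsBin Q) {a b : ℕ → ℕ} (ha : BinSeq a)
    (hb : BinSeq b) : BinBi (glue P Q a b) := by
  intro k
  cases k with
  | ofNat n => exact binSeq_append hP ha n
  | negSucc n => exact binSeq_append hQ hb n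

theorem lambdaVal_shift (h : BinBi α) (hβ : BinBi β) {m : ℤ} (e : ∀ k, α (m + k) = β k) (k : ℤ) :
    lambdaVal α (m + k) = lambdaVal β k := by
  have h1 : fwd α (m + k + 1) = fwd β (k + 1) := by
    funext n
    simp only [fwd, ← e]; congr 1; ring
  have h2 : bwd α (m + k - 1) = bwd β (k - 1) := by
    funext n
    simp only [bwd, ← e]; congr 1; ring
  rw [h.lambdaVal_eq, hβ.lambdaVal_eq, e, h1, h2]

theorem lambdaVal_reflect (h : BinBi α) (hβ : BinBi β) (e : ∀ k, α (-1 - k) = β k) (k : ℤ) :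
    lambdaVal α (-1 - k) = lambdaVal β k := by
  have h1 : fwd α (-1 - k + 1) = bwd β (k - 1) := by
    funext n
    simp only [fwd, bwd, ← e]; congr 1; ring
  have h2 : bwd α (-1 - k - 1) = fwd β (k + 1) := by
    funext n
    simp only [fwd, bwd, ← e]; congr 1; ring
  rw [h.lambdaVal_eq, hβ.lambdaVal_eq, e, h1, h2]
  ring

theorem glue_reflect (P Q : List ℕ) (a b : ℕ → ℕ) (k : ℤ) :
    glue P Q a b (-1 - k) = glue Q P b a k := by
  rcases k with n | n
  · rw [Int.ofNat_eq_natCast, glue_neg, glue_natCast]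
  · rw [show Int.negSucc n = -1 - (n : ℤ) by omega, glue_neg,
      show (-1 - (-1 - (n : ℤ))) = n by ring, glue_natCast]

theorem lambdaVal_glue_zero {d : ℕ} {P Q : List ℕ} (hP : IsBin (d :: P)) (hQ : IsBin Q)
    {a b : ℕ → ℕ} (ha : BinSeq a) (hb : BinSeq b) :
    lambdaVal (glue (d :: P) Q a b) 0 = d + cfMap P (cfv a) + cfMap Q (cfv b) := by
  rw [(binBi_glue hP hQ ha hb).lambdaVal_eq]
  have h1 : fwd (glue (d :: P) Q a b) (0 + 1) = seqApp P a := by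
    have := fwd_glue (d :: P) Q a b 1
    rw [show d :: P = [d] ++ P from rfl, seqApp_append, show 1 = [d].length from rfl,
      shift_seqApp] at this
    simpa using this
  rw [h1, zero_sub, bwd_glue_zero, cfv_append (isBin_cons.1 hP).2 ha.posSeq,
    cfv_append hQ hb.posSeq]
  congr 2

theorem seqApp_mem_omegaSeqs (h𝓜 : IsWordMonoid 𝓜) {u : List ℕ} (hu : u ∈ 𝓜) {a : ℕ → ℕ}
    (ha : a ∈ omegaSeqs 𝓜) : seqApp u a ∈ omegaSeqs 𝓜 := by
  intro n
  obtain ⟨m, hm, h⟩ := ha n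
  refine ⟨u.length + m, by omega, ?_⟩
  rw [seqTake_add, seqTake_seqApp, shift_seqApp]
  exact h𝓜.append _ hu _ h

theorem exists_dominant (h𝓜 : IsWordMonoid 𝓜) {P Q : List ℕ} (hP : IsBin P) (hQ : IsBin Q)
    {J : Finset ℤ} (hJ : J.Nonempty) :
    ∃ j ∈ J, ∃ u ∈ 𝓜, ∃ v ∈ 𝓜, ∀ a ∈ omegaSeqs 𝓜, ∀ b ∈ omegaSeqs 𝓜, ∀ i ∈ J,
      lambdaVal (glue (P ++ u) (Q ++ v) a b) i ≤ lambdaVal (glue (P ++ u) (Q ++ v) a b) j := by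
  induction hJ using Finset.Nonempty.cons_induction with
  | singleton j =>
    refine ⟨j, by simp, [], h𝓜.nil, [], h𝓜.nil, fun a _ b _ i hi => ?_⟩
    rw [Finset.mem_singleton.1 hi]
  | cons j₀ J hj₀ hJ ih =>
    obtain ⟨j, hj, u, hu, v, hv, hle⟩ := ih
    by_cases hcase : ∀ a ∈ omegaSeqs 𝓜, ∀ b ∈ omegaSeqs 𝓜,
        lambdaVal (glue (P ++ u) (Q ++ v) a b) j₀ ≤ lambdaVal (glue (P ++ u) (Q ++ v) a b) j
    · refine ⟨j, by simp [hj], u, hu, v, hv, fun a ha b hb i hi => ?_⟩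
      rcases Finset.mem_cons.1 hi with rfl | hi
      · exact hcase a ha b hb
      · exact hle a ha b hb i hi
    · push Not at hcase
      obtain ⟨a, ha, b, hb, hlt⟩ := hcase
      have hPu := isBin_append.2 ⟨hP, h𝓜.bin u hu⟩
      have hQv := isBin_append.2 ⟨hQ, h𝓜.bin v hv⟩
      have hbin : ∀ {a b}, a ∈ omegaSeqs 𝓜 → b ∈ omegaSeqs 𝓜 → BinBi (glue (P ++ u) (Q ++ v) a b) :=
        fun ha hb => binBi_glue hPu hQv (binSeq_of_mem_omegaSeqs h𝓜.bin ha)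
          (binSeq_of_mem_omegaSeqs h𝓜.bin hb)
      have hε := half_pos (sub_pos.2 hlt)
      obtain ⟨N₁, hN₁⟩ := exists_window (hbin ha hb) j hε
      obtain ⟨N₂, hN₂⟩ := exists_window (hbin ha hb) j₀ hε
      obtain ⟨m, hm, hma⟩ := ha (N₁ + N₂ + 1)
      obtain ⟨m', hm', hmb⟩ := hb (N₁ + N₂ + 1)
      refine ⟨j₀, by simp, u ++ seqTake a m, h𝓜.append _ hu _ hma, v ++ seqTake b m',
        h𝓜.append _ hv _ hmb, fun a' ha' b' hb' => ?_⟩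
      rw [← List.append_assoc, ← List.append_assoc, glue_append _ _ (seqTake a m)]
      have hA := seqApp_mem_omegaSeqs h𝓜 hma ha'
      have hB := seqApp_mem_omegaSeqs h𝓜 hmb hb'
      have happ : ∀ (R : List ℕ) (c c' : ℕ → ℕ) (l i : ℕ), i < l →
          seqApp R (seqApp (seqTake c l) c') i = seqApp R c i := by
        intro R c c' l i hi
        by_cases h : i < R.length
        · rw [seqApp_of_lt _ h, seqApp_of_lt _ h]
        · obtain ⟨n, rfl⟩ := Nat.exists_eq_add_of_le (not_lt.1 h)
          rw [seqApp_add, seqApp_add, seqApp_of_lt _ (by simp; omega), getElem_seqTake]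
      have hagree : ∀ k : ℤ, -(m' : ℤ) ≤ k → k < m →
          glue (P ++ u) (Q ++ v) (seqApp (seqTake a m) a') (seqApp (seqTake b m') b') k =
            glue (P ++ u) (Q ++ v) a b k := by
        rintro (n | n) h1 h2
        · exact happ _ _ _ _ _ (by simpa using h2)
        · exact happ _ _ _ _ _ (by omega)
      have h1 := hN₁ _ (hbin hA hB) fun k h1 h2 => hagree k (by omega) (by omega)
      have h2 := hN₂ _ (hbin hA hB) fun k h1 h2 => hagree k (by omega) (by omega)
      rw [abs_lt] at h1 h2
      have h3 : lambdaVal (glue (P ++ u) (Q ++ v) (seqApp (seqTake a m) a')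
          (seqApp (seqTake b m') b')) j ≤ lambdaVal (glue (P ++ u) (Q ++ v)
          (seqApp (seqTake a m) a') (seqApp (seqTake b m') b')) j₀ := by
        linarith [h1.2, h2.1]
      intro i hi
      rcases Finset.mem_cons.1 hi with rfl | hi
      · exact le_rfl
      · exact (hle _ hA _ hB i hi).trans h3

/-- If the values of the sequences through a centre are bounded by those at finitely many
positions, then the Markov spectrum inherits the dimension of the sequences. -/
theorem le_dimFun_of_centre (h𝓜 : IsWordMonoid 𝓜) {𝓐 : Finset (List ℕ)} {σ t : ℝ}
    (h𝓐 : ∀ w ∈ 𝓐, w ∈ 𝓜) (hpf : ∀ u ∈ 𝓐, ∀ v ∈ 𝓐, u <+: v → u = v) (hσ : 0 ≤ σ) (hσ1 : σ < 1)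
    (hsum : 1 < ∑ w ∈ 𝓐, (2 * cfq w) ^ (-σ)) {P Q : List ℕ} (hP : IsBin P) (hQ : IsBin Q)
    {J : Finset ℤ} (hJ : J.Nonempty)
    (hlt : ∀ a ∈ omegaSeqs 𝓜, ∀ b ∈ omegaSeqs 𝓜, ∀ j ∈ J, lambdaVal (glue P Q a b) j < t)
    (hle : ∀ a ∈ omegaSeqs 𝓜, ∀ b ∈ omegaSeqs 𝓜, ∀ j, ∃ i ∈ J,
      lambdaVal (glue P Q a b) j ≤ lambdaVal (glue P Q a b) i) :
    ENNReal.ofReal σ ≤ dimFun t := by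
  obtain ⟨j, hj, u, hu, v, hv, hdom⟩ := exists_dominant h𝓜 hP hQ hJ
  set r := wrep [2, 2, 2, 2] (j.natAbs + 1) with hr
  have hr𝓜 : r ∈ 𝓜 := h𝓜.wrep h𝓜.mem_2222 _
  have hrl : r.length = 4 * (j.natAbs + 1) := by simp [hr, length_wrep, mul_comm]
  have hu' := h𝓜.append _ hu _ hr𝓜
  have hv' := h𝓜.append _ hv _ hr𝓜
  set P' := P ++ (u ++ r) with hP'
  set Q' := Q ++ (v ++ r) with hQ'
  have hP'b : IsBin P' := isBin_append.2 ⟨hP, h𝓜.bin _ hu'⟩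
  have hQ'b : IsBin Q' := isBin_append.2 ⟨hQ, h𝓜.bin _ hv'⟩
  have hbin : ∀ {a b}, a ∈ omegaSeqs 𝓜 → b ∈ omegaSeqs 𝓜 → BinBi (glue P' Q' a b) :=
    fun ha hb => binBi_glue hP'b hQ'b (binSeq_of_mem_omegaSeqs h𝓜.bin ha)
      (binSeq_of_mem_omegaSeqs h𝓜.bin hb)
  have hmem : ∀ a ∈ omegaSeqs 𝓜, ∀ b ∈ omegaSeqs 𝓜,
      lambdaVal (glue P' Q' a b) j ∈ markovSpectrum ∩ Iio t := by
    intro a ha b hb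
    have e1 : glue P' Q' a b = glue P Q (seqApp (u ++ r) a) (seqApp (v ++ r) b) := by
      rw [hP', hQ', glue_append]
    have e2 : glue P' Q' a b = glue (P ++ u) (Q ++ v) (seqApp r a) (seqApp r b) := by
      rw [hP', hQ', ← List.append_assoc, ← List.append_assoc, glue_append]
    have hmax : markovValue (glue P' Q' a b) = lambdaVal (glue P' Q' a b) j := by
      refine le_antisymm (ciSup_le fun k => ?_) ((hbin ha hb).le_markovValue j)
      obtain ⟨i, hi, h⟩ := hle _ (seqApp_mem_omegaSeqs h𝓜 hu' ha) _
        (seqApp_mem_omegaSeqs h𝓜 hv' hb) k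
      rw [← e1] at h
      refine h.trans ?_
      have := hdom _ (seqApp_mem_omegaSeqs h𝓜 hr𝓜 ha) _ (seqApp_mem_omegaSeqs h𝓜 hr𝓜 hb) i hi
      rwa [← e2] at this
    refine ⟨hmax ▸ (hbin ha hb).markovValue_mem, ?_⟩
    have := hlt _ (seqApp_mem_omegaSeqs h𝓜 hu' ha) _ (seqApp_mem_omegaSeqs h𝓜 hv' hb) j hj
    rwa [← e1] at this
  have hformula : ∃ (d : ℕ) (R S : List ℕ), IsBin R ∧ IsBin S ∧ ∀ a ∈ omegaSeqs 𝓜,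
      ∀ b ∈ omegaSeqs 𝓜, (d : ℝ) + (cfMap R (cfv a) + cfMap S (cfv b)) ∈
        markovSpectrum ∩ Iio t := by
    have key : ∀ {P Q : List ℕ} {n : ℕ}, IsBin P → IsBin Q → n < P.length →
        ∃ (d : ℕ) (R S : List ℕ), IsBin R ∧ IsBin S ∧ ∀ a b, BinSeq a → BinSeq b →
          lambdaVal (glue P Q a b) n = d + (cfMap R (cfv a) + cfMap S (cfv b)) := by
      intro P Q n hP hQ hn
      obtain ⟨d, R, hdR⟩ := List.exists_cons_of_length_pos (l := P.drop n) (by simp; omega)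
      have hPeq : P = P.take n ++ (d :: R) := by rw [← hdR, List.take_append_drop]
      rw [hPeq, isBin_append] at hP
      have hS : IsBin ((P.take n).reverse ++ Q) := isBin_append.2 ⟨isBin_reverse.2 hP.1, hQ⟩
      refine ⟨d, R, _, (isBin_cons.1 hP.2).2, hS, fun a b ha hb => ?_⟩
      have h2 := lambdaVal_shift (binBi_glue (isBin_append.2 hP) hQ ha hb)
        (binBi_glue hP.2 hS ha hb) (m := (P.take n).length)
        (fun k => glue_shift _ _ _ _ _ k) 0
      rw [lambdaVal_glue_zero hP.2 hS ha hb, ← hPeq, List.length_take, min_eq_left hn.le,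
        add_zero, add_assoc] at h2
      exact h2
    have hbs : ∀ {a}, a ∈ omegaSeqs 𝓜 → BinSeq a := fun ha => binSeq_of_mem_omegaSeqs h𝓜.bin ha
    rcases le_or_gt 0 j with h0 | h0
    · lift j to ℕ using h0
      obtain ⟨d, R, S, hR, hS, h⟩ := key (n := j) hP'b hQ'b (by
        simp only [hP', List.length_append, hrl, Int.natAbs_natCast]; omega)
      refine ⟨d, R, S, hR, hS, fun a ha b hb => ?_⟩
      rw [← h a b (hbs ha) (hbs hb)]
      exact hmem a ha b hb
    · obtain ⟨n, hn⟩ : ∃ n : ℕ, j = -1 - n := ⟨(-1 - j).toNat, by omega⟩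
      obtain ⟨d, R, S, hR, hS, h⟩ := key (n := n) hQ'b hP'b (by
        simp only [hQ', List.length_append, hrl]; omega)
      refine ⟨d, S, R, hS, hR, fun a ha b hb => ?_⟩
      rw [add_comm (cfMap S _), ← h b a (hbs hb) (hbs ha),
        ← lambdaVal_reflect (hbin ha hb) (binBi_glue hQ'b hP'b (hbs hb) (hbs ha))
          (fun k => glue_reflect _ _ _ _ k), ← hn]
      exact hmem a ha b hb
  obtain ⟨d, R, S, hR, hS, h⟩ := hformula
  refine (le_dimH_sum_of_code h𝓜 h𝓐 hpf hσ hσ1 hsum hR hS).trans ?_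
  rw [← (IsometryEquiv.addLeft (d : ℝ)).isometry.dimH_image]
  refine dimH_mono ?_
  rintro _ ⟨_, ⟨a, ha, b, hb, rfl⟩, rfl⟩
  exact h a ha b hb

end glue

section tame

theorem one_third_mem_Icc : (1 / 3 : ℝ) ∈ Icc (0 : ℝ) 1 := by norm_num
theorem three_quarters_mem_Icc : (3 / 4 : ℝ) ∈ Icc (0 : ℝ) 1 := by norm_num

theorem cfMap_sub_even {w : List ℕ} (hw : IsBin w) (he : Even w.length) {x y : ℝ}
    (hx : x ∈ Icc (0 : ℝ) 1) (hy : y ∈ Icc (0 : ℝ) 1) :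
    cfMap w x - cfMap w y = (x - y) / (cfDen w x * cfDen w y) := by
  rw [cfMap_sub hw hx hy, he.neg_one_pow, one_mul]

theorem cfMap_le_of_even {w : List ℕ} (hw : IsBin w) (he : Even w.length) {x y : ℝ}
    (hx : x ∈ Icc (0 : ℝ) 1) (hy : y ∈ Icc (0 : ℝ) 1) (h : x ≤ y) : cfMap w x ≤ cfMap w y := by
  rw [← sub_nonneg, cfMap_sub_even hw he hy hx]
  have := cfDen_pos hw hx
  have := cfDen_pos hw hy
  have := sub_nonneg.2 h
  positivity

theorem cfMap_lt_of_even {w : List ℕ} (hw : IsBin w) (he : Even w.length) {x y : ℝ}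
    (hx : x ∈ Icc (0 : ℝ) 1) (hy : y ∈ Icc (0 : ℝ) 1) (h : x < y) : cfMap w x < cfMap w y := by
  rw [← sub_pos, cfMap_sub_even hw he hy hx]
  have := cfDen_pos hw hx
  have := cfDen_pos hw hy
  have := sub_pos.2 h
  positivity

theorem cfMap_le_of_odd {w : List ℕ} (hw : IsBin w) (ho : Odd w.length) {x y : ℝ}
    (hx : x ∈ Icc (0 : ℝ) 1) (hy : y ∈ Icc (0 : ℝ) 1) (h : x ≤ y) : cfMap w y ≤ cfMap w x := by
  rw [← sub_nonneg, cfMap_sub hw hx hy, ho.neg_one_pow, neg_one_mul, neg_sub]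
  have := cfDen_pos hw hx
  have := cfDen_pos hw hy
  have := sub_nonneg.2 h
  positivity

theorem cfv_eq_of_seqTake {a : ℕ → ℕ} (ha : BinSeq a) {w : List ℕ} (h : seqTake a w.length = w) :
    cfv a = cfMap w (cfv (shift a w.length)) := by
  rw [cfv_take_drop ha.posSeq w.length, h]

theorem cfv_mem_of_even {a : ℕ → ℕ} (ha : BinSeq a) {w : List ℕ} (h : seqTake a w.length = w)
    (he : Even w.length) : cfv a ∈ Icc (cfMap w (1 / 3)) (cfMap w (3 / 4)) := by
  have hw : IsBin w := h ▸ ha.isBin_take _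
  have h1 := cfv_mem_binHull (ha.drop w.length)
  rw [cfv_eq_of_seqTake ha h]
  exact ⟨cfMap_le_of_even hw he one_third_mem_Icc (binHull_subset h1) h1.1,
    cfMap_le_of_even hw he (binHull_subset h1) three_quarters_mem_Icc h1.2⟩

theorem cfv_mem_of_odd {a : ℕ → ℕ} (ha : BinSeq a) {w : List ℕ} (h : seqTake a w.length = w)
    (ho : Odd w.length) : cfv a ∈ Icc (cfMap w (3 / 4)) (cfMap w (1 / 3)) := by
  have hw : IsBin w := h ▸ ha.isBin_take _
  have h1 := cfv_mem_binHull (ha.drop w.length)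
  rw [cfv_eq_of_seqTake ha h]
  exact ⟨cfMap_le_of_odd hw ho (binHull_subset h1) three_quarters_mem_Icc h1.2,
    cfMap_le_of_odd hw ho one_third_mem_Icc (binHull_subset h1) h1.1⟩

/-- The value `[0; 1, 2, 2, 2, 1, 2, 2, 2, …]`. -/
noncomputable def perVal : ℝ := (2 * Real.sqrt 30 - 6) / 7

theorem sqrt30_bounds : 5.4772 < Real.sqrt 30 ∧ Real.sqrt 30 < 5.4773 := by
  constructor
  · exact Real.lt_sqrt_of_sq_lt (by norm_num)
  · rw [Real.sqrt_lt' (by norm_num)]; norm_num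

theorem perVal_bounds : 0.70777 < perVal ∧ perVal < 0.7078 := by
  have := sqrt30_bounds
  unfold perVal
  constructor <;> linarith

theorem perVal_mem_Icc : perVal ∈ Icc (0 : ℝ) 1 := by
  have := perVal_bounds
  constructor <;> linarith

theorem perVal_quadratic : 7 * perVal ^ 2 + 12 * perVal - 12 = 0 := by
  have := Real.sq_sqrt (show (0 : ℝ) ≤ 30 by norm_num)
  unfold perVal
  linear_combination (4 / 7) * this

theorem isBin_1222 : IsBin [1, 2, 2, 2] := by simp [IsBin]

theorem cfMap_1222_perVal : cfMap [1, 2, 2, 2] perVal = perVal := by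
  have h := perVal_quadratic
  have hb := perVal_bounds
  have : cfMap [1, 2, 2, 2] perVal = (12 + 5 * perVal) / (17 + 7 * perVal) := by
    simp only [cfMap_cons, cfMap_nil]
    have h1 : (0 : ℝ) < 2 + perVal := by linarith
    have h2 : (0 : ℝ) < 5 + 2 * perVal := by linarith
    have h3 : (0 : ℝ) < 12 + 5 * perVal := by linarith
    have h4 : (0 : ℝ) < 17 + 7 * perVal := by linarith
    push_cast
    rw [show 2 + 1 / (2 + perVal) = (5 + 2 * perVal) / (2 + perVal) by field_simp; ring,
      one_div_div, show 2 + (2 + perVal) / (5 + 2 * perVal) =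
        (12 + 5 * perVal) / (5 + 2 * perVal) by field_simp; ring,
      one_div_div, show 1 + (5 + 2 * perVal) / (12 + 5 * perVal) =
        (17 + 7 * perVal) / (12 + 5 * perVal) by field_simp; ring, one_div_div]
  rw [this, div_eq_iff (by linarith)]
  linarith

/-- The word `(1222)^n`. -/
abbrev perWord (n : ℕ) : List ℕ := wrep [1, 2, 2, 2] n

theorem length_perWord (n : ℕ) : (perWord n).length = 4 * n := by simp [length_wrep, mul_comm]

theorem even_length_perWord (n : ℕ) : Even (perWord n).length := ⟨2 * n, by
  rw [length_perWord]; ring⟩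

theorem isBin_perWord (n : ℕ) : IsBin (perWord n) := isBin_wrep isBin_1222 n

theorem cfMap_perWord_perVal (n : ℕ) : cfMap (perWord n) perVal = perVal :=
  cfMap_wrep_fixed cfMap_1222_perVal n

/-- An upper bound for the values of the sequences leaving `(1222)^∞` before `(1222)^(n+1)`. -/
noncomputable def perBound (n : ℕ) : ℝ := cfMap (perWord n) (12 / 17)

theorem perBound_lt (n : ℕ) : perBound n < perVal := by
  rw [← cfMap_perWord_perVal n]
  exact cfMap_lt_of_even (isBin_perWord n) (even_length_perWord n) (by norm_num) perVal_mem_Icc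
    (by linarith [perVal_bounds.1])

theorem le_perBound (n : ℕ) : 12 / 17 ≤ perBound n := by
  induction n with
  | zero => simp [perBound]
  | succ n ih =>
    have h1 : (12 / 17 : ℝ) ≤ cfMap [1, 2, 2, 2] (12 / 17) := by norm_num
    refine h1.trans ?_
    rw [perBound, perWord, wrep_succ, cfMap_append]
    exact cfMap_le_of_even isBin_1222 (by decide) (by norm_num)
      (cfMap_mem_Icc (isBin_perWord n) (by norm_num)) ih

/-- Sequences `a` in `1, 2` such that `2a` has no factor `2121`. -/
def Tame (a : ℕ → ℕ) : Prop :=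
  BinSeq a ∧ ¬(a 0 = 1 ∧ a 1 = 2 ∧ a 2 = 1) ∧
    ∀ n, ¬(a n = 2 ∧ a (n + 1) = 1 ∧ a (n + 2) = 2 ∧ a (n + 3) = 1)

theorem GoodSeq.tame {a : ℕ → ℕ} (h : GoodSeq a) : Tame a := by
  rw [goodSeq_iff] at h
  exact ⟨h.1, h.2 0, fun n hn => h.2 (n + 1) hn.2⟩

theorem seqTake_four (a : ℕ → ℕ) : seqTake a 4 = [a 0, a 1, a 2, a 3] := rfl

theorem Tame.cfv_le_or {a : ℕ → ℕ} (h : Tame a) :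
    seqTake a 4 = [1, 2, 2, 2] ∨ cfv a ≤ 12 / 17 := by
  obtain ⟨hb, h0, -⟩ := h
  rcases hb 0 with e0 | e0
  · rcases hb 1 with e1 | e1
    · right
      refine (cfv_mem_of_even hb (w := [1, 1]) (by simp [seqTake, List.range_succ, e0, e1])
        (by decide)).2.trans ?_
      norm_num
    · rcases hb 2 with e2 | e2
      · exact absurd ⟨e0, e1, e2⟩ h0
      · rcases hb 3 with e3 | e3
        · right
          refine (cfv_mem_of_even hb (w := [1, 2, 2, 1])
            (by simp [seqTake, List.range_succ, e0, e1, e2, e3]) (by decide)).2.trans ?_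
          norm_num
        · left
          rw [seqTake_four, e0, e1, e2, e3]
  · right
    refine (cfv_mem_of_odd hb (w := [2]) (by simp [seqTake, List.range_succ, e0])
      (by decide)).2.trans ?_
    norm_num

theorem Tame.drop_four {a : ℕ → ℕ} (h : Tame a) (h4 : seqTake a 4 = [1, 2, 2, 2]) :
    Tame (shift a 4) := by
  obtain ⟨hb, -, h2⟩ := h
  rw [seqTake_four] at h4
  simp only [List.cons.injEq] at h4
  refine ⟨hb.drop 4, fun h => h2 3 ⟨h4.2.2.2.1, h⟩, fun n hn => h2 (4 + n) hn⟩

theorem Tame.cfv_le_perBound {a : ℕ → ℕ} (h : Tame a) {n : ℕ}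
    (hn : seqTake a (4 * (n + 1)) ≠ perWord (n + 1)) : cfv a ≤ perBound n := by
  induction n generalizing a with
  | zero =>
    rcases h.cfv_le_or with h4 | h4
    · exact absurd (by simpa [perWord, wrep_one] using h4) hn
    · simpa [perBound] using h4
  | succ n ih =>
    rcases h.cfv_le_or with h4 | h4
    · have hd := h.drop_four h4
      have h5 : cfv (shift a 4) ≤ perBound n := by
        refine ih hd fun e => hn ?_
        rw [show 4 * (n + 1 + 1) = 4 + 4 * (n + 1) by ring, seqTake_add, h4, e, perWord, perWord,
          wrep_succ _ (n + 1)]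
      rw [cfv_eq_of_seqTake h.1 (w := [1, 2, 2, 2]) h4, perBound, perWord, wrep_succ, cfMap_append]
      exact cfMap_le_of_even isBin_1222 (by decide) (cfv_mem_Icc hd.1.posSeq)
        (cfMap_mem_Icc (isBin_perWord n) (by norm_num)) h5
    · exact h4.trans (le_perBound _)

theorem abs_cfMap_perWord_sub_le (n : ℕ) {x y : ℝ} (hx : x ∈ Icc (0 : ℝ) 1)
    (hy : y ∈ Icc (0 : ℝ) 1) : |cfMap (perWord n) x - cfMap (perWord n) y| ≤ (1 / 4) ^ n := by
  refine (abs_cfMap_sub_le_inv (isBin_perWord n) hx hy).trans ?_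
  have h2 : (2 : ℝ) ^ n ≤ cfq (perWord n) :=
    two_pow_le_cfq (isBin_perWord n) (by rw [length_perWord]; omega)
  rw [div_pow, one_pow]
  refine one_div_le_one_div_of_le (by positivity) ?_
  calc (4 : ℝ) ^ n = (2 ^ n) ^ 2 := by rw [← pow_mul, mul_comm, pow_mul]; norm_num
    _ ≤ _ := by gcongr

theorem abs_cfv_sub_perVal_le {a : ℕ → ℕ} (ha : BinSeq a) {n : ℕ}
    (h : seqTake a (4 * n) = perWord n) : |cfv a - perVal| ≤ (1 / 4) ^ n := by
  rw [cfv_eq_of_seqTake ha (w := perWord n) (by rwa [length_perWord]),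
    ← cfMap_perWord_perVal n]
  conv_lhs => rw [cfMap_perWord_perVal n]
  rw [← cfMap_perWord_perVal n]
  exact abs_cfMap_perWord_sub_le n (cfv_mem_Icc (ha.drop _).posSeq) perVal_mem_Icc

theorem Tame.cfv_le {a : ℕ → ℕ} (h : Tame a) : cfv a ≤ perVal := by
  by_contra! hlt
  obtain ⟨n, hn⟩ := exists_pow_lt_of_lt_one (sub_pos.2 hlt) (by norm_num : (1 / 4 : ℝ) < 1)
  have h1 : seqTake a (4 * (n + 1)) = perWord (n + 1) := by
    by_contra hne
    linarith [h.cfv_le_perBound hne, perBound_lt n]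
  have h2 := abs_cfv_sub_perVal_le h.1 h1
  rw [pow_succ] at h2
  have h3 : (0 : ℝ) < (1 / 4) ^ n := by positivity
  linarith [le_abs_self (cfv a - perVal)]

end tame

section occurrences

variable {α : ℤ → ℕ}

/-- The word `v` occurs in `α` at position `k`. -/
def OccursAt (α : ℤ → ℕ) (v : List ℕ) (k : ℤ) : Prop := seqTake (fwd α k) v.length = v

theorem shift_fwd (α : ℤ → ℕ) (k : ℤ) (n : ℕ) : shift (fwd α k) n = fwd α (k + n) := by
  funext i; simp [fwd, add_assoc]

theorem shift_bwd (α : ℤ → ℕ) (k : ℤ) (n : ℕ) : shift (bwd α k) n = bwd α (k - n) := by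
  funext i; simp [bwd, sub_sub]

theorem occursAt_append {u v : List ℕ} {k : ℤ} :
    OccursAt α (u ++ v) k ↔ OccursAt α u k ∧ OccursAt α v (k + u.length) := by
  unfold OccursAt
  rw [List.length_append, seqTake_add, shift_fwd]
  constructor
  · exact fun h => List.append_inj h (by simp)
  · rintro ⟨h1, h2⟩
    rw [h1, h2]

theorem occursAt_nil {k : ℤ} : OccursAt α [] k := rfl

theorem occursAt_cons {b : ℕ} {v : List ℕ} {k : ℤ} :
    OccursAt α (b :: v) k ↔ α k = b ∧ OccursAt α v (k + 1) := by
  rw [show b :: v = [b] ++ v from rfl, occursAt_append]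
  simp [OccursAt, seqTake, fwd, List.range_succ]

theorem seqTake_bwd (α : ℤ → ℕ) (k : ℤ) (n : ℕ) :
    seqTake (bwd α k) n = (seqTake (fwd α (k - n + 1)) n).reverse := by
  refine List.ext_getElem (by simp) fun i h1 h2 => ?_
  simp only [length_seqTake] at h1
  rw [List.getElem_reverse, getElem_seqTake, getElem_seqTake, bwd, fwd, length_seqTake]
  congr 1
  omega

theorem occursAt_reverse {v : List ℕ} {k : ℤ} :
    OccursAt α v.reverse k ↔ seqTake (bwd α (k + v.length - 1)) v.length = v := by
  rw [seqTake_bwd, show k + v.length - 1 - v.length + 1 = k by ring, OccursAt,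
    List.length_reverse, List.reverse_eq_iff]

theorem seqTake_fwd_mem_avoiding {v : List ℕ} (h : ∀ k, ¬ OccursAt α v k) (k : ℤ) (n : ℕ) :
    seqTake (fwd α k) n ∈ avoiding v := by
  refine forall_seqTake_mem_avoiding.2 (fun m hm => h (k + m) ?_) n
  rwa [shift_fwd] at hm

theorem seqTake_bwd_mem_avoiding {v : List ℕ} (h : ∀ k, ¬ OccursAt α v.reverse k) (k : ℤ)
    (n : ℕ) : seqTake (bwd α k) n ∈ avoiding v := by
  refine forall_seqTake_mem_avoiding.2 (fun m hm => h (k - m - v.length + 1) ?_) n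
  rw [shift_bwd] at hm
  rw [occursAt_reverse]
  convert hm using 3
  ring

/-- Markov values below `7/2` come from sequences in `1, 2`. -/
theorem binBi_of_markovValue_lt (hpos : ∀ n, 0 < α n) (hbdd : BddAbove (range (lambdaVal α)))
    (h : markovValue α < 7 / 2) : BinBi α := by
  have hl : ∀ k, lambdaVal α k < 7 / 2 := fun k => (le_ciSup hbdd k).trans_lt h
  have hR : ∀ k, PosSeq (fwd α k) := fun k n => hpos _
  have hL : ∀ k, PosSeq (bwd α k) := fun k n => hpos _
  have h3 : ∀ k, α k ≤ 3 := by
    intro k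
    by_contra! hk
    have := hl k
    rw [lambdaVal_eq hpos] at this
    have h1 := cfv_pos (hR (k + 1))
    have h2 := cfv_pos (hL (k - 1))
    unfold fwd at h1
    unfold bwd at h2
    have h4 : (4 : ℝ) ≤ α k := by exact_mod_cast hk
    linarith
  have hq : ∀ a : ℕ → ℕ, PosSeq a → a 0 ≤ 3 → 1 / 4 < cfv a := by
    intro a ha h0
    rw [cfv_eq ha]
    have h1 := cfv_lt_one (ha.drop 1)
    have h2 := cfv_pos (ha.drop 1)
    have h3 : (a 0 : ℝ) ≤ 3 := by exact_mod_cast h0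
    have h4 := ha.one_le 0
    exact one_div_lt_one_div_of_lt (by linarith) (by linarith)
  intro k
  have hk : α k ≠ 3 := by
    intro hk
    have := hl k
    rw [lambdaVal_eq hpos, hk] at this
    have h1 := hq _ (hR (k + 1)) (h3 _)
    have h2 := hq _ (hL (k - 1)) (h3 _)
    unfold fwd at h1
    unfold bwd at h2
    push_cast at this
    linarith
  have := h3 k
  have := hpos k
  omega

theorem exists_binBi_of_mem_markovSpectrum {x t : ℝ} (hx : x ∈ markovSpectrum ∩ Iio t)
    (ht : t ≤ 7 / 2) : ∃ α, BinBi α ∧ markovValue α = x ∧ ∀ k, lambdaVal α k ≤ x := by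
  obtain ⟨⟨α, hpos, hbdd, rfl⟩, hlt⟩ := hx
  exact ⟨α, binBi_of_markovValue_lt hpos hbdd (lt_of_lt_of_le hlt ht), rfl,
    fun k => le_ciSup hbdd k⟩

/-- Markov values of sequences with restricted factors have small dimension. -/
theorem dimH_le_of_factors {𝓛 : Set (List ℕ)} (h𝓛 : FactorClosed 𝓛) {σ : ℝ} (hσ : 0 ≤ σ) {N : ℕ}
    (hN : 0 < N) (h : levelSum 𝓛 σ N < 1) :
    dimH {x | ∃ α, BinBi α ∧ (∀ k n, seqTake (fwd α k) n ∈ 𝓛) ∧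
      (∀ k n, seqTake (bwd α k) n ∈ 𝓛) ∧ markovValue α = x} ≤ ENNReal.ofReal σ := by
  refine (dimH_mono ?_).trans (dimH_closure_sum_le h𝓛 hσ hN h)
  rintro _ ⟨α, hα, hf, hb, rfl⟩
  refine closure_mono ?_ (csSup_mem_closure (range_nonempty (lambdaVal α)) hα.bddAbove)
  rintro _ ⟨k, rfl⟩
  exact ⟨α k, hα k, fwd α (k + 1), bwd α (k - 1), hα.fwd _, hα.bwd _, hf _, hb _,
    hα.lambdaVal_eq k⟩

end occurrences

section endpoints

theorem plateauStart_eq :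
    4 * Real.sqrt 30 / 7 = 2 + perVal + cfMap [2, 2] perVal := by
  have hb := perVal_bounds
  have hq := perVal_quadratic
  have h1 : (0 : ℝ) < 2 + perVal := by linarith
  have h2 : (0 : ℝ) < 5 + 2 * perVal := by linarith
  have h3 : cfMap [2, 2] perVal = (2 + perVal) / (5 + 2 * perVal) := by
    simp only [cfMap_cons, cfMap_nil]
    push_cast
    rw [show 2 + 1 / (2 + perVal) = (5 + 2 * perVal) / (2 + perVal) by field_simp; ring,
      one_div_div]
  have h4 : (2 + perVal) / (5 + 2 * perVal) = perVal - 2 / 7 := by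
    rw [div_eq_iff h2.ne']; linarith
  rw [h3, h4, perVal]
  ring

theorem plateauEnd_eq :
    (16351 + 720 * Real.sqrt 30) / 6409 =
      2 + cfMap [1] perVal + cfMap [1, 1, 2, 1] perVal := by
  have hb := perVal_bounds
  have hq := perVal_quadratic
  have h1 : (0 : ℝ) < 1 + perVal := by linarith
  have h2 : (0 : ℝ) < 3 + 2 * perVal := by linarith
  have h3 : (0 : ℝ) < 4 + 3 * perVal := by linarith
  have h4 : (0 : ℝ) < 7 + 5 * perVal := by linarith
  have h5 : cfMap [1, 1, 2, 1] perVal = (4 + 3 * perVal) / (7 + 5 * perVal) := by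
    simp only [cfMap_cons, cfMap_nil]
    push_cast
    rw [show 2 + 1 / (1 + perVal) = (3 + 2 * perVal) / (1 + perVal) by field_simp; ring,
      one_div_div, show 1 + (1 + perVal) / (3 + 2 * perVal) =
        (4 + 3 * perVal) / (3 + 2 * perVal) by
          rw [eq_div_iff h2.ne', add_mul, div_mul_cancel₀ _ h2.ne']
          ring,
      one_div_div, show 1 + (3 + 2 * perVal) / (4 + 3 * perVal) =
        (7 + 5 * perVal) / (4 + 3 * perVal) by field_simp; ring, one_div_div]
  have h6 : cfMap [1] perVal = 1 / (1 + perVal) := by simp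
  have hs : Real.sqrt 30 = (7 * perVal + 6) / 2 := by unfold perVal; ring
  have h7 : 1 / (1 + perVal) = (7 * perVal + 5) / 17 := by
    rw [div_eq_iff h1.ne']; linarith
  have h8 : (4 + 3 * perVal) / (7 + 5 * perVal) = (224 - 7 * perVal) / 377 := by
    rw [div_eq_iff h4.ne']; linarith
  rw [h5, h6, h7, h8, hs]
  ring

theorem plateauEnd_lt : (16351 + 720 * Real.sqrt 30) / 6409 < 3.1666 := by
  have := sqrt30_bounds
  rw [div_lt_iff₀ (by norm_num)]
  linarith

theorem plateauStart_bounds : 3.12 < 4 * Real.sqrt 30 / 7 ∧ 4 * Real.sqrt 30 / 7 < 3.13 := by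
  have := sqrt30_bounds
  constructor <;> linarith

end endpoints

section upperBound

variable {α : ℤ → ℕ}

/-- The sequence read backwards. -/
def reflect (α : ℤ → ℕ) : ℤ → ℕ := fun k => α (-k)

theorem BinBi.reflect (h : BinBi α) : BinBi (reflect α) := fun k => h (-k)

theorem fwd_reflect (α : ℤ → ℕ) (k : ℤ) : fwd (reflect α) k = bwd α (-k) := by
  funext n; simp only [fwd, reflect, bwd]; congr 1; ring

theorem bwd_reflect (α : ℤ → ℕ) (k : ℤ) : bwd (reflect α) k = fwd α (-k) := by
  funext n; simp only [fwd, reflect, bwd]; congr 1; ring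

theorem lambdaVal_reflect_neg (h : BinBi α) (k : ℤ) :
    lambdaVal (reflect α) k = lambdaVal α (-k) := by
  rw [h.reflect.lambdaVal_eq, h.lambdaVal_eq, fwd_reflect, bwd_reflect, reflect,
    show -(k + 1) = -k - 1 by ring, show -(k - 1) = -k + 1 by ring]
  ring

theorem cfv_le_of_two {a : ℕ → ℕ} (ha : BinSeq a) (h : a 0 = 2) : cfv a ≤ 3 / 7 :=
  (cfv_mem_of_odd ha (w := [2]) (by simp [seqTake, List.range_succ, h]) (by decide)).2.trans
    (by norm_num)

theorem le_cfv_of_one {a : ℕ → ℕ} (ha : BinSeq a) (h : a 0 = 1) : 4 / 7 ≤ cfv a :=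
  le_trans (by norm_num)
    (cfv_mem_of_odd ha (w := [1]) (by simp [seqTake, List.range_succ, h]) (by decide)).1

/-- The position `j` is the middle of a factor `121`. -/
def IsCentre (α : ℤ → ℕ) (j : ℤ) : Prop := α (j - 1) = 1 ∧ α j = 2 ∧ α (j + 1) = 1

theorem IsCentre.reflect {j : ℤ} (h : IsCentre α j) : IsCentre (reflect α) (-j) := by
  refine ⟨?_, ?_, ?_⟩ <;> simp only [_root_.reflect]
  · rw [show -(-j - 1) = j + 1 by ring]; exact h.2.2
  · rw [neg_neg]; exact h.2.1
  · rw [show -(-j + 1) = j - 1 by ring]; exact h.1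

theorem fwd_at {α : ℤ → ℕ} {k m : ℤ} {n : ℕ} {b : ℕ} (h : α m = b) (e : k + n = m) :
    fwd α k n = b := by rw [fwd, e, h]

theorem bwd_at {α : ℤ → ℕ} {k m : ℤ} {n : ℕ} {b : ℕ} (h : α m = b) (e : k - n = m) :
    bwd α k n = b := by rw [bwd, e, h]

theorem le_lambdaVal_of_centre (hα : BinBi α) {j : ℤ} (hj : IsCentre α j) :
    22 / 7 ≤ lambdaVal α j := by
  rw [hα.lambdaVal_eq, hj.2.1]
  have h1 := le_cfv_of_one (hα.fwd (j + 1)) (fwd_at hj.2.2 (by simp))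
  have h2 := le_cfv_of_one (hα.bwd (j - 1)) (bwd_at hj.1 (by simp))
  push_cast
  linarith

theorem next_eq_one (hα : BinBi α) {j : ℤ} (hj : IsCentre α j) (h : lambdaVal α j < 3.1666) :
    α (j + 2) = 1 := by
  refine (hα (j + 2)).resolve_right fun h2 => ?_
  rw [hα.lambdaVal_eq, hj.2.1] at h
  have h1 := (cfv_mem_of_even (hα.fwd (j + 1)) (w := [1, 2]) (by
    simp [seqTake, List.range_succ, fwd_at hj.2.2, fwd_at h2 (k := j + 1) (n := 1) (by push_cast; ring)])
    (by decide)).1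
  have h3 := le_cfv_of_one (hα.bwd (j - 1)) (bwd_at hj.1 (by simp))
  norm_num at h1 h
  linarith

theorem prev_eq_one (hα : BinBi α) {j : ℤ} (hj : IsCentre α j) (h : lambdaVal α j < 3.1666) :
    α (j - 2) = 1 := by
  have := next_eq_one hα.reflect hj.reflect (by rwa [lambdaVal_reflect_neg hα, neg_neg])
  rwa [reflect, show -(-j + 2) = j - 2 by ring] at this

theorem third_eq_two (hα : BinBi α) {j : ℤ} (hj : IsCentre α j) (h : lambdaVal α j < 3.1666) :
    α (j + 3) = 2 := by
  refine (hα (j + 3)).resolve_left fun h2 => ?_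
  have hn := next_eq_one hα hj h
  have hp := prev_eq_one hα hj h
  rw [hα.lambdaVal_eq, hj.2.1] at h
  have h1 := (cfv_mem_of_odd (hα.fwd (j + 1)) (w := [1, 1, 1]) (by
    simp [seqTake, List.range_succ, fwd_at hj.2.2,
      fwd_at hn (k := j + 1) (n := 1) (by push_cast; ring),
      fwd_at h2 (k := j + 1) (n := 2) (by push_cast; ring)]) (by decide)).1
  have h3 := (cfv_mem_of_even (hα.bwd (j - 1)) (w := [1, 1]) (by
    simp [seqTake, List.range_succ, bwd_at hj.1,
      bwd_at hp (k := j - 1) (n := 1) (by push_cast; ring)]) (by decide)).1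
  norm_num at h1 h h3
  linarith

theorem third_prev_eq_two (hα : BinBi α) {j : ℤ} (hj : IsCentre α j)
    (h : lambdaVal α j < 3.1666) : α (j - 3) = 2 := by
  have := third_eq_two hα.reflect hj.reflect (by rwa [lambdaVal_reflect_neg hα, neg_neg])
  rwa [reflect, show -(-j + 3) = j - 3 by ring] at this

theorem tame_fwd (hα : BinBi α) (h : ∀ j, lambdaVal α j < 3.1666) {k : ℤ}
    (hk : ¬(α k = 1 ∧ α (k + 1) = 2 ∧ α (k + 2) = 1)) : Tame (fwd α k) := by
  refine ⟨hα.fwd k, by simpa [fwd] using hk, fun n hn => ?_⟩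
  simp only [fwd, Nat.cast_add, Nat.cast_one, Nat.cast_ofNat] at hn
  obtain ⟨h0, h1, h2, h3⟩ := hn
  have hc : IsCentre α (k + n + 2) := by
    refine ⟨?_, ?_, ?_⟩
    · rw [← h1]; congr 1; ring
    · rw [← h2]; congr 1; ring
    · rw [← h3]; congr 1; ring
  have := prev_eq_one hα hc (h _)
  rw [show k + n + 2 - 2 = k + n by ring, h0] at this
  omega

/-- Comparison of the two middles of `… 121 121 …`. -/
theorem cfMap_pair_ge {x y : ℝ} (hx : x ∈ Icc (0 : ℝ) 1) (hy : y ∈ Icc (0 : ℝ) 1) (hxy : x ≤ y)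
    (hle : y ≤ perVal) : cfMap [1] perVal + cfMap [1, 1, 2, 1] perVal + (perVal - x) / 5 ≤
      cfMap [1] x + cfMap [1, 1, 2, 1] y := by
  have h1 : (perVal - x) / 4 ≤ cfMap [1] x - cfMap [1] perVal := by
    have hb := perVal_bounds
    have h0 := hx.1
    have e : cfMap [1] x - cfMap [1] perVal = (perVal - x) / ((1 + x) * (1 + perVal)) := by
      have : 1 + x ≠ 0 := by linarith
      have : 1 + perVal ≠ 0 := by linarith
      simp only [cfMap_cons, cfMap_nil]
      push_cast
      field_simp
      ring
    rw [e]
    refine div_le_div_of_nonneg_left (by linarith) (by nlinarith) ?_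
    nlinarith
  have h2 : cfMap [1, 1, 2, 1] perVal - cfMap [1, 1, 2, 1] y ≤ (perVal - y) / 20 := by
    have hw : IsBin [1, 1, 2, 1] := by simp [IsBin]
    refine (le_abs_self _).trans ((abs_cfMap_sub_le hw perVal_mem_Icc hy).trans ?_)
    rw [abs_of_nonneg (by linarith)]
    refine div_le_div_of_nonneg_left (by linarith) (by norm_num) ?_
    have : cfq [1, 1, 2, 1] = 7 := by norm_num [cfq]
    rw [this]
    norm_num
  linarith

theorem fourth_eq_one (hα : BinBi α)
    (h : ∀ j, lambdaVal α j < (16351 + 720 * Real.sqrt 30) / 6409) {j : ℤ} (hj : IsCentre α j) :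
    α (j + 4) = 1 := by
  refine (hα (j + 4)).resolve_right fun h4 => ?_
  have hlt : ∀ j, lambdaVal α j < 3.1666 := fun j => (h j).trans plateauEnd_lt
  have hn := next_eq_one hα hj (hlt j)
  have hp := prev_eq_one hα hj (hlt j)
  have hn3 := third_eq_two hα hj (hlt j)
  have hp3 := third_prev_eq_two hα hj (hlt j)
  have hR : cfv (fwd α (j + 1)) = cfMap [1] (cfv (fwd α (j + 2))) := by
    rw [cfv_eq_of_seqTake (hα.fwd (j + 1)) (w := [1])
      (by simp [seqTake, List.range_succ, fwd_at hj.2.2]), shift_fwd]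
    norm_num [add_assoc]
  rcases hα (j - 4) with hp4 | hp4
  · have hj' : IsCentre α (j - 3) := by
      refine ⟨?_, hp3, ?_⟩
      · rw [show j - 3 - 1 = j - 4 by ring, hp4]
      · rw [show j - 3 + 1 = j - 2 by ring, hp]
    have hp5 := prev_eq_one hα hj' (hlt _)
    have hp6 := third_prev_eq_two hα hj' (hlt _)
    rw [show j - 3 - 2 = j - 5 by ring] at hp5
    rw [show j - 3 - 3 = j - 6 by ring] at hp6
    have hL : cfv (bwd α (j - 1)) = cfMap [1, 1, 2, 1] (cfv (bwd α (j - 5))) := by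
      rw [cfv_eq_of_seqTake (hα.bwd (j - 1)) (w := [1, 1, 2, 1]) (by
        simp [seqTake, List.range_succ, bwd_at hj.1,
          bwd_at hp (k := j - 1) (n := 1) (by push_cast; ring),
          bwd_at hp3 (k := j - 1) (n := 2) (by push_cast; ring),
          bwd_at hp4 (k := j - 1) (n := 3) (by push_cast; ring)]), shift_bwd]
      norm_num [sub_sub]
    have hs : cfv (fwd α (j + 2)) ≤ perVal := by
      refine (tame_fwd hα hlt fun hk => ?_).cfv_le
      rw [show j + 2 + 2 = j + 4 by ring, h4] at hk
      omega
    have hj1 := h j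
    rw [hα.lambdaVal_eq, hj.2.1, hR, hL, plateauEnd_eq] at hj1
    have hsI := cfv_mem_Icc (hα.fwd (j + 2)).posSeq
    have hsI' := cfv_mem_Icc (hα.bwd (j - 5)).posSeq
    rcases hα (j - 7) with hp7 | hp7
    · have h5 := (cfv_mem_of_odd (hα.bwd (j - 5)) (w := [1, 2, 1]) (by
        simp [seqTake, List.range_succ, bwd_at hp5 (k := j - 5) (n := 0) (by simp),
          bwd_at hp6 (k := j - 5) (n := 1) (by push_cast; ring),
          bwd_at hp7 (k := j - 5) (n := 2) (by push_cast; ring)]) (by decide)).1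
      norm_num at h5
      have h6 := cfMap_le_of_even (w := [1, 1, 2, 1]) (by simp [IsBin]) (by decide)
        perVal_mem_Icc hsI' (by linarith [perVal_bounds.2])
      have h7 := cfMap_le_of_odd (w := [1]) (by simp [IsBin]) (by decide) hsI perVal_mem_Icc hs
      push_cast at hj1
      linarith
    · have hs' : cfv (bwd α (j - 5)) ≤ perVal := by
        have : Tame (fwd (reflect α) (-j + 5)) := by
          refine tame_fwd hα.reflect (fun k => ?_) fun hk => ?_
          · rw [lambdaVal_reflect_neg hα]; exact hlt _
          · have := hk.2.2
            rw [reflect, show -(-j + 5 + 2) = j - 7 by ring, hp7] at this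
            omega
        have := this.cfv_le
        rwa [fwd_reflect, show -(-j + 5) = j - 5 by ring] at this
      have hL' : cfv (bwd α (j - 3 - 1)) = cfMap [1] (cfv (bwd α (j - 5))) := by
        rw [cfv_eq_of_seqTake (hα.bwd (j - 3 - 1)) (w := [1])
          (by simp [seqTake, List.range_succ, bwd_at hj'.1]), shift_bwd]
        norm_num [sub_sub]
      have hR' : cfv (fwd α (j - 3 + 1)) = cfMap [1, 1, 2, 1] (cfv (fwd α (j + 2))) := by
        rw [cfv_eq_of_seqTake (hα.fwd (j - 3 + 1)) (w := [1, 1, 2, 1]) (by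
          simp [seqTake, List.range_succ, fwd_at hj'.2.2,
            fwd_at hj.1 (k := j - 3 + 1) (n := 1) (by push_cast; ring),
            fwd_at hj.2.1 (k := j - 3 + 1) (n := 2) (by push_cast; ring),
            fwd_at hj.2.2 (k := j - 3 + 1) (n := 3) (by push_cast; ring)]), shift_fwd]
        congr 3
        simp; ring
      have hj2 := h (j - 3)
      rw [hα.lambdaVal_eq, hj'.2.1, hR', hL', plateauEnd_eq] at hj2
      push_cast at hj1 hj2
      rcases le_total (cfv (fwd α (j + 2))) (cfv (bwd α (j - 5))) with hle | hle
      · linarith [cfMap_pair_ge hsI hsI' hle hs']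
      · linarith [cfMap_pair_ge hsI' hsI hle hs]
  · have h1 := (cfv_mem_of_even (hα.fwd (j + 1)) (w := [1, 1, 2, 2]) (by
      simp [seqTake, List.range_succ, fwd_at hj.2.2,
        fwd_at hn (k := j + 1) (n := 1) (by push_cast; ring),
        fwd_at hn3 (k := j + 1) (n := 2) (by push_cast; ring),
        fwd_at h4 (k := j + 1) (n := 3) (by push_cast; ring)]) (by decide)).1
    have h2 := (cfv_mem_of_even (hα.bwd (j - 1)) (w := [1, 1, 2, 2]) (by
      simp [seqTake, List.range_succ, bwd_at hj.1,
        bwd_at hp (k := j - 1) (n := 1) (by push_cast; ring),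
        bwd_at hp3 (k := j - 1) (n := 2) (by push_cast; ring),
        bwd_at hp4 (k := j - 1) (n := 3) (by push_cast; ring)]) (by decide)).1
    have h3 := hlt j
    rw [hα.lambdaVal_eq, hj.2.1] at h3
    norm_num at h1 h2 h3
    linarith

theorem IsCentre.add_three (hα : BinBi α)
    (h : ∀ j, lambdaVal α j < (16351 + 720 * Real.sqrt 30) / 6409) {j : ℤ} (hj : IsCentre α j) :
    IsCentre α (j + 3) := by
  have hlt := (h j).trans plateauEnd_lt
  refine ⟨?_, third_eq_two hα hj hlt, ?_⟩
  · rw [show j + 3 - 1 = j + 2 by ring]; exact next_eq_one hα hj hlt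
  · rw [show j + 3 + 1 = j + 4 by ring]; exact fourth_eq_one hα h hj

theorem IsCentre.add_mul_three (hα : BinBi α)
    (h : ∀ j, lambdaVal α j < (16351 + 720 * Real.sqrt 30) / 6409) {j : ℤ} (hj : IsCentre α j)
    (n : ℕ) : IsCentre α (j + 3 * n) := by
  induction n with
  | zero => simpa using hj
  | succ n ih =>
    have := ih.add_three hα h
    rwa [show j + 3 * n + 3 = j + 3 * ((n + 1 : ℕ) : ℤ) by push_cast; ring] at this

theorem IsCentre.sub_mul_three (hα : BinBi α)
    (h : ∀ j, lambdaVal α j < (16351 + 720 * Real.sqrt 30) / 6409) {j : ℤ} (hj : IsCentre α j)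
    (n : ℕ) : IsCentre α (j - 3 * n) := by
  have := (hj.reflect.add_mul_three hα.reflect
    (fun k => by rw [lambdaVal_reflect_neg hα]; exact h _) n).reflect
  rwa [show _root_.reflect (_root_.reflect α) = α by funext k; simp [_root_.reflect],
    show -(-j + 3 * (n : ℤ)) = j - 3 * n by ring] at this

/-- Below the right endpoint, a sequence with a factor `121` is `112` repeated. -/
theorem eq_of_isCentre (hα : BinBi α)
    (h : ∀ j, lambdaVal α j < (16351 + 720 * Real.sqrt 30) / 6409) {j : ℤ} (hj : IsCentre α j) :
    α = fun k => if (3 : ℤ) ∣ k - j then 2 else 1 := by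
  have hall : ∀ m : ℤ, IsCentre α (j + 3 * m) := by
    intro m
    rcases le_total 0 m with hm | hm
    · lift m to ℕ using hm
      exact hj.add_mul_three hα h m
    · obtain ⟨n, rfl⟩ : ∃ n : ℕ, m = -n := ⟨m.natAbs, by omega⟩
      have := hj.sub_mul_three hα h n
      rwa [show j - 3 * (n : ℤ) = j + 3 * (-n) by ring] at this
  funext k
  split_ifs with hk
  · obtain ⟨m, hm⟩ := hk
    rw [show k = j + 3 * m by omega]
    exact (hall m).2.1
  · rcases (by omega : (k - j) % 3 = 1 ∨ (k - j) % 3 = 2) with hr | hr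
    · rw [show k = j + 3 * ((k - j) / 3) + 1 by omega]
      exact (hall _).2.2
    · rw [show k = j + 3 * ((k - j) / 3 + 1) - 1 by omega]
      exact (hall _).1

theorem not_occursAt_of_no_centre (h : ∀ j, ¬ IsCentre α j) (k : ℤ) : ¬ OccursAt α [1, 2, 1] k := by
  intro hk
  simp only [occursAt_cons] at hk
  refine h (k + 1) ⟨?_, hk.2.1, hk.2.2.1⟩
  rw [show k + 1 - 1 = k by ring]; exact hk.1

theorem dimFun_plateauEnd_le :
    dimFun ((16351 + 720 * Real.sqrt 30) / 6409) ≤ 2 * dimH K2 := by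
  rw [← ofReal_critExp]
  refine ENNReal.le_of_forall_pos_le_add fun ε hε _ => ?_
  rw [← ENNReal.ofReal_coe_nnreal, ← ENNReal.ofReal_add critExp_nonneg (NNReal.coe_nonneg ε)]
  obtain ⟨n, hn, hlt⟩ := exists_levelSum_lt_one (lt_add_of_pos_right critExp (show (0 : ℝ) < ε from hε))
  have h1 := dimH_le_of_factors (factorClosed_avoiding [1, 2, 1])
    (add_nonneg critExp_nonneg ε.2) hn hlt
  have h2 : dimH (range fun j : ℤ => markovValue fun k => if (3 : ℤ) ∣ k - j then 2 else 1) = 0 :=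
    (countable_range _).dimH_zero
  rw [dimFun]
  refine (dimH_mono (t := _ ∪ _) ?_).trans ((dimH_union _ _).trans_le (max_le h1 (h2.trans_le
    zero_le)))
  intro x hx
  obtain ⟨α, hα, rfl, hle⟩ := exists_binBi_of_mem_markovSpectrum hx
    (by linarith [plateauEnd_lt])
  have hlt : ∀ j, lambdaVal α j < (16351 + 720 * Real.sqrt 30) / 6409 :=
    fun j => (hle j).trans_lt hx.2
  by_cases hc : ∃ j, IsCentre α j
  · obtain ⟨j, hj⟩ := hc
    exact Or.inr ⟨j, congrArg markovValue (eq_of_isCentre hα hlt hj).symm⟩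
  · push Not at hc
    have hno := not_occursAt_of_no_centre hc
    exact Or.inl ⟨α, hα, seqTake_fwd_mem_avoiding hno,
      seqTake_bwd_mem_avoiding (by simpa using hno), rfl⟩

end upperBound

section belowPlateau

/-- Words marked at the end by a factor that does not occur in `𝓛` form a prefix-free set. -/
theorem prefix_biUnion_markedWords {𝓛 : Set (List ℕ)} {g₀ U : List ℕ} {N : ℕ}
    (hU : U.head? = some 1) (hU' : U.getLast? = some 1) (hU2 : ¬ [2, 2, 2, 2] <:+: U)
    (h𝓛 : ∀ w ∈ 𝓛, w ∈ avoiding U) :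
    ∀ u ∈ (Finset.range N).biUnion (markedWords 𝓛 g₀ ([2, 2, 2, 2] ++ U ++ [2, 2, 2, 2])),
      ∀ v ∈ (Finset.range N).biUnion (markedWords 𝓛 g₀ ([2, 2, 2, 2] ++ U ++ [2, 2, 2, 2])),
        u <+: v → u = v := by
  intro u hu v hv h
  obtain ⟨n, -, hu⟩ := Finset.mem_biUnion.1 hu
  obtain ⟨n', -, hv⟩ := Finset.mem_biUnion.1 hv
  obtain ⟨w, hw, -, hl, rfl⟩ := mem_markedWords.1 hu
  obtain ⟨w', hw', -, hl', rfl⟩ := mem_markedWords.1 hv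
  have hle := h.length_le
  simp only [List.length_append] at hle
  rcases (show w.length ≤ w'.length by omega).eq_or_lt with he | hlt
  · exact h.eq_of_length (by simp [he])
  exfalso
  have hUne : U ≠ [] := by rintro rfl; simp at hU
  have hUpos := List.length_pos_iff.2 hUne
  rw [List.append_assoc g₀ w, List.append_assoc g₀ w', List.prefix_append_right_inj] at h
  have h1 : w ++ [2, 2, 2, 2] ++ U <+: w' ++ ([2, 2, 2, 2] ++ U ++ [2, 2, 2, 2]) :=
    List.IsPrefix.trans ⟨[2, 2, 2, 2], by simp⟩ h
  have h2 : w' ++ [2, 2, 2, 2] ++ U.dropLast <+: w' ++ ([2, 2, 2, 2] ++ U ++ [2, 2, 2, 2]) := by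
    rw [List.append_assoc, List.append_assoc, List.prefix_append_right_inj,
      List.prefix_append_right_inj]
    exact (List.dropLast_prefix U).trans (List.prefix_append _ _)
  have h3 := List.prefix_of_prefix_length_le h1 h2 (by simp; omega)
  have h4 : U <:+: w' ++ [2, 2, 2, 2] ++ U.dropLast :=
    (List.suffix_append _ _).isInfix.trans h3.isInfix
  rw [List.infix_append_iff] at h4
  rcases h4 with h4 | h4 | ⟨p, q, hpq, hp, hq⟩
  · rw [List.infix_append_iff] at h4
    rcases h4 with h4 | h4 | ⟨p, q, hpq, hp, hq⟩
    · exact h𝓛 w' hw' h4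
    · have := h4.subset (List.mem_of_getLast? hU')
      simp at this
    · rcases eq_or_ne q [] with rfl | hne
      · rw [List.append_nil] at hpq
        exact h𝓛 w' hw' (hpq ▸ hp.isInfix)
      · rw [hpq, List.getLast?_append_of_ne_nil _ hne] at hU'
        have := hq.subset (List.mem_of_getLast? hU')
        simp at this
  · have := h4.length_le
    simp at this
    omega
  · rw [straddle_eq_nil (by simp) hU2 hU hpq (List.suffix_append _ _) hp, List.nil_append] at hpq
    have := hq.length_le
    rw [← hpq, List.length_dropLast] at this
    omega

theorem avoiding_2222_append {u w : List ℕ} (hu : u ∈ avoiding [2, 2, 2, 2])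
    (hw : w ∈ avoiding [2, 2, 2, 2]) (h : w.head? = some 1) : u ++ w ∈ avoiding [2, 2, 2, 2] := by
  intro hcon
  rw [List.infix_append_iff] at hcon
  rcases hcon with h1 | h1 | ⟨p, q, hpq, hp, hq⟩
  · exact hu h1
  · exact hw h1
  · rcases q with _ | ⟨d, q⟩
    · rw [List.append_nil] at hpq
      exact hu (hpq ▸ hp.isInfix)
    · obtain ⟨r, rfl⟩ := hq
      simp at h
      have : d ∈ [2, 2, 2, 2] := by rw [hpq]; simp
      simp at this
      omega

theorem good_perWord_append {w : List ℕ} (hw : w ∈ goodWords) (m : ℕ) :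
    perWord m ++ w ∈ goodWords := by
  induction m with
  | zero => simpa using hw
  | succ m ih =>
    rw [perWord, wrep_succ, List.append_assoc]
    exact good_append_of_suffix (by unfold goodWords avoiding; decide) ih ⟨[1, 2], rfl⟩

theorem perWord_append_avoiding_2222 {w : List ℕ} (hw : w ∈ avoiding [2, 2, 2, 2])
    (h : w.head? = some 1) (m : ℕ) :
    perWord m ++ w ∈ avoiding [2, 2, 2, 2] ∧ (perWord m ++ w).head? = some 1 := by
  induction m with
  | zero => simpa using ⟨hw, h⟩
  | succ m ih =>
    rw [perWord, wrep_succ, List.append_assoc]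
    exact ⟨avoiding_2222_append (by unfold avoiding; decide) ih.1 ih.2, rfl⟩

theorem perWord_append_one (m : ℕ) : perWord m ++ [1] = 1 :: wrep [2, 2, 2, 1] m := by
  induction m with
  | zero => rfl
  | succ m ih =>
    rw [perWord, wrep_succ, List.append_assoc, ih, wrep_succ]
    rfl

theorem reverse_perWord_append_one (m : ℕ) : (perWord m ++ [1]).reverse = perWord m ++ [1] := by
  rw [List.reverse_append, perWord, reverse_wrep]
  exact (perWord_append_one m).symm

theorem reverse_perWord (m : ℕ) : (perWord m).reverse = wrep [2, 2, 2, 1] m := by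
  rw [perWord, reverse_wrep]; rfl

/-- Decomposition of a periodic word around the middle letter of its middle `222`. -/
theorem perWord_decomp (k : ℕ) :
    perWord (2 * k + 1) = [1] ++ (([2, 2] ++ perWord k).reverse ++ ([2] ++ perWord k)) := by
  rw [List.reverse_append, reverse_perWord, show 2 * k + 1 = k + (1 + k) by ring, perWord, wrep_add,
    wrep_add, wrep_one]
  have h := perWord_append_one k
  rw [perWord] at h
  calc _ = (wrep [1, 2, 2, 2] k ++ [1]) ++ ([2, 2, 2] ++ wrep [1, 2, 2, 2] k) := by simp
    _ = _ := by rw [h]; simp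

theorem not_occursAt_perWord {α : ℤ → ℕ} (hα : BinBi α) {t : ℝ} {k : ℕ}
    (hk : 2 * (1 / 4 : ℝ) ^ k < 4 * Real.sqrt 30 / 7 - t) (h : ∀ j, lambdaVal α j ≤ t) (p : ℤ) :
    ¬ OccursAt α (perWord (2 * k + 1)) p := by
  intro ho
  rw [perWord_decomp, occursAt_append, occursAt_append, occursAt_append] at ho
  obtain ⟨-, h1, h2, h3⟩ := ho
  rw [occursAt_reverse] at h1
  simp only [List.length_append, List.length_reverse, List.length_cons, List.length_nil,
    length_perWord] at h1 h2 h3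
  push_cast at h1 h2 h3
  set c : ℤ := p + 1 + (2 + 4 * k) with hc
  have hc2 : α c = 2 := (occursAt_cons.1 h2).1
  have hR : seqTake (fwd α (c + 1)) (4 * k) = perWord k := by
    rwa [OccursAt, length_perWord] at h3
  have hL : seqTake (bwd α (c - 1)) (2 + 4 * k) = [2, 2] ++ perWord k := h1
  rw [seqTake_add] at hL
  obtain ⟨hL1, hL2⟩ := List.append_inj hL (by simp)
  have e1 := abs_cfv_sub_perVal_le (hα.fwd _) hR
  have e2 := abs_cfv_sub_perVal_le ((hα.bwd (c - 1)).drop 2) hL2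
  have e3 := cfv_eq_of_seqTake (w := [2, 2]) (hα.bwd (c - 1)) hL1
  have e4 := abs_cfMap_sub_le (w := [2, 2]) (by simp [IsBin])
    (cfv_mem_Icc ((hα.bwd (c - 1)).drop 2).posSeq) perVal_mem_Icc
  have e5 : cfq [2, 2] = 5 := by simp [cfq]; norm_num
  have e6 := h c
  rw [hα.lambdaVal_eq, hc2, e3] at e6
  simp only [List.length_cons, List.length_nil] at e6
  rw [e5] at e4
  rw [plateauStart_eq] at hk
  rw [abs_le] at e1 e2
  have e7 : |cfv (shift (bwd α (c - 1)) 2) - perVal| / 5 ^ 2 ≤ (1 / 4) ^ k := by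
    rw [div_le_iff₀ (by norm_num)]
    nlinarith [abs_le.2 e2, pow_pos (show (0 : ℝ) < 1 / 4 by norm_num) k]
  have e8 := abs_le.1 (e4.trans e7)
  push_cast at e6
  norm_num at e6 e8 e1 hk
  linarith [e8.1, e1.1]

theorem dimFun_lt_of_lt {t : ℝ} (ht : t < 4 * Real.sqrt 30 / 7) : dimFun t < 2 * dimH K2 := by
  obtain ⟨k, hk⟩ : ∃ k : ℕ, 2 * (1 / 4 : ℝ) ^ k < 4 * Real.sqrt 30 / 7 - t := by
    obtain ⟨k, hk⟩ := exists_pow_lt_of_lt_one (show (0 : ℝ) < (4 * Real.sqrt 30 / 7 - t) / 2 by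
      linarith) (show (1 / 4 : ℝ) < 1 by norm_num)
    exact ⟨k, by linarith⟩
  set U := perWord (2 * k + 1) ++ [1] with hU
  set 𝓛 : Set (List ℕ) := goodWords ∩ avoiding U with h𝓛
  have hfc : FactorClosed 𝓛 := fun w hw u hu =>
    ⟨factorClosed_avoiding _ w hw.1 u hu, factorClosed_avoiding _ w hw.2 u hu⟩
  have hUb : IsBin U := isBin_append.2 ⟨isBin_perWord _, by simp [IsBin]⟩
  have hcode : ∃ n, levelSum 𝓛 critExp n < 1 := by
    by_contra! hall
    obtain ⟨σ', h1, h2, N, hN⟩ := exists_larger_exponent (g₀ := [1, 1, 2, 2])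
      (g₁ := [2, 2, 2, 2] ++ U ++ [2, 2, 2, 2]) (by simp [IsBin])
      (isBin_append.2 ⟨isBin_append.2 ⟨by simp [IsBin], hUb⟩, by simp [IsBin]⟩)
      critExp_nonneg critExp_lt_one hall
    have hU2 := perWord_append_avoiding_2222 (w := [1]) (by unfold avoiding; decide) rfl (2 * k + 1)
    have hdim := (le_dimH_cfv_of_code isWordMonoid_goodBlocks (fun u hu => ?_)
      (prefix_biUnion_markedWords hU2.2 (by simp) hU2.1 (fun w hw => hw.2))
      (critExp_nonneg.trans h1.le) h2 hN).trans (dimH_mono omegaGood_subset_K2)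
    · rw [← ofReal_critExp_half,
        ENNReal.ofReal_le_ofReal_iff (by linarith [critExp_nonneg])] at hdim
      linarith
    · obtain ⟨n, -, hu⟩ := Finset.mem_biUnion.1 hu
      obtain ⟨w, hw, hb, -, rfl⟩ := mem_markedWords.1 hu
      have e : [1, 1, 2, 2] ++ w ++ ([2, 2, 2, 2] ++ U ++ [2, 2, 2, 2]) =
          [1, 1, 2, 2] ++ (w ++ ([2, 2, 2, 2] ++ U)) ++ [2, 2, 2, 2] := by simp
      rw [e]
      refine marked_mem_blockWords (isBin_append.2 ⟨hb, isBin_append.2 ⟨by simp [IsBin], hUb⟩⟩)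
        (good_marked ?_)
      refine good_append_of_two_two hw.1 (good_append_of_suffix (by unfold goodWords avoiding; decide)
        (good_perWord_append (by unfold goodWords avoiding; decide) _) ⟨[2, 2], rfl⟩)
        ⟨[2, 2] ++ U, by simp⟩
  obtain ⟨n, hn⟩ := hcode
  have hlow : 1 ≤ levelSum 𝓛 0 n := by
    have hmem : List.replicate n 2 ∈ levelWords 𝓛 n := by
      refine mem_levelWords.2 ⟨⟨fun h => ?_, fun h => ?_⟩,
        fun d hd => Or.inr (List.eq_of_mem_replicate hd), by simp⟩
      · have := List.eq_of_mem_replicate (h.subset (by simp : 1 ∈ [1, 2, 1]))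
        omega
      · have := List.eq_of_mem_replicate (h.subset (by simp [hU] : 1 ∈ U))
        omega
    simp only [levelSum, neg_zero, Real.rpow_zero, Finset.sum_const, nsmul_eq_mul, mul_one]
    exact_mod_cast Finset.card_pos.2 ⟨_, hmem⟩
  have hn0 : 0 < n := by
    rcases Nat.eq_zero_or_pos n with rfl | h
    · have hnil : [] ∈ 𝓛 := ⟨by unfold goodWords avoiding; decide, by simp [avoiding, hU]⟩
      rw [levelSum_zero hnil] at hn
      exact absurd hn (lt_irrefl _)
    · exact h
  obtain ⟨σ, hσ, hσn⟩ := exists_lt_levelSum_lt_one hn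
  have hσ0 : 0 ≤ σ := by
    by_contra! hneg
    refine (hlow.trans (Finset.sum_le_sum fun w hw => ?_)).not_gt hσn
    exact Real.rpow_le_rpow_of_exponent_le (one_le_cfq (mem_levelWords.1 hw).2.1) (by linarith)
  rw [← ofReal_critExp]
  refine lt_of_le_of_lt ((dimH_mono ?_).trans (dimH_le_of_factors hfc hσ0 hn0 hσn))
    ((ENNReal.ofReal_lt_ofReal_iff (hσ0.trans_lt hσ)).2 hσ)
  intro x hx
  have hb := plateauStart_bounds
  obtain ⟨α, hα, hx', hle⟩ := exists_binBi_of_mem_markovSpectrum hx (by linarith)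
  have hxt : x < t := hx.2
  have hle' : ∀ j, lambdaVal α j ≤ t := fun j => (hle j).trans hxt.le
  have hcen : ∀ j, ¬ IsCentre α j := fun j hj => by
    have := le_lambdaVal_of_centre hα hj
    have := hle' j
    linarith
  have h121 := not_occursAt_of_no_centre hcen
  have hocc : ∀ p, ¬ OccursAt α U p := fun p hp =>
    not_occursAt_perWord hα hk hle' p (occursAt_append.1 hp).1
  refine ⟨α, hα, fun j m => ⟨seqTake_fwd_mem_avoiding h121 j m,
    seqTake_fwd_mem_avoiding hocc j m⟩, fun j m => ⟨seqTake_bwd_mem_avoiding h121 j m,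
    seqTake_bwd_mem_avoiding ?_ j m⟩, hx'⟩
  rwa [hU, reverse_perWord_append_one]

end belowPlateau

section plateauStart

variable {α : ℤ → ℕ}

theorem goodSeq_fwd (hα : BinBi α) (h : ∀ k, ¬ OccursAt α [1, 2, 1] k) (k : ℤ) :
    GoodSeq (fwd α k) := ⟨hα.fwd k, fun n => seqTake_fwd_mem_avoiding h k n⟩

theorem goodSeq_bwd (hα : BinBi α) (h : ∀ k, ¬ OccursAt α [1, 2, 1] k) (k : ℤ) :
    GoodSeq (bwd α k) :=
  ⟨hα.bwd k, fun n => seqTake_bwd_mem_avoiding (v := [1, 2, 1]) h k n⟩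

theorem GoodSeq.cfv_le_of_two {a : ℕ → ℕ} (h : GoodSeq a) (h2 : a 0 = 2) :
    cfv a ≤ cfMap [2, 2] perVal := by
  rw [cfv_eq h.1.posSeq, h2]
  have h1 := cfv_eq (h.drop 1).1.posSeq
  have h3 := ((h.drop 1).drop 1).tame.cfv_le
  have h4 := cfv_pos ((h.drop 1).drop 1).1.posSeq
  have h5 := cast_le_two_of_bin ((h.drop 1).1 0)
  have h6 := (h.drop 1).1.posSeq.one_le 0
  have h7 : 1 / (2 + perVal) ≤ cfv (shift a 1) := by
    rw [h1]
    exact one_div_le_one_div_of_le (by linarith) (by linarith)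
  have h8 := perVal_bounds
  have h9 : (0 : ℝ) < 1 / (2 + perVal) := by
    apply one_div_pos.2; linarith
  have e : cfMap [2, 2] perVal = 1 / (2 + 1 / (2 + perVal)) := by simp
  rw [e]
  push_cast
  exact one_div_le_one_div_of_le (by linarith) (by linarith)

/-- Bound for the local value in a sequence without `121`. -/
theorem lambdaVal_le_of_good (hα : BinBi α) (h : ∀ k, ¬ OccursAt α [1, 2, 1] k) {j : ℤ} {B : ℝ}
    (hB : B ≤ perVal) (h1 : cfv (fwd α (j + 1)) ≤ B)
    (h2 : cfv (bwd α (j - 1)) ≤ B) : lambdaVal α j ≤ 2 + B + cfMap [2, 2] perVal := by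
  have hb := perVal_bounds
  have hs := plateauStart_bounds.1
  rw [plateauStart_eq] at hs
  rw [hα.lambdaVal_eq]
  rcases hα j with hj | hj
  · rw [hj]; push_cast; linarith
  · rw [hj]
    push_cast
    rcases hα (j + 1) with hr | hr
    · rcases hα (j - 1) with hl | hl
      · refine absurd ?_ (h (j - 1))
        simp only [occursAt_cons, occursAt_nil, and_true]
        refine ⟨hl, ?_, ?_⟩
        · rwa [show j - 1 + 1 = j by ring]
        · rwa [show j - 1 + 1 + 1 = j + 1 by ring]
      · have := (goodSeq_bwd hα h (j - 1)).cfv_le_of_two (bwd_at hl (by simp))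
        linarith
    · have := (goodSeq_fwd hα h (j + 1)).cfv_le_of_two (fwd_at hr (by simp))
      linarith

theorem exists_seqTake_fwd_ne {B : ℤ} {K : ℕ}
    (hf : ∀ k ≥ B, seqTake (fwd α k) (4 * K) ≠ perWord K) (k : ℤ) :
    ∃ n, seqTake (fwd α k) (4 * (n + 1)) ≠ perWord (n + 1) := by
  by_contra! h
  set i := (B - k).toNat
  have h1 := h (i + K)
  rw [show 4 * (i + K + 1) = 4 * i + 4 * (K + 1) by ring, seqTake_add, add_assoc, perWord, wrep_add]
    at h1
  have h2 := (List.append_inj h1 (by simp [length_wrep, mul_comm])).2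
  rw [wrep_add, show 4 * (K + 1) = 4 * K + 4 by ring, seqTake_add] at h2
  have h3 := (List.append_inj h2 (by simp [length_wrep, mul_comm])).1
  rw [shift_fwd] at h3
  exact hf _ (by push_cast; omega) h3

theorem seqTake_bwd_ne {B : ℤ} {K : ℕ}
    (hf : ∀ k ≥ B, seqTake (fwd α k) (4 * K) ≠ perWord K) {k : ℤ} (hk : B + 4 * (K + 1) ≤ k) :
    seqTake (bwd α k) (4 * (K + 1)) ≠ perWord (K + 1) := by
  intro h
  have h1 : OccursAt α (perWord (K + 1)).reverse (k - 4 * (K + 1) + 1) := by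
    rw [occursAt_reverse, length_perWord]
    convert h using 3
    push_cast; ring
  have e : wrep [2, 2, 2, 1] (K + 1) = [2, 2, 2] ++ (perWord K ++ [1]) := by
    rw [perWord_append_one, wrep_succ]; rfl
  rw [reverse_perWord, e, occursAt_append, occursAt_append] at h1
  have h2 := h1.2.1
  rw [OccursAt, length_perWord] at h2
  exact hf _ (by simp; omega) h2

theorem cfv_fwd_lt (hα : BinBi α) (h : ∀ k, ¬ OccursAt α [1, 2, 1] k) {B : ℤ} {K : ℕ}
    (hf : ∀ k ≥ B, seqTake (fwd α k) (4 * K) ≠ perWord K) (k : ℤ) : cfv (fwd α k) < perVal := by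
  obtain ⟨n, hn⟩ := exists_seqTake_fwd_ne hf k
  exact ((goodSeq_fwd hα h k).tame.cfv_le_perBound hn).trans_lt (perBound_lt n)

theorem not_occursAt_reflect (h : ∀ k, ¬ OccursAt α [1, 2, 1] k) (k : ℤ) :
    ¬ OccursAt (reflect α) [1, 2, 1] k := by
  intro hk
  rw [OccursAt, fwd_reflect] at hk
  refine h (-k - 2) ?_
  have := (occursAt_reverse (α := α) (v := [1, 2, 1]) (k := -k - 2)).2
  refine this ?_
  convert hk using 3
  simp
  ring

theorem lambdaVal_lt_plateauStart (hα : BinBi α) (h : ∀ k, ¬ OccursAt α [1, 2, 1] k) {B : ℤ} {K : ℕ}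
    (hf : ∀ k ≥ B, seqTake (fwd α k) (4 * K) ≠ perWord K)
    (hb : ∀ k ≤ -B, seqTake (bwd α k) (4 * K) ≠ perWord K) (j : ℤ) :
    lambdaVal α j < 4 * Real.sqrt 30 / 7 := by
  have h1 := cfv_fwd_lt hα h hf (j + 1)
  have h2 : cfv (bwd α (j - 1)) < perVal := by
    have := cfv_fwd_lt hα.reflect (not_occursAt_reflect h) (B := B) (K := K)
      (fun k hk => by rw [fwd_reflect]; exact hb _ (by omega)) (-(j - 1))
    rwa [fwd_reflect, neg_neg] at this
  have h3 : max (cfv (fwd α (j + 1))) (cfv (bwd α (j - 1))) < perVal := max_lt h1 h2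
  have h4 := lambdaVal_le_of_good hα h h3.le (le_max_left _ _) (le_max_right _ _)
  rw [plateauStart_eq]
  linarith

theorem lambdaVal_le_of_far_right (hα : BinBi α) (h : ∀ k, ¬ OccursAt α [1, 2, 1] k) {B : ℤ} {K : ℕ}
    (hf : ∀ k ≥ B, seqTake (fwd α k) (4 * K) ≠ perWord K) {j : ℤ} (hj : B + 4 * (K + 1) < j) :
    lambdaVal α j ≤ 2 + perBound K + cfMap [2, 2] perVal := by
  refine lambdaVal_le_of_good hα h (perBound_lt K).le
    ((goodSeq_fwd hα h _).tame.cfv_le_perBound fun e => hf (j + 1) (by omega) ?_)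
    ((goodSeq_bwd hα h _).tame.cfv_le_perBound (seqTake_bwd_ne hf (by omega)))
  rw [show 4 * (K + 1) = 4 * K + 4 by ring, seqTake_add, perWord, wrep_add] at e
  exact (List.append_inj e (by simp [length_wrep, mul_comm])).1

theorem lambdaVal_le_of_far (hα : BinBi α) (h : ∀ k, ¬ OccursAt α [1, 2, 1] k) {B : ℤ} {K : ℕ}
    (hf : ∀ k ≥ B, seqTake (fwd α k) (4 * K) ≠ perWord K)
    (hb : ∀ k ≤ -B, seqTake (bwd α k) (4 * K) ≠ perWord K) {j : ℤ} (hj : B + 4 * (K + 1) < |j|) :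
    lambdaVal α j ≤ 2 + perBound K + cfMap [2, 2] perVal := by
  rcases lt_abs.1 hj with hj | hj
  · exact lambdaVal_le_of_far_right hα h hf hj
  · have := lambdaVal_le_of_far_right hα.reflect (not_occursAt_reflect h) (B := B) (K := K)
      (fun k hk => by rw [fwd_reflect]; exact hb _ (by omega)) hj
    rwa [lambdaVal_reflect_neg hα, neg_neg] at this

theorem goodSeq_seqApp {w : List ℕ} {a : ℕ → ℕ} (hb : IsBin w) (hw : w ∈ goodWords)
    (h2 : [2, 2] <:+ w) (ha : GoodSeq a) : GoodSeq (seqApp w a) := by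
  refine ⟨binSeq_append hb ha.1, fun n => ?_⟩
  refine factorClosed_avoiding _ _ (good_append_of_suffix hw (ha.2 n) h2) _ ?_
  have e : seqTake (seqApp w a) (w.length + n) = w ++ seqTake a n := by
    rw [seqTake_add, seqTake_seqApp, shift_seqApp]
  rw [← e, add_comm, seqTake_add]
  exact (List.prefix_append _ _).isInfix

theorem two_two_suffix_perWord (n : ℕ) : [2, 2] <:+ perWord (n + 1) := by
  rw [perWord, wrep_succ_right]
  exact ⟨wrep [1, 2, 2, 2] n ++ [1, 2], by simp⟩

theorem perWord_avoiding_2222 (m : ℕ) : ¬ [2, 2, 2, 2] <:+: perWord m :=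
  factorClosed_avoiding _ _ (perWord_append_avoiding_2222 (w := [1]) (by unfold avoiding; decide)
    rfl m).1 _ (List.prefix_append _ _).isInfix

theorem good_perWord (m : ℕ) : perWord m ∈ goodWords := by
  simpa using good_perWord_append (w := []) (by unfold goodWords avoiding; decide) m

theorem not_occursAt_glue {P Q : List ℕ} {a b : ℕ → ℕ} (hP : GoodSeq (seqApp P a))
    (hQ : GoodSeq (seqApp Q b)) (h0 : seqApp Q b 0 = 2) (h1 : seqApp Q b 1 = 2) (k : ℤ) :
    ¬ OccursAt (glue P Q a b) [1, 2, 1] k := by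
  intro hk
  rcases le_or_gt 0 k with h | h
  · lift k to ℕ using h
    rw [OccursAt, fwd_glue] at hk
    exact forall_seqTake_mem_avoiding.1 hP.2 k hk
  rcases le_or_gt k (-3) with h' | h'
  · obtain ⟨n, rfl⟩ : ∃ n : ℕ, k = -3 - n := ⟨(-3 - k).toNat, by omega⟩
    have := (occursAt_reverse (v := [1, 2, 1])).1 hk
    rw [show (-3 - n + ([1, 2, 1] : List ℕ).length - 1 : ℤ) = -1 - n by simp; ring, bwd_glue] at this
    exact forall_seqTake_mem_avoiding.1 hQ.2 n this
  · have hk1 := (occursAt_cons.1 hk).1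
    rcases (show k = -1 - (0 : ℕ) ∨ k = -1 - (1 : ℕ) by push_cast; omega) with rfl | rfl
    · rw [glue_neg] at hk1; omega
    · rw [glue_neg] at hk1; omega

theorem le_dimFun_plateauStart : 2 * dimH K2 ≤ dimFun (4 * Real.sqrt 30 / 7) := by
  rw [← ofReal_critExp]
  refine le_of_forall_lt fun c hc => ?_
  obtain ⟨σ, hσ0, hσ, hcσ⟩ : ∃ σ : ℝ, 0 ≤ σ ∧ σ < critExp ∧ c < ENNReal.ofReal σ := by
    obtain ⟨r, h1, h2⟩ := ENNReal.lt_iff_exists_nnreal_btwn.1 hc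
    refine ⟨r, r.coe_nonneg, ?_, by simpa using h1⟩
    rwa [← ENNReal.ofReal_coe_nnreal, ENNReal.ofReal_lt_ofReal_iff_of_nonneg r.coe_nonneg] at h2
  refine hcσ.trans_le ?_
  obtain ⟨n, hn⟩ := exists_level_weight (g₀ := [1, 1, 2, 2]) (g₁ := [2, 2, 2, 2])
    (by simp [IsBin]) (by simp [IsBin]) hσ0 hσ one_le_levelSum_critExp
  set K := n + 9 with hK
  set 𝓖 : Set (List ℕ) := goodWords ∩ avoiding (perWord K) with h𝓖
  have hshort : ∀ w : List ℕ, w.length < 4 * K → w ∈ avoiding (perWord K) := fun w hw h => by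
    have := h.length_le
    rw [length_perWord] at this
    omega
  have h𝓜 : IsWordMonoid (blockWords 𝓖) := by
    refine isWordMonoid_blockWords ⟨by unfold goodWords avoiding; decide, hshort _ (by simp; omega)⟩
      ⟨by unfold goodWords avoiding; decide, hshort _ (by simp; omega)⟩ fun u hu v hv h _ => ?_
    exact ⟨avoiding_append (e := [2, 2, 2, 2]) (by simp) (by decide) rfl hu.1 hv.1 h,
      avoiding_append (e := [2, 2, 2, 2]) (by simp) (perWord_avoiding_2222 K)
        (by rw [hK, perWord, wrep_succ]; rfl) hu.2 hv.2 h⟩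
  have hfc : FactorClosed 𝓖 := fun w hw u hu =>
    ⟨factorClosed_avoiding _ w hw.1 u hu, factorClosed_avoiding _ w hw.2 u hu⟩
  have hnil : [] ∈ 𝓖 := ⟨by unfold goodWords avoiding; decide, hshort _ (by simp; omega)⟩
  obtain ⟨m, hm⟩ : ∃ m : ℕ, 2 * (1 / 4 : ℝ) ^ (m + 1) < perVal - perBound K := by
    obtain ⟨m, hm⟩ := exists_pow_lt_of_lt_one (show (0 : ℝ) < (perVal - perBound K) / 2 by
      linarith [perBound_lt K]) (show (1 / 4 : ℝ) < 1 by norm_num)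
    refine ⟨m, ?_⟩
    rw [pow_succ]
    linarith [show (0 : ℝ) < (1 / 4) ^ m by positivity]
  set P := 2 :: perWord (m + 1) with hP
  set Q := [2, 2] ++ perWord (m + 1) with hQ
  have hPb : IsBin P := isBin_cons.2 ⟨by simp, isBin_perWord _⟩
  have hQb : IsBin Q := isBin_append.2 ⟨by simp [IsBin], isBin_perWord _⟩
  have hPg : P ∈ goodWords := by
    refine factorClosed_avoiding _ ([2, 2] ++ perWord (m + 1)) ?_ _ ⟨[2], [], by simp [hP]⟩
    exact good_append_of_suffix (by unfold goodWords avoiding; decide) (good_perWord _)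
      List.suffix_rfl
  have hQg : Q ∈ goodWords :=
    good_append_of_suffix (by unfold goodWords avoiding; decide) (good_perWord _) List.suffix_rfl
  set B : ℤ := P.length + Q.length + 1 with hB
  have key : ∀ a ∈ omegaSeqs (blockWords 𝓖), BinSeq a ∧ GoodSeq a ∧
      ∀ n, seqTake (shift a n) (4 * K) ≠ perWord K := fun a ha => by
    have hab := binSeq_of_mem_omegaSeqs h𝓜.bin ha
    have h1 := seqTake_mem_of_omegaSeqs hfc hnil ha
    refine ⟨hab, ⟨hab, fun n => (h1 n).1⟩, fun n => ?_⟩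
    have := forall_seqTake_mem_avoiding.1 (fun n => (h1 n).2) n
    rwa [length_perWord] at this
  have hno : ∀ a ∈ omegaSeqs (blockWords 𝓖), ∀ b ∈ omegaSeqs (blockWords 𝓖), ∀ k,
      ¬ OccursAt (glue P Q a b) [1, 2, 1] k := fun a ha b hb =>
    not_occursAt_glue
      (goodSeq_seqApp hPb hPg ((two_two_suffix_perWord m).trans (List.suffix_cons _ _))
        (key a ha).2.1)
      (goodSeq_seqApp hQb hQg ((two_two_suffix_perWord m).trans (List.suffix_append _ _))
        (key b hb).2.1)
      (by rw [seqApp_of_lt _ (by simp [hQ])]; simp [hQ])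
      (by rw [seqApp_of_lt _ (by simp [hQ])]; simp [hQ])
  have hf : ∀ a ∈ omegaSeqs (blockWords 𝓖), ∀ b, ∀ k ≥ B,
      seqTake (fwd (glue P Q a b) k) (4 * K) ≠ perWord K := fun a ha b k hk => by
    obtain ⟨i, rfl⟩ : ∃ i : ℕ, k = (P.length + i : ℕ) := ⟨(k - P.length).toNat, by omega⟩
    rw [fwd_glue, ← shift_shift, shift_seqApp]
    exact (key a ha).2.2 i
  have hb : ∀ a, ∀ b ∈ omegaSeqs (blockWords 𝓖), ∀ k ≤ -B,
      seqTake (bwd (glue P Q a b) k) (4 * K) ≠ perWord K := fun a b hb k hk => by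
    obtain ⟨i, rfl⟩ : ∃ i : ℕ, k = -1 - (Q.length + i : ℕ) := ⟨(-1 - k - Q.length).toNat, by omega⟩
    rw [bwd_glue, ← shift_shift, shift_seqApp]
    exact (key b hb).2.2 i
  refine le_dimFun_of_centre h𝓜 (fun u hu => ?_) prefix_markedWords hσ0 (hσ.trans critExp_lt_one) hn
    hPb hQb (J := Finset.Icc (-(B + 4 * (K + 1))) (B + 4 * (K + 1))) ⟨0, ?_⟩
    (fun a ha b hb' j _ => ?_) fun a ha b hb' j => ?_
  · obtain ⟨w, hw, hwb, hl, rfl⟩ := mem_markedWords.1 hu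
    exact marked_mem_blockWords hwb ⟨good_marked hw, hshort _ (by simp; omega)⟩
  · rw [Finset.mem_Icc]; omega
  · exact lambdaVal_lt_plateauStart (binBi_glue hPb hQb (key a ha).1 (key b hb').1) (hno a ha b hb')
      (hf a ha b) (hb a b hb') j
  · by_cases hj : |j| ≤ B + 4 * (K + 1)
    · exact ⟨j, Finset.mem_Icc.2 (abs_le.1 hj), le_rfl⟩
    · refine ⟨0, by rw [Finset.mem_Icc]; omega, ?_⟩
      refine (lambdaVal_le_of_far (binBi_glue hPb hQb (key a ha).1 (key b hb').1) (hno a ha b hb')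
        (hf a ha b) (hb a b hb') (not_le.1 hj)).trans ?_
      rw [hP, lambdaVal_glue_zero hPb hQb (key a ha).1 (key b hb').1, hQ, cfMap_append]
      have ca := cfv_mem_Icc (key a ha).1.posSeq
      have cb := cfv_mem_Icc (key b hb').1.posSeq
      have h1 := abs_cfMap_perWord_sub_le (m + 1) ca perVal_mem_Icc
      have h2 := abs_cfMap_perWord_sub_le (m + 1) cb perVal_mem_Icc
      have h3 := abs_cfMap_sub_le (w := [2, 2]) (by simp [IsBin])
        (cfMap_mem_Icc (isBin_perWord (m + 1)) cb) perVal_mem_Icc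
      have h4 : cfq [2, 2] = 5 := by simp [cfq]; norm_num
      rw [h4] at h3
      rw [cfMap_perWord_perVal] at h1 h2
      have h5 : |cfMap (perWord (m + 1)) (cfv b) - perVal| / 5 ^ 2 ≤ (1 / 4) ^ (m + 1) := by
        rw [div_le_iff₀ (by norm_num)]
        nlinarith [abs_nonneg (cfMap (perWord (m + 1)) (cfv b) - perVal)]
      have h6 := (abs_le.1 (h3.trans h5)).1
      have h7 := (abs_le.1 h1).1
      push_cast
      linarith

end plateauStart

section twinWords

/-- The word `(2221)ᵐ 121121 (1222)ᵐ`. -/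
def twinWord (m : ℕ) : List ℕ := wrep [2, 2, 2, 1] m ++ ([1, 2, 1] ++ ([1, 2, 1] ++ perWord m))

theorem length_twinWord (m : ℕ) : (twinWord m).length = 8 * m + 6 := by
  simp [twinWord, length_wrep]; ring

theorem twinWord_eq_left (m : ℕ) :
    twinWord m = ([1] ++ perWord m).reverse ++ ([2] ++ ([1, 1, 2, 1] ++ perWord m)) := by
  simp only [twinWord, List.reverse_append, reverse_perWord]; simp

theorem twinWord_eq_right (m : ℕ) :
    twinWord m = ([1, 1, 2, 1] ++ perWord m).reverse ++ ([2] ++ ([1] ++ perWord m)) := by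
  simp only [twinWord, List.reverse_append, reverse_perWord]; simp

theorem reverse_twinWord (m : ℕ) : (twinWord m).reverse = twinWord m := by
  conv_lhs => rw [twinWord_eq_left]
  rw [twinWord_eq_right]
  simp

/-- The words in which every `121` belongs to a factor `twinWord m`. -/
def twinWords (m : ℕ) : Set (List ℕ) :=
  {w | ∀ l r, w = l ++ ([1, 2, 1] ++ r) →
    (wrep [2, 2, 2, 1] m <:+ l ∧ [1, 2, 1] ++ perWord m <+: r) ∨
      (wrep [2, 2, 2, 1] m ++ [1, 2, 1] <:+ l ∧ perWord m <+: r)}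

variable {m : ℕ}

theorem twinWords_of_good {w : List ℕ} (h : w ∈ goodWords) : w ∈ twinWords m :=
  fun l r e => absurd ⟨l, r, by rw [e, List.append_assoc]⟩ h

theorem twinWords_append {u v : List ℕ} (hu : u ∈ twinWords m) (hv : v ∈ twinWords m)
    (h : [2, 2] <:+ u) : u ++ v ∈ twinWords m := by
  intro l r e
  rcases List.append_eq_append_iff.1 e with ⟨x, rfl, hx⟩ | ⟨x, rfl, hx⟩
  · exact (hv x r hx).imp (fun h => ⟨h.1.trans (List.suffix_append _ _), h.2⟩)
      (fun h => ⟨h.1.trans (List.suffix_append _ _), h.2⟩)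
  · obtain ⟨s, hs⟩ := h
    rcases x with _ | ⟨b, _ | ⟨c, _ | ⟨d, x⟩⟩⟩
    · exact (hv [] r hx.symm).imp (fun h => ⟨h.1.trans List.nil_suffix, h.2⟩)
        (fun h => ⟨h.1.trans List.nil_suffix, h.2⟩)
    · have h1 := (List.append_inj' (s₁ := s ++ [2]) (t₁ := [2]) (s₂ := l) (t₂ := [b])
        (by simpa using hs) rfl).2
      simp at hx h1
      omega
    · have h1 := (List.append_inj' hs rfl).2
      simp at hx h1
      omega
    · simp only [List.cons_append, List.nil_append, List.cons.injEq] at hx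
      obtain ⟨rfl, rfl, rfl, rfl⟩ := hx
      exact (hu l x rfl).imp (fun h => ⟨h.1, h.2.trans (List.prefix_append _ _)⟩)
        (fun h => ⟨h.1, h.2.trans (List.prefix_append _ _)⟩)

theorem isWordMonoid_twinBlocks (m : ℕ) : IsWordMonoid (blockWords (twinWords m)) :=
  isWordMonoid_blockWords (twinWords_of_good (by unfold goodWords avoiding; decide))
    (twinWords_of_good (by unfold goodWords avoiding; decide))
    fun _ hu _ hv h _ => twinWords_append hu hv (List.IsSuffix.trans ⟨[2, 2], rfl⟩ h)

theorem seqTake_shift_of_eq {a : ℕ → ℕ} {N : ℕ} {s w t : List ℕ} (h : seqTake a N = s ++ w ++ t) :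
    seqTake (shift a s.length) w.length = w := by
  have hl := congrArg List.length h
  simp only [List.length_append, length_seqTake] at hl
  rw [hl, seqTake_add, seqTake_add] at h
  exact (List.append_inj (List.append_inj h (by simp)).1 (by simp)).2

theorem exists_twinWord {a : ℕ → ℕ} (ha : a ∈ omegaSeqs (twinWords m)) {n : ℕ}
    (h : seqTake (shift a n) 3 = [1, 2, 1]) :
    ∃ k, seqTake (shift a k) (8 * m + 6) = twinWord m ∧ (n = k + 4 * m ∨ n = k + 4 * m + 3) := by
  obtain ⟨N, hN, hmem⟩ := ha (n + 3)
  obtain ⟨i, rfl⟩ := Nat.exists_eq_add_of_le hN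
  have e : seqTake a (n + 3 + i) =
      seqTake a n ++ ([1, 2, 1] ++ seqTake (shift a (n + 3)) i) := by
    rw [seqTake_add, seqTake_add, h, List.append_assoc]
  rw [← length_twinWord]
  rcases hmem _ _ e with ⟨⟨l, hl⟩, ⟨r, hr⟩⟩ | ⟨⟨l, hl⟩, ⟨r, hr⟩⟩
  · have h1 : seqTake a (n + 3 + i) = l ++ twinWord m ++ r := by
      rw [e, ← hl, ← hr]; simp [twinWord]
    refine ⟨_, seqTake_shift_of_eq h1, Or.inl ?_⟩
    have := congrArg List.length hl
    simp [length_wrep] at this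
    omega
  · have h1 : seqTake a (n + 3 + i) = l ++ twinWord m ++ r := by
      rw [e, ← hl, ← hr]; simp [twinWord]
    refine ⟨_, seqTake_shift_of_eq h1, Or.inr ?_⟩
    have := congrArg List.length hl
    simp [length_wrep] at this
    omega

theorem seqApp_mem_omega_twinWords {P : List ℕ} (hP : P ∈ twinWords m) (h2 : [2, 2] <:+ P)
    {a : ℕ → ℕ} (ha : a ∈ omegaSeqs (blockWords (twinWords m))) :
    seqApp P a ∈ omegaSeqs (twinWords m) := by
  intro n
  obtain ⟨k, hk, h⟩ := ha n
  refine ⟨P.length + k, by omega, ?_⟩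
  rw [seqTake_add, seqTake_seqApp, shift_seqApp]
  rcases h with h | h
  · rwa [h, List.append_nil]
  · exact twinWords_append hP h.2.2.2 h2

/-- The word `1 (2221)ᵐ 121121 (1222)ᵐ 1`. -/
def twinMark (m : ℕ) : List ℕ :=
  perWord m ++ ([1, 1, 2, 1, 1, 2, 1] ++ (perWord m ++ [1]))

theorem isBin_twinMark (m : ℕ) : IsBin (twinMark m) :=
  isBin_append.2 ⟨isBin_perWord m, isBin_append.2 ⟨by simp [IsBin],
    isBin_append.2 ⟨isBin_perWord m, by simp [IsBin]⟩⟩⟩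

theorem twinMark_avoiding_2222 (m : ℕ) :
    twinMark m ∈ avoiding [2, 2, 2, 2] ∧ (twinMark m).head? = some 1 := by
  have h := perWord_append_avoiding_2222 (w := [1]) (by unfold avoiding; decide) rfl m
  exact perWord_append_avoiding_2222 (avoiding_2222_append (by unfold avoiding; decide) h.1 h.2) rfl m

theorem twinMark_append_mem (m : ℕ) : twinMark m ++ [2, 2, 2, 2] ∈ twinWords m := by
  set X := perWord m ++ [1] with hX
  set Z := perWord m ++ [1, 2, 2, 2, 2] with hZ
  have hXg : X ∈ goodWords := good_perWord_append (by unfold goodWords avoiding; decide) m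
  have hZg : Z ∈ goodWords := good_perWord_append (by unfold goodWords avoiding; decide) m
  have hZ1 : Z.head? = some 1 := by
    rw [hZ]; cases m <;> simp [perWord, wrep_succ]
  have e : twinMark m ++ [2, 2, 2, 2] = X ++ ([1, 2, 1, 1, 2, 1] ++ Z) := by
    simp [twinMark, hX, hZ]
  have hXs : wrep [2, 2, 2, 1] m <:+ X := by
    rw [hX, perWord_append_one]; exact List.suffix_cons _ _
  have hZp : perWord m <+: Z := List.prefix_append _ _
  intro l r h
  rw [e] at h
  rcases List.append_eq_append_iff.1 h with ⟨x, rfl, hx⟩ | ⟨x, hl, hx⟩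
  · rcases x with _ | ⟨b, _ | ⟨c, _ | ⟨d, _ | ⟨b', _ | ⟨c', _ | ⟨d', x⟩⟩⟩⟩⟩⟩ <;>
      simp only [List.cons_append, List.nil_append, List.cons.injEq] at hx
    · left
      obtain ⟨-, -, -, rfl⟩ := hx
      rw [List.append_nil]
      exact ⟨hXs, by simpa using hZp⟩
    · omega
    · omega
    · right
      obtain ⟨rfl, rfl, rfl, -, -, -, rfl⟩ := hx
      obtain ⟨s, hs⟩ := hXs
      exact ⟨⟨s, by rw [← hs]; simp⟩, hZp⟩
    · omega
    · rw [hx.2.2.2.2.2.2] at hZ1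
      simp at hZ1
    · exact absurd ⟨x, r, by rw [hx.2.2.2.2.2.2]; simp⟩ hZg
  · rcases x with _ | ⟨b, _ | ⟨c, _ | ⟨d, x⟩⟩⟩ <;>
      simp only [List.cons_append, List.nil_append, List.cons.injEq] at hx
    · left
      obtain ⟨-, -, -, rfl⟩ := hx
      rw [List.append_nil] at hl
      exact ⟨hl ▸ hXs, by simpa using hZp⟩
    · omega
    · have h1 := (List.append_inj' (s₁ := perWord m) (t₁ := [1]) (s₂ := l ++ [b]) (t₂ := [c])
        (by rw [← hX, hl]; simp) rfl).2
      simp at h1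
      omega
    · obtain ⟨rfl, rfl, rfl, -⟩ := hx
      exact absurd ⟨l, x, by rw [hl]; simp⟩ hXg

end twinWords

section abovePlateau

variable {α : ℤ → ℕ}

theorem lambdaVal_of_occursAt (hα : BinBi α) {u v : List ℕ} {p : ℤ}
    (h : OccursAt α (u.reverse ++ ([2] ++ v)) p) :
    lambdaVal α (p + u.length) = 2 + cfMap v (cfv (fwd α (p + u.length + 1 + v.length))) +
      cfMap u (cfv (bwd α (p - 1))) := by
  rw [occursAt_append, occursAt_append] at h
  obtain ⟨h1, h2, h3⟩ := h
  rw [occursAt_reverse] at h1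
  rw [List.length_reverse] at h2 h3
  have h3' : seqTake (fwd α (p + u.length + 1)) v.length = v := h3
  rw [hα.lambdaVal_eq, (occursAt_cons.1 h2).1, cfv_eq_of_seqTake (hα.fwd _) h3',
    cfv_eq_of_seqTake (hα.bwd _) h1, shift_fwd, shift_bwd,
    show p + u.length - 1 - u.length = p - 1 by ring]
  rfl

theorem lambdaVal_of_twinWord (hα : BinBi α) {m : ℕ} {p : ℤ} (h : OccursAt α (twinWord m) p) :
    lambdaVal α (p + 4 * m + 1) = 2 + cfMap ([1, 1, 2, 1] ++ perWord m)
        (cfv (fwd α (p + 8 * m + 6))) + cfMap ([1] ++ perWord m) (cfv (bwd α (p - 1))) ∧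
      lambdaVal α (p + 4 * m + 4) = 2 + cfMap ([1] ++ perWord m)
        (cfv (fwd α (p + 8 * m + 6))) +
          cfMap ([1, 1, 2, 1] ++ perWord m) (cfv (bwd α (p - 1))) := by
  have e1 : ((([1] ++ perWord m : List ℕ).length : ℕ) : ℤ) = 4 * m + 1 := by
    simp only [List.length_append, length_perWord, List.length_cons, List.length_nil]
    push_cast; ring
  have e2 : ((([1, 1, 2, 1] ++ perWord m : List ℕ).length : ℕ) : ℤ) = 4 * m + 4 := by
    simp only [List.length_append, length_perWord, List.length_cons, List.length_nil]
    push_cast; ring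
  have h1 := lambdaVal_of_occursAt hα (twinWord_eq_left m ▸ h)
  have h2 := lambdaVal_of_occursAt hα (twinWord_eq_right m ▸ h)
  rw [e1, e2] at h1 h2
  rw [show p + (4 * m + 1 : ℤ) = p + 4 * m + 1 by ring,
    show p + 4 * m + 1 + 1 + (4 * m + 4 : ℤ) = p + 8 * m + 6 by ring] at h1
  rw [show p + (4 * m + 4 : ℤ) = p + 4 * m + 4 by ring,
    show p + 4 * m + 4 + 1 + (4 * m + 1 : ℤ) = p + 8 * m + 6 by ring] at h2
  exact ⟨h1, h2⟩

theorem abs_cfMap_append_perWord_sub_le {w : List ℕ} (hw : IsBin w) (m : ℕ) {x : ℝ}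
    (hx : x ∈ Icc (0 : ℝ) 1) : |cfMap (w ++ perWord m) x - cfMap w perVal| ≤ (1 / 4) ^ m := by
  rw [cfMap_append]
  refine (abs_cfMap_sub_le hw (cfMap_mem_Icc (isBin_perWord m) hx) perVal_mem_Icc).trans ?_
  have h1 := abs_cfMap_perWord_sub_le m hx perVal_mem_Icc
  rw [cfMap_perWord_perVal] at h1
  have h2 := one_le_cfq hw
  refine (div_le_self (abs_nonneg _) ?_).trans h1
  nlinarith

theorem lambdaVal_le_of_twinWord (hα : BinBi α) {m : ℕ} {p : ℤ} (h : OccursAt α (twinWord m) p) :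
    lambdaVal α (p + 4 * m + 1) ≤ (16351 + 720 * Real.sqrt 30) / 6409 + 2 * (1 / 4) ^ m ∧
      lambdaVal α (p + 4 * m + 4) ≤ (16351 + 720 * Real.sqrt 30) / 6409 + 2 * (1 / 4) ^ m := by
  rw [plateauEnd_eq]
  have hI : ∀ k, cfv (fwd α k) ∈ Icc (0 : ℝ) 1 := fun k => cfv_mem_Icc (hα.fwd k).posSeq
  have hI' : ∀ k, cfv (bwd α k) ∈ Icc (0 : ℝ) 1 := fun k => cfv_mem_Icc (hα.bwd k).posSeq
  have b1 : IsBin [1] := by simp [IsBin]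
  have b2 : IsBin [1, 1, 2, 1] := by simp [IsBin]
  obtain ⟨h1, h2⟩ := lambdaVal_of_twinWord hα h
  have h3 := (abs_le.1 (abs_cfMap_append_perWord_sub_le b1 m (hI' (p - 1)))).2
  have h4 := (abs_le.1 (abs_cfMap_append_perWord_sub_le b2 m (hI (p + 8 * m + 6)))).2
  have h5 := (abs_le.1 (abs_cfMap_append_perWord_sub_le b2 m (hI' (p - 1)))).2
  have h6 := (abs_le.1 (abs_cfMap_append_perWord_sub_le b1 m (hI (p + 8 * m + 6)))).2
  constructor <;> linarith

/-- One of the two centres of a twin word has a large local value if the word is continued by `2` on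
both sides. -/
theorem le_lambdaVal_of_twinWord (hα : BinBi α) {m : ℕ} {p : ℤ} (h : OccursAt α (twinWord m) p)
    (hr : α (p + 8 * m + 6) = 2) (hl : α (p - 1) = 2) :
    (16351 + 720 * Real.sqrt 30) / 6409 + (perVal - cfMap (perWord m) (1 / 2)) / 5 ≤
      max (lambdaVal α (p + 4 * m + 1)) (lambdaVal α (p + 4 * m + 4)) := by
  obtain ⟨h1, h2⟩ := lambdaVal_of_twinWord hα h
  rw [cfMap_append, cfMap_append] at h1 h2
  have hp := perVal_bounds
  have key : ∀ a, BinSeq a → a 0 = 2 → cfMap (perWord m) (cfv a) ∈ Icc (0 : ℝ) 1 ∧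
      cfMap (perWord m) (cfv a) ≤ cfMap (perWord m) (1 / 2) := fun a ha h0 => by
    have hc := cfv_mem_Icc ha.posSeq
    refine ⟨cfMap_mem_Icc (isBin_perWord m) hc, ?_⟩
    exact cfMap_le_of_even (isBin_perWord m) (even_length_perWord m) hc (by norm_num)
      ((cfv_le_of_two ha h0).trans (by norm_num))
  have hhalf : cfMap (perWord m) (1 / 2) ≤ perVal := by
    conv_rhs => rw [← cfMap_perWord_perVal m]
    exact cfMap_le_of_even (isBin_perWord m) (even_length_perWord m) (by norm_num) perVal_mem_Icc
      (by linarith)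
  obtain ⟨k1, k2⟩ := key _ (hα.fwd (p + 8 * m + 6)) (fwd_at hr (by simp))
  obtain ⟨k3, k4⟩ := key _ (hα.bwd (p - 1)) (bwd_at hl (by simp))
  rw [plateauEnd_eq]
  rcases le_total (cfMap (perWord m) (cfv (fwd α (p + 8 * m + 6))))
    (cfMap (perWord m) (cfv (bwd α (p - 1)))) with hle | hle
  · have := cfMap_pair_ge k1 k3 hle (k4.trans hhalf)
    refine le_trans ?_ (le_max_right _ _)
    linarith
  · have := cfMap_pair_ge k3 k1 hle (k2.trans hhalf)
    refine le_trans ?_ (le_max_left _ _)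
    linarith

theorem eq_one_of_twinWord {m : ℕ} {p : ℤ} (h : OccursAt α (twinWord (m + 1)) p) :
    α (p + 4 * (m + 1) - 1) = 1 ∧ α (p + 4 * (m + 1) + 2) = 1 ∧ α (p + 4 * (m + 1) + 3) = 1 ∧
      α (p + 4 * (m + 1) + 6) = 1 := by
  have e : twinWord (m + 1) = wrep [2, 2, 2, 1] m ++ ([2, 2, 2, 1, 1, 2, 1, 1, 2, 1, 1] ++
      ([2, 2, 2] ++ perWord m)) := by
    rw [twinWord, wrep_succ_right, perWord, wrep_succ]; simp
  rw [e, occursAt_append, occursAt_append] at h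
  have h1 := h.2.1
  simp only [occursAt_cons, length_wrep, List.length_cons, List.length_nil] at h1
  push_cast at h1
  obtain ⟨-, -, -, h4, -, -, h5, h6, -, -, h7, -⟩ := h1
  refine ⟨?_, ?_, ?_, ?_⟩
  · convert h4 using 2; ring
  · convert h5 using 2; ring
  · convert h6 using 2; ring
  · convert h7 using 2; ring

theorem cfv_le_of_not_121 {a : ℕ → ℕ} (ha : BinSeq a) (h : ¬(a 0 = 1 ∧ a 1 = 2 ∧ a 2 = 1)) :
    cfv a ≤ 17 / 24 := by
  rcases ha 0 with e0 | e0
  · rcases ha 1 with e1 | e1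
    · exact (cfv_mem_of_even ha (w := [1, 1]) (by simp [seqTake, List.range_succ, e0, e1])
        (by decide)).2.trans (by norm_num)
    · have e2 := (ha 2).resolve_left fun e2 => h ⟨e0, e1, e2⟩
      exact (cfv_mem_of_odd ha (w := [1, 2, 2]) (by simp [seqTake, List.range_succ, e0, e1, e2])
        (by decide)).2.trans (by norm_num)
  · exact (cfv_le_of_two ha e0).trans (by norm_num)

/-- Local values away from `121`, if every `121` is surrounded by `1`s. -/
theorem lambdaVal_lt_of_not_centre (hα : BinBi α)
    (hone : ∀ c, IsCentre α c → α (c - 2) = 1 ∧ α (c + 2) = 1) {j : ℤ} (hj : ¬ IsCentre α j) :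
    lambdaVal α j < (16351 + 720 * Real.sqrt 30) / 6409 := by
  have ht : 3.14 < (16351 + 720 * Real.sqrt 30) / 6409 := by
    have := sqrt30_bounds
    rw [lt_div_iff₀ (by norm_num)]
    linarith
  refine lt_trans ?_ ht
  rw [hα.lambdaVal_eq]
  have m1 := (cfv_mem_binHull (hα.fwd (j + 1))).2
  have m2 := (cfv_mem_binHull (hα.bwd (j - 1))).2
  rcases hα j with h | h
  · rw [h]; push_cast; linarith
  have hr : cfv (fwd α (j + 1)) ≤ 17 / 24 := by
    refine cfv_le_of_not_121 (hα.fwd _) ?_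
    simp only [fwd]
    rintro ⟨h0, h1, h2⟩
    have := (hone (j + 2) ⟨?_, ?_, ?_⟩).1
    · rw [show j + 2 - 2 = j by ring] at this; omega
    · convert h0 using 2; push_cast; ring
    · convert h1 using 2; push_cast; ring
    · convert h2 using 2; push_cast; ring
  have hl : cfv (bwd α (j - 1)) ≤ 17 / 24 := by
    refine cfv_le_of_not_121 (hα.bwd _) ?_
    simp only [bwd]
    rintro ⟨h0, h1, h2⟩
    have := (hone (j - 2) ⟨?_, ?_, ?_⟩).2
    · rw [show j - 2 + 2 = j by ring] at this; omega
    · convert h2 using 2; push_cast; ring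
    · convert h1 using 2; push_cast; ring
    · convert h0 using 2; push_cast; ring
  rw [h]
  push_cast
  rcases hα (j + 1) with h1 | h1
  · rcases hα (j - 1) with h2 | h2
    · exact absurd ⟨h2, h, h1⟩ hj
    · have := cfv_le_of_two (hα.bwd (j - 1)) (bwd_at h2 (by simp))
      linarith
  · have := cfv_le_of_two (hα.fwd (j + 1)) (fwd_at h1 (by simp))
    linarith

end abovePlateau

section twinGlue

/-- The word `1 (1222)ⁿ⁺¹ 2222`. -/
def twinTail (n : ℕ) : List ℕ := [1, 1, 2, 2, 2] ++ (perWord n ++ [2, 2, 2, 2])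

theorem isBin_twinTail (n : ℕ) : IsBin (twinTail n) :=
  isBin_append.2 ⟨by simp [IsBin], isBin_append.2 ⟨isBin_perWord n, by simp [IsBin]⟩⟩

theorem append_twinTail_good {u : List ℕ} (hu : u ++ [1, 1, 2, 2, 2] ∈ goodWords) (n : ℕ) :
    u ++ twinTail n ∈ goodWords := by
  rw [twinTail, ← List.append_assoc]
  exact good_append_of_suffix hu (good_perWord_append (by unfold goodWords avoiding; decide) n)
    (List.IsSuffix.trans ⟨[1, 1, 2], rfl⟩ (List.suffix_append _ _))

theorem two_two_suffix_twinTail (u : List ℕ) (n : ℕ) : [2, 2] <:+ u ++ twinTail n :=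
  ⟨u ++ ([1, 1, 2, 2, 2] ++ (perWord n ++ [2, 2])), by simp [twinTail]⟩

theorem occursAt_glue (P Q : List ℕ) (a b : ℕ → ℕ) :
    OccursAt (glue P Q a b) (Q.reverse ++ P) (-Q.length) := by
  rw [occursAt_append, occursAt_reverse, List.length_reverse, OccursAt]
  constructor
  · rw [show -(Q.length : ℤ) + Q.length - 1 = -1 - (0 : ℕ) by simp, bwd_glue, shift_zero,
      seqTake_seqApp]
  · rw [show -(Q.length : ℤ) + Q.length = (0 : ℕ) by simp, fwd_glue, shift_zero, seqTake_seqApp]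

/-- A bi-infinite sequence with a twin word around the origin. -/
abbrev twinGlue (n : ℕ) (a b : ℕ → ℕ) : ℤ → ℕ :=
  glue ([2] ++ twinTail n) ([1, 1, 2] ++ twinTail n) a b

theorem occursAt_twinGlue (n : ℕ) (a b : ℕ → ℕ) :
    OccursAt (twinGlue n a b) (twinWord (n + 1)) (-8 - 4 * n) ∧ twinGlue n a b (-9 - 4 * n) = 2 ∧
      twinGlue n a b (4 * n + 6) = 2 := by
  have h := occursAt_glue ([2] ++ twinTail n) ([1, 1, 2] ++ twinTail n) a b
  have e : ([1, 1, 2] ++ twinTail n).reverse ++ ([2] ++ twinTail n) =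
      [2, 2, 2] ++ ([2] ++ (twinWord (n + 1) ++ [2, 2, 2, 2])) := by
    rw [twinWord_eq_right, perWord, wrep_succ, twinTail]
    simp
  have hl : (([1, 1, 2] ++ twinTail n : List ℕ).length : ℤ) = 4 * n + 12 := by
    simp only [twinTail, List.length_append, length_perWord, List.length_cons, List.length_nil]
    push_cast
    ring
  rw [e, hl, occursAt_append, occursAt_append, occursAt_append, length_twinWord] at h
  simp only [List.length_cons, List.length_nil] at h
  push_cast at h
  obtain ⟨-, h1, h2, h3⟩ := h
  refine ⟨?_, ?_, ?_⟩
  · convert h2 using 1; ring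
  · convert (occursAt_cons.1 h1).1 using 2; ring
  · convert (occursAt_cons.1 h3).1 using 2; ring

variable {m n : ℕ} {a b : ℕ → ℕ}

theorem IsCentre.occursAt {α : ℤ → ℕ} {j : ℤ} (h : IsCentre α j) : OccursAt α [1, 2, 1] (j - 1) := by
  refine occursAt_cons.2 ⟨h.1, occursAt_cons.2 ⟨?_, occursAt_cons.2 ⟨?_, rfl⟩⟩⟩
  · rw [sub_add_cancel]; exact h.2.1
  · rw [sub_add_cancel]; exact h.2.2

theorem twinGlue_centre (ha : a ∈ omegaSeqs (blockWords (twinWords m)))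
    (hb : b ∈ omegaSeqs (blockWords (twinWords m))) {j : ℤ} (hj : IsCentre (twinGlue n a b) j) :
    j = 0 ∨ j = -3 ∨ ∃ p, OccursAt (twinGlue n a b) (twinWord m) p ∧
      (j = p + 4 * m + 1 ∨ j = p + 4 * m + 4) := by
  have hocc := hj.occursAt
  rcases lt_or_ge 0 j with h0 | h0
  · right; right
    obtain ⟨i, hi⟩ : ∃ i : ℕ, j - 1 = i := ⟨(j - 1).toNat, by omega⟩
    rw [hi, OccursAt, fwd_glue] at hocc
    obtain ⟨k, hk, hik⟩ := exists_twinWord (seqApp_mem_omega_twinWords (twinWords_of_good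
      (append_twinTail_good (by unfold goodWords avoiding; decide) n))
      (two_two_suffix_twinTail _ n) ha) hocc
    refine ⟨k, ?_, by omega⟩
    rwa [OccursAt, fwd_glue, length_twinWord]
  rcases lt_or_ge j (-4) with h4 | h4
  · right; right
    have hs : ∀ i : ℕ, bwd (twinGlue n a b) (-4 - i) = shift (seqApp ([] ++ twinTail n) b) i :=
      fun i => by
        have := shift_seqApp [1, 1, 2] (seqApp (twinTail n) b)
        rw [List.nil_append, ← this, shift_shift, ← seqApp_append, ← bwd_glue ([2] ++ twinTail n) _ a]
        congr 1
        simp only [List.length_cons, List.length_nil]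
        push_cast
        ring
    obtain ⟨i, hi⟩ : ∃ i : ℕ, j + 1 = -4 - i := ⟨(-5 - j).toNat, by omega⟩
    have hocc' := occursAt_reverse (v := [1, 2, 1]).1 hocc
    rw [show j - 1 + (([1, 2, 1] : List ℕ).length : ℕ) - 1 = -4 - i by
      rw [← hi]; simp only [List.length_cons, List.length_nil]; push_cast; ring, hs] at hocc'
    obtain ⟨k, hk, hik⟩ := exists_twinWord (seqApp_mem_omega_twinWords (twinWords_of_good
      (append_twinTail_good (by unfold goodWords avoiding; decide) n))
      (two_two_suffix_twinTail _ n) hb) hocc'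
    refine ⟨-9 - 8 * m - k, ?_, by omega⟩
    rw [← reverse_twinWord, occursAt_reverse, length_twinWord,
      show (-9 - 8 * m - k + (8 * m + 6 : ℕ) - 1 : ℤ) = -4 - k by push_cast; ring, hs, hk]
  · have h2 := hj.2.1
    have hv : ∀ i : ℕ, i < 4 → i ≠ 2 → twinGlue n a b (-1 - i) = 1 := fun i hi hi' => by
      rw [twinGlue, glue_neg, seqApp_of_lt _ (by simp [twinTail]; omega)]
      interval_cases i <;> simp_all [twinTail]
    have e1 := hv 0
    have e2 := hv 1
    have e4 := hv 3
    norm_num at e1 e2 e4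
    obtain rfl | rfl | rfl | rfl | rfl : j = 0 ∨ j = -1 ∨ j = -2 ∨ j = -3 ∨ j = -4 := by omega
    · exact Or.inl rfl
    · omega
    · omega
    · exact Or.inr (Or.inl rfl)
    · omega

/-- All local values of `twinGlue` are dominated by one of the two central ones. -/
theorem exists_lambdaVal_twinGlue_le (hm : 2 * (1 / 4) ^ (m + 1) ≤
      (perVal - cfMap (perWord (n + 1)) (1 / 2)) / 5)
    (ha : a ∈ omegaSeqs (blockWords (twinWords (m + 1))))
    (hb : b ∈ omegaSeqs (blockWords (twinWords (m + 1)))) (j : ℤ) :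
    ∃ i ∈ ({0, -3} : Finset ℤ), lambdaVal (twinGlue n a b) j ≤ lambdaVal (twinGlue n a b) i := by
  have hα : BinBi (twinGlue n a b) := binBi_glue
    (isBin_append.2 ⟨by simp [IsBin], isBin_twinTail n⟩)
    (isBin_append.2 ⟨by simp [IsBin], isBin_twinTail n⟩)
    (binSeq_of_mem_omegaSeqs (isWordMonoid_twinBlocks _).bin ha)
    (binSeq_of_mem_omegaSeqs (isWordMonoid_twinBlocks _).bin hb)
  obtain ⟨h1, h2, h3⟩ := occursAt_twinGlue n a b
  have hmax := le_lambdaVal_of_twinWord hα h1 (by convert h3 using 2; push_cast; ring)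
    (by convert h2 using 2; ring)
  rw [show (-8 - 4 * n + 4 * (n + 1 : ℕ) + 1 : ℤ) = -3 by push_cast; ring,
    show (-8 - 4 * n + 4 * (n + 1 : ℕ) + 4 : ℤ) = 0 by push_cast; ring] at hmax
  have hone : ∀ c, IsCentre (twinGlue n a b) c →
      twinGlue n a b (c - 2) = 1 ∧ twinGlue n a b (c + 2) = 1 := fun c hc => by
    have key : ∀ {k : ℕ} {p : ℤ}, OccursAt (twinGlue n a b) (twinWord (k + 1)) p →
        c = p + 4 * (k + 1) + 1 ∨ c = p + 4 * (k + 1) + 4 →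
        twinGlue n a b (c - 2) = 1 ∧ twinGlue n a b (c + 2) = 1 := fun hp hcp => by
      obtain ⟨e1, e2, e3, e4⟩ := eq_one_of_twinWord hp
      rcases hcp with rfl | rfl
      · exact ⟨by convert e1 using 2; ring, by convert e3 using 2; ring⟩
      · exact ⟨by convert e2 using 2; ring, by convert e4 using 2; ring⟩
    rcases twinGlue_centre ha hb hc with h | h | ⟨p, hp, h⟩
    · exact key h1 (by omega)
    · exact key h1 (by omega)
    · exact key hp (by push_cast at h; exact h)
  have hdom : lambdaVal (twinGlue n a b) j ≤ (16351 + 720 * Real.sqrt 30) / 6409 +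
      (perVal - cfMap (perWord (n + 1)) (1 / 2)) / 5 → ∃ i ∈ ({0, -3} : Finset ℤ),
        lambdaVal (twinGlue n a b) j ≤ lambdaVal (twinGlue n a b) i := fun h => by
    rcases le_max_iff.1 (h.trans hmax) with h | h
    · exact ⟨-3, by simp, h⟩
    · exact ⟨0, by simp, h⟩
  by_cases hj : IsCentre (twinGlue n a b) j
  · rcases twinGlue_centre ha hb hj with rfl | rfl | ⟨p, hp, h⟩
    · exact ⟨0, by simp, le_rfl⟩
    · exact ⟨-3, by simp, le_rfl⟩
    · have hle := lambdaVal_le_of_twinWord hα hp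
      refine hdom ?_
      rcases h with rfl | rfl
      · linarith [hle.1]
      · linarith [hle.2]
  · refine hdom ?_
    have := lambdaVal_lt_of_not_centre hα hone hj
    have : (0 : ℝ) < (1 / 4) ^ (m + 1) := by positivity
    linarith

theorem lt_dimFun_of_lt {t : ℝ} (ht : (16351 + 720 * Real.sqrt 30) / 6409 < t) :
    2 * dimH K2 < dimFun t := by
  have hpow : ∀ ε > (0 : ℝ), ∃ k : ℕ, 2 * (1 / 4 : ℝ) ^ (k + 1) < ε := fun ε hε => by
    obtain ⟨k, hk⟩ := exists_pow_lt_of_lt_one (half_pos hε) (show (1 / 4 : ℝ) < 1 by norm_num)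
    refine ⟨k, ?_⟩
    rw [pow_succ]
    linarith [show (0 : ℝ) < (1 / 4) ^ k by positivity]
  obtain ⟨n, hn⟩ := hpow _ (sub_pos.2 ht)
  have hc : cfMap (perWord (n + 1)) (1 / 2) < perVal := by
    conv_rhs => rw [← cfMap_perWord_perVal (n + 1)]
    exact cfMap_lt_of_even (isBin_perWord _) (even_length_perWord _) (by norm_num) perVal_mem_Icc
      (by linarith [perVal_bounds.1])
  obtain ⟨m, hm⟩ := hpow ((perVal - cfMap (perWord (n + 1)) (1 / 2)) / 5) (by linarith)
  obtain ⟨σ, h1, h2, N, hN⟩ := exists_larger_exponent (g₀ := [1, 1, 2, 2])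
    (g₁ := [2, 2, 2, 2] ++ twinMark (m + 1) ++ [2, 2, 2, 2]) (by simp [IsBin])
    (isBin_append.2 ⟨isBin_append.2 ⟨by simp [IsBin], isBin_twinMark _⟩, by simp [IsBin]⟩)
    critExp_nonneg critExp_lt_one one_le_levelSum_critExp
  have hU := twinMark_avoiding_2222 (m + 1)
  have hU' : (twinMark (m + 1)).getLast? = some 1 := by
    rw [twinMark, ← List.append_assoc, ← List.append_assoc, List.getLast?_concat]
  rw [← ofReal_critExp]
  refine ((ENNReal.ofReal_lt_ofReal_iff (critExp_nonneg.trans_lt h1)).2 h1).trans_le ?_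
  refine le_dimFun_of_centre (isWordMonoid_twinBlocks (m + 1)) (fun u hu => ?_)
    (prefix_biUnion_markedWords hU.2 hU' hU.1 fun w hw h => ?_)
    (critExp_nonneg.trans h1.le) h2 hN (isBin_append.2 ⟨by simp [IsBin], isBin_twinTail n⟩)
    (isBin_append.2 ⟨by simp [IsBin], isBin_twinTail n⟩) (J := {0, -3}) ⟨0, by simp⟩
    (fun a ha b hb j hj => ?_) fun a ha b hb => exists_lambdaVal_twinGlue_le hm.le ha hb
  · obtain ⟨k, -, hu⟩ := Finset.mem_biUnion.1 hu
    obtain ⟨w, hw, hwb, -, rfl⟩ := mem_markedWords.1 hu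
    have e : [1, 1, 2, 2] ++ w ++ ([2, 2, 2, 2] ++ twinMark (m + 1) ++ [2, 2, 2, 2]) =
        [1, 1, 2, 2] ++ (w ++ ([2, 2, 2, 2] ++ twinMark (m + 1))) ++ [2, 2, 2, 2] := by simp
    have e' : [1, 1, 2, 2] ++ w ++ ([2, 2, 2, 2] ++ twinMark (m + 1) ++ [2, 2, 2, 2]) =
        ([1, 1, 2, 2] ++ w ++ [2, 2, 2, 2]) ++ (twinMark (m + 1) ++ [2, 2, 2, 2]) := by simp
    rw [e]
    refine marked_mem_blockWords (isBin_append.2 ⟨hwb, isBin_append.2 ⟨by simp [IsBin],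
      isBin_twinMark _⟩⟩) ?_
    rw [← e, e']
    exact twinWords_append (twinWords_of_good (good_marked hw)) (twinMark_append_mem _)
      (List.IsSuffix.trans ⟨[2, 2], rfl⟩ (List.suffix_append _ _))
  · exact hw (List.IsInfix.trans ⟨perWord (m + 1) ++ [1], [1, 2, 1] ++ (perWord (m + 1) ++ [1]),
      by simp [twinMark]⟩ h)
  · have hα : BinBi (twinGlue n a b) := binBi_glue
      (isBin_append.2 ⟨by simp [IsBin], isBin_twinTail n⟩)
      (isBin_append.2 ⟨by simp [IsBin], isBin_twinTail n⟩)
      (binSeq_of_mem_omegaSeqs (isWordMonoid_twinBlocks _).bin ha)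
      (binSeq_of_mem_omegaSeqs (isWordMonoid_twinBlocks _).bin hb)
    have hle := lambdaVal_le_of_twinWord hα (occursAt_twinGlue n a b).1
    rw [show (-8 - 4 * n + 4 * (n + 1 : ℕ) + 1 : ℤ) = -3 by push_cast; ring,
      show (-8 - 4 * n + 4 * (n + 1 : ℕ) + 4 : ℤ) = 0 by push_cast; ring] at hle
    rcases Finset.mem_insert.1 hj with rfl | hj
    · linarith [hle.2]
    · rw [Finset.mem_singleton.1 hj]
      linarith [hle.1]

end twinGlue

theorem dimFun_mono : Monotone dimFun := fun _ _ h =>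
  dimH_mono (inter_subset_inter_right _ (Iio_subset_Iio h))

/-- The level set of the dimension function at the value `2 · dim_H K₂` is
exactly the closed interval `[4√30/7, (16351+720√30)/6409]`. -/
theorem plateau_of_first_appearance_of_121 :
    dimFun ⁻¹' {2 * dimH K2} =
      Icc (4 * Real.sqrt 30 / 7) ((16351 + 720 * Real.sqrt 30) / 6409) := by
  ext t
  simp only [mem_preimage, mem_singleton_iff, mem_Icc]
  constructor
  · intro h
    refine ⟨?_, ?_⟩ <;> by_contra! ht
    · exact (dimFun_lt_of_lt ht).ne h
    · exact (lt_dimFun_of_lt ht).ne' h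
  · rintro ⟨h0, h1⟩
    exact le_antisymm ((dimFun_mono h1).trans dimFun_plateauEnd_le)
      (le_dimFun_plateauStart.trans (dimFun_mono h0))
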